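/- arXiv:1207.3703 — 6 statements merged into one kernel-verified Lean document; each statement's English description precedes it below -/
import Mathlib

section
/- Let Ω ⊂ ℝ^N be a smoothly bounded domain, λ, μ > 0, α > 0, and (u, v) ∈ C²(Ω̄)² a classical solution of the Gelfand system. Then μ ∫_Ω (e^{αu} − 1) e^{v} dx = α ∫_Ω e^{αu} |∇u|² dx = (4/α) ∫_Ω |∇(e^{αu/2} − 1)|² dx. -/
open MeasureTheory Real
open scoped RealInnerProductSpace

/-- The Laplacian of `u : ℝ^N → ℝ`, computed as the sum of second derivatives
along the standard basis directions. -/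
noncomputable def lap {N : ℕ} (u : EuclideanSpace ℝ (Fin N) → ℝ)
    (x : EuclideanSpace ℝ (Fin N)) : ℝ :=
  ∑ i : Fin N,
    fderiv ℝ (fun y => fderiv ℝ u y (EuclideanSpace.single i 1)) x (EuclideanSpace.single i 1)

/-- A (smoothly bounded) domain: a nonempty bounded open connected subset of `ℝ^N`. -/
def IsBoundedDomain {N : ℕ} (Ω : Set (EuclideanSpace ℝ (Fin N))) : Prop :=
  IsOpen Ω ∧ IsConnected Ω ∧ Bornology.IsBounded Ω

/-- `(u, v)` is a classical solution of the Gelfand system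
`-Δu = μ e^v`, `-Δv = λ e^u` in `Ω`, `u = v = 0` on `∂Ω`. -/
def IsGelfandSolution {N : ℕ} (Ω : Set (EuclideanSpace ℝ (Fin N))) (lam mu : ℝ)
    (u v : EuclideanSpace ℝ (Fin N) → ℝ) : Prop :=
  ContDiffOn ℝ 2 u (closure Ω) ∧ ContDiffOn ℝ 2 v (closure Ω) ∧
  (∀ x ∈ Ω, -lap u x = mu * exp (v x)) ∧
  (∀ x ∈ Ω, -lap v x = lam * exp (u x)) ∧
  (∀ x ∈ frontier Ω, u x = 0) ∧ (∀ x ∈ frontier Ω, v x = 0)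

/-- `(u, v)` is a stable classical solution of the Gelfand system: there exist `λ₁ ≥ 0` and
positive eigenfunctions `φ₁, ψ₁ ∈ C²(Ω̄)` of the linearized system, vanishing on `∂Ω`. -/
def IsStableGelfandSolution {N : ℕ} (Ω : Set (EuclideanSpace ℝ (Fin N))) (lam mu : ℝ)
    (u v : EuclideanSpace ℝ (Fin N) → ℝ) : Prop :=
  IsGelfandSolution Ω lam mu u v ∧
  ∃ (lam1 : ℝ) (φ₁ ψ₁ : EuclideanSpace ℝ (Fin N) → ℝ),
    0 ≤ lam1 ∧
    ContDiffOn ℝ 2 φ₁ (closure Ω) ∧ ContDiffOn ℝ 2 ψ₁ (closure Ω) ∧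
    (∀ x ∈ Ω, 0 < φ₁ x) ∧ (∀ x ∈ Ω, 0 < ψ₁ x) ∧
    (∀ x ∈ Ω, -lap φ₁ x - mu * exp (v x) * ψ₁ x = lam1 * φ₁ x) ∧
    (∀ x ∈ Ω, -lap ψ₁ x - lam * exp (u x) * φ₁ x = lam1 * ψ₁ x) ∧
    (∀ x ∈ frontier Ω, φ₁ x = 0) ∧ (∀ x ∈ frontier Ω, ψ₁ x = 0)

section GelfandHelpers
open Filter Topology Set

lemma gel_cutoff (a : ℝ) (ha : 0 < a) : ∃ h g : ℝ → ℝ, Continuous g ∧ (∀ s, 0 ≤ g s ∧ g s ≤ 1) ∧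
    (∀ s, HasDerivAt h (g s) s) ∧ (∀ s ≤ a, h s = 0) ∧ (∀ s, |h s| ≤ |s|) ∧
    (∀ s, 2 * a ≤ s → g s = 1) ∧ (∀ s, 2 * a ≤ s → |h s - s| ≤ 4 * a) := by
  let g : ℝ → ℝ := fun s => max 0 (min 1 (s / a - 1))
  have hg : Continuous g := by fun_prop
  have hg01 : ∀ s, 0 ≤ g s ∧ g s ≤ 1 := fun s => ⟨le_max_left _ _, max_le zero_le_one (min_le_left _ _)⟩
  have hg1 : ∀ s, 2 * a ≤ s → g s = 1 := by
    intro s hs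
    have : 2 ≤ s / a := by rwa [le_div_iff₀ ha]
    simp only [g]
    rw [min_eq_left (by linarith)]; norm_num
  have hg0 : ∀ s, s ≤ a → g s = 0 := by
    intro s hs
    have : s / a ≤ 1 := by rwa [div_le_one ha]
    simp only [g]
    exact max_eq_left ((min_le_right _ _).trans (by linarith))
  have habs : ∀ s, |∫ t in (0:ℝ)..s, g t| ≤ |s| := by
    intro s
    have := intervalIntegral.norm_integral_le_of_norm_le_const (a := 0) (b := s) (f := g) (C := 1)
      (fun x _ => by rw [norm_eq_abs, abs_of_nonneg (hg01 x).1]; exact (hg01 x).2)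
    simpa using this
  refine ⟨fun s => ∫ t in (0:ℝ)..s, g t, g, hg, hg01, ?_, ?_, habs, hg1, ?_⟩
  · intro s
    exact intervalIntegral.integral_hasDerivAt_right (hg.intervalIntegrable _ _)
      hg.stronglyMeasurable.stronglyMeasurableAtFilter hg.continuousAt
  · intro s hs
    show ∫ t in (0:ℝ)..s, g t = 0
    rw [intervalIntegral.integral_congr (g := fun _ => 0)]
    · simp
    · intro t ht
      have : t ≤ max 0 s := ht.2
      exact hg0 t (this.trans (max_le ha.le hs))
  · intro s hs
    show |(∫ t in (0:ℝ)..s, g t) - s| ≤ 4 * a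
    have h1 : ∫ t in (2*a)..s, g t = s - 2 * a := by
      rw [intervalIntegral.integral_congr (g := fun _ => 1)]
      · simp
      · intro t ht
        rw [uIcc_of_le hs] at ht
        exact hg1 t ht.1
    rw [← intervalIntegral.integral_add_adjacent_intervals (hg.intervalIntegrable 0 (2*a))
      (hg.intervalIntegrable (2*a) s), h1]
    have h2 := habs (2*a)
    rw [abs_of_pos (by positivity : 0 < 2 * a)] at h2
    rw [abs_le] at h2 ⊢
    constructor <;> linarith [h2.1, h2.2]

lemma gel_local {E F : Type*} [NormedAddCommGroup E] [NormedSpace ℝ E] [NormedAddCommGroup F]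
    [NormedSpace ℝ F] {n : ℕ∞} {f : E → F} {s : Set E} {x : E} (hx : x ∈ s) (hn : n ≠ ⊤)
    (h : ContDiffWithinAt ℝ (n + 1) f s x) :
    ∃ f' : E → E →L[ℝ] F, ContDiffWithinAt ℝ n f' s x ∧ 
      ∃ O ∈ 𝓝 x, ∀ y ∈ O, s ∈ 𝓝 y → f' =ᶠ[𝓝 y] fderiv ℝ f := by
  obtain ⟨t, ht, -, f', hf', hc⟩ := (contDiffWithinAt_succ_iff_hasFDerivWithinAt
    (by simpa using hn)).1 h
  rw [insert_eq_of_mem hx] at ht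
  refine ⟨f', hc.mono_of_mem_nhdsWithin ht, ?_⟩
  obtain ⟨O, hO, hxO, hOt⟩ := mem_nhdsWithin.1 ht
  refine ⟨O, hO.mem_nhds hxO, fun y hy hs => ?_⟩
  have h1 : ∀ᶠ z in 𝓝 y, t ∈ 𝓝 z := by
    rw [eventually_mem_nhds_iff]
    exact mem_of_superset (inter_mem (hO.mem_nhds hy) hs) hOt
  filter_upwards [h1] with z hz
  exact ((hf' z (mem_of_mem_nhds hz)).hasFDerivAt hz).fderiv.symm

lemma gel_bound {E : Type*} [NormedAddCommGroup E] [NormedSpace ℝ E] [ProperSpace E]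
    {Ω : Set E} (ho : IsOpen Ω)
    (hb : Bornology.IsBounded Ω) {u : E → ℝ} (hu : ContDiffOn ℝ 2 u (closure Ω)) :
    ∃ C, ∀ y ∈ Ω, ‖fderiv ℝ u y‖ ≤ C ∧ ‖fderiv ℝ (fderiv ℝ u) y‖ ≤ C := by
  have hK : IsCompact (closure Ω) := hb.isCompact_closure
  have key : ∃ C, ∀ y ∈ closure Ω, y ∈ Ω → ‖fderiv ℝ u y‖ ≤ C ∧ ‖fderiv ℝ (fderiv ℝ u) y‖ ≤ C := by
    refine hK.induction_on (p := fun s => ∃ C, ∀ y ∈ s, y ∈ Ω → ‖fderiv ℝ u y‖ ≤ C ∧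
      ‖fderiv ℝ (fderiv ℝ u) y‖ ≤ C) ⟨0, by simp⟩ ?_ ?_ ?_
    · rintro s t hst ⟨C, hC⟩
      exact ⟨C, fun y hy => hC y (hst hy)⟩
    · rintro s t ⟨C, hC⟩ ⟨D, hD⟩
      refine ⟨max C D, fun y hy hyΩ => ?_⟩
      rcases hy with hy | hy
      · exact ⟨(hC y hy hyΩ).1.trans (le_max_left _ _), (hC y hy hyΩ).2.trans (le_max_left _ _)⟩
      · exact ⟨(hD y hy hyΩ).1.trans (le_max_right _ _), (hD y hy hyΩ).2.trans (le_max_right _ _)⟩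
    · intro x hx
      obtain ⟨f', hf', O, hO, h1⟩ := gel_local (n := 1) hx (by simp) (by
        have := hu x hx
        norm_num
        exact this)
      obtain ⟨f'', hf'', O', hO', h2⟩ := gel_local (n := 0) hx (by simp) (by simpa using hf')
      have c1 := hf'.continuousWithinAt.norm
      have c2 := hf''.continuousWithinAt.norm
      have b1 := c1.eventually (eventually_le_nhds (lt_add_one _))
      have b2 := c2.eventually (eventually_le_nhds (lt_add_one _))
      refine ⟨_, inter_mem (inter_mem b1 b2) (mem_nhdsWithin_of_mem_nhds (inter_mem hO hO')),
        max (‖f' x‖ + 1) (‖f'' x‖ + 1), ?_⟩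
      rintro y ⟨⟨hy1, hy2⟩, hyO, hyO'⟩ hyΩ
      have hn : closure Ω ∈ 𝓝 y := mem_of_superset (ho.mem_nhds hyΩ) subset_closure
      have e1 := h1 y hyO hn
      have e2 := h2 y hyO' hn
      rw [← e1.fderiv_eq, ← e1.eq_of_nhds, ← e2.eq_of_nhds]
      exact ⟨hy1.trans (le_max_left _ _), hy2.trans (le_max_right _ _)⟩
  obtain ⟨C, hC⟩ := key
  exact ⟨C, fun y hy => hC y (subset_closure hy) hy⟩

lemma gel_integrable {E : Type*} [NormedAddCommGroup E] [NormedSpace ℝ E] [MeasureSpace E] [BorelSpace E]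
    [ProperSpace E] [IsFiniteMeasureOnCompacts (volume : Measure E)] {Ω : Set E} (ho : IsOpen Ω)
    (hb : Bornology.IsBounded Ω) {f : E → ℝ} (hf : ContinuousOn f Ω) (C : ℝ)
    (hC : ∀ x ∈ Ω, ‖f x‖ ≤ C) : IntegrableOn f Ω := by
  have : IsFiniteMeasure (volume.restrict Ω) := ⟨by simpa using hb.measure_lt_top⟩
  exact Integrable.of_bound (hf.aestronglyMeasurable ho.measurableSet) C
    (ae_restrict_of_forall_mem ho.measurableSet hC)

/-- integral of a derivative of a function vanishing near the boundary -/
lemma gel_div {N : ℕ} {Ω : Set (EuclideanSpace ℝ (Fin N))} (ho : IsOpen Ω)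
    {f f' : EuclideanSpace ℝ (Fin N) → ℝ} (e : EuclideanSpace ℝ (Fin N))
    (hf : IntegrableOn f Ω) (hf' : IntegrableOn f' Ω)
    (hd : ∀ x ∈ Ω, HasLineDerivAt ℝ f (f' x) x e)
    (hz : ∀ x ∉ Ω, ∀ᶠ y in 𝓝 x, y ∈ Ω → f y = 0) :
    ∫ x in Ω, f' x = 0 := by
  have hm := ho.measurableSet
  have hD : ∀ x, HasLineDerivAt ℝ (Ω.indicator f) (Ω.indicator f' x) x e := by
    intro x
    by_cases hx : x ∈ Ω
    · rw [indicator_of_mem hx]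
      refine (hd x hx).congr_of_eventuallyEq ?_
      filter_upwards [ho.mem_nhds hx] with y hy
      exact indicator_of_mem hy _
    · rw [indicator_of_notMem hx]
      have : HasLineDerivAt ℝ (fun _ => (0:ℝ)) 0 x e := by
        simpa using (hasFDerivAt_const (𝕜 := ℝ) (0:ℝ) x).hasLineDerivAt e
      refine this.congr_of_eventuallyEq ?_
      filter_upwards [hz x hx] with y hy
      by_cases hyΩ : y ∈ Ω
      · rw [indicator_of_mem hyΩ, hy hyΩ]
      · rw [indicator_of_notMem hyΩ]
  have h1 : HasLineDerivAt ℝ (fun _ : EuclideanSpace ℝ (Fin N) => (1:ℝ)) 0 0 e := by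
    simpa using (hasFDerivAt_const (𝕜 := ℝ) (1:ℝ) (0 : EuclideanSpace ℝ (Fin N))).hasLineDerivAt e
  have := integral_bilinear_hasLineDerivAt_right_eq_neg_left_of_integrable
    (μ := (volume : Measure (EuclideanSpace ℝ (Fin N))))
    (f := fun _ => (1:ℝ)) (f' := fun _ => 0) (g := Ω.indicator f) (g' := Ω.indicator f')
    (v := e) (B := ContinuousLinearMap.mul ℝ ℝ) (by simp) 
    (by simpa using (integrable_indicator_iff hm).2 hf') 
    (by simpa using (integrable_indicator_iff hm).2 hf) 
    (fun x _ => by simpa using (hasFDerivAt_const (𝕜 := ℝ) (1:ℝ) x).hasLineDerivAt e) 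
    (fun x _ => hD x)
  simpa [integral_indicator hm] using this

/-- No interior local minimum in a direction where the second derivative is negative. -/
lemma gel_min {E : Type*} [NormedAddCommGroup E] [NormedSpace ℝ E] {u : E → ℝ} {x e : E}
    (hu : ContDiffAt ℝ 2 u x) (hm : IsLocalMin u x) :
    0 ≤ fderiv ℝ (fun y => fderiv ℝ u y e) x e := by
  by_contra! hneg
  let l : ℝ → E := fun t => x + t • e
  have hl : ∀ t, HasDerivAt l e t := fun t => by
    simpa [l] using ((hasDerivAt_id t).smul_const e).const_add x
  have l0 : l 0 = x := by simp [l]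
  have hlt : Tendsto l (𝓝 0) (𝓝 x) := by
    have := (hl 0).continuousAt.tendsto
    rwa [l0] at this
  have hdiff : ∀ᶠ y in 𝓝 x, DifferentiableAt ℝ u y := by
    filter_upwards [hu.eventually (by simp)] with y hy
    exact hy.differentiableAt (by simp)
  have hd1 : deriv (u ∘ l) =ᶠ[𝓝 0] fun t => fderiv ℝ u (l t) e := by
    filter_upwards [hlt.eventually hdiff] with t ht
    exact (ht.hasFDerivAt.comp_hasDerivAt t (hl t)).deriv
  have hD : DifferentiableAt ℝ (fun y => fderiv ℝ u y e) x := by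
    have : ContDiffAt ℝ 1 (fderiv ℝ u) x := hu.fderiv_right (by norm_num)
    exact (this.differentiableAt (by simp)).clm_apply (differentiableAt_const e)
  have hd2 : deriv (deriv (u ∘ l)) 0 = fderiv ℝ (fun y => fderiv ℝ u y e) x e := by
    rw [hd1.deriv_eq]
    have h := hD.hasFDerivAt
    rw [← l0] at h
    have h2 := (h.comp_hasDerivAt 0 (hl 0)).deriv
    rw [l0] at h2
    exact h2
  have hmin : IsLocalMin (u ∘ l) 0 := by
    have : ∀ᶠ t in 𝓝 0, u x ≤ u (l t) := hlt.eventually hm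
    filter_upwards [this] with t ht
    simpa [l0] using ht
  have hmax : IsLocalMax (u ∘ l) 0 := by
    apply isLocalMax_of_deriv_deriv_neg
    · rwa [hd2]
    · exact hmin.deriv_eq_zero
    · refine ContinuousAt.comp ?_ (hl 0).continuousAt
      rw [l0]; exact hu.continuousAt
  have hconst : (u ∘ l) =ᶠ[𝓝 0] fun _ => (u ∘ l) 0 := by
    filter_upwards [hmin, hmax] with t h1 h2
    exact le_antisymm h2 h1
  have := hconst.deriv.deriv_eq
  rw [hd2] at this
  simp at this
  linarith

lemma gel_norm {N : ℕ} (u : EuclideanSpace ℝ (Fin N) → ℝ) (x : EuclideanSpace ℝ (Fin N)) :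
    ‖gradient u x‖ ^ 2 = ∑ i, (fderiv ℝ u x (EuclideanSpace.single i 1)) ^ 2 := by
  rw [EuclideanSpace.norm_sq_eq]
  refine Finset.sum_congr rfl fun i _ => ?_
  have : fderiv ℝ u x (EuclideanSpace.single i 1) = ⟪gradient u x, EuclideanSpace.single i 1⟫ := by
    simp [gradient]
  rw [this, EuclideanSpace.inner_single_right]
  simp

lemma gel_pos {N : ℕ}
    (Ω : Set (EuclideanSpace ℝ (Fin N))) (hΩ : IsBoundedDomain Ω)
    (lam mu : ℝ) (hmu : 0 < mu)
    (u v : EuclideanSpace ℝ (Fin N) → ℝ)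
    (huv : IsGelfandSolution Ω lam mu u v) : ∀ x ∈ Ω, 0 < u x := by
  obtain ⟨ho, hconn, hb⟩ := hΩ
  obtain ⟨hu, hv, hpu, hpv, hu0, hv0⟩ := huv
  have hK : IsCompact (closure Ω) := hb.isCompact_closure
  obtain ⟨x₀, hx₀, hmin⟩ := hK.exists_isMinOn hconn.nonempty.closure hu.continuousOn
  have hno : ∀ x ∈ Ω, ¬ IsMinOn u (closure Ω) x := by
    intro x hx hm
    have hn : closure Ω ∈ 𝓝 x := mem_of_superset (ho.mem_nhds hx) subset_closure
    have hc : ContDiffAt ℝ 2 u x := (hu x (subset_closure hx)).contDiffAt hn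
    have h0 : 0 ≤ lap u x := Finset.sum_nonneg fun i _ => gel_min hc (hm.isLocalMin hn)
    have := hpu x hx
    have : 0 < mu * exp (v x) := by positivity
    linarith
  have hfr : x₀ ∈ frontier Ω := by
    rw [frontier, ho.interior_eq]
    exact ⟨hx₀, fun h => hno x₀ h hmin⟩
  have h0 := hu0 x₀ hfr
  intro x hx
  by_contra! hle
  refine hno x hx fun y hy => ?_
  have := hmin hy
  simp only [mem_setOf_eq] at this ⊢
  linarith

lemma gel_main {N : ℕ}
    (Ω : Set (EuclideanSpace ℝ (Fin N))) (hΩ : IsBoundedDomain Ω)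
    (lam mu : ℝ) (hmu : 0 < mu)
    (α : ℝ) (hα : 0 < α)
    (u v : EuclideanSpace ℝ (Fin N) → ℝ)
    (huv : IsGelfandSolution Ω lam mu u v) :
    mu * ∫ x in Ω, (exp (α * u x) - 1) * exp (v x) =
        α * ∫ x in Ω, exp (α * u x) * ‖gradient u x‖ ^ 2 := by
  have hpos := gel_pos Ω hΩ lam mu hmu u v huv
  obtain ⟨ho, hconn, hb⟩ := hΩ
  obtain ⟨hu, hv, hpu, hpv, hu0, hv0⟩ := huv
  have hK : IsCompact (closure Ω) := hb.isCompact_closure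
  have hm := ho.measurableSet
  have hnh : ∀ x ∈ Ω, closure Ω ∈ 𝓝 x := fun x hx =>
    mem_of_superset (ho.mem_nhds hx) subset_closure
  have hC2 : ∀ x ∈ Ω, ContDiffAt ℝ 2 u x := fun x hx => (hu x (subset_closure hx)).contDiffAt (hnh x hx)
  obtain ⟨C, hC⟩ := gel_bound ho hb hu
  have hC0 : 0 ≤ C := by
    obtain ⟨x, hx⟩ := hconn.nonempty
    exact (norm_nonneg _).trans (hC x hx).1
  let D : Fin N → EuclideanSpace ℝ (Fin N) → ℝ :=
    fun i x => fderiv ℝ u x (EuclideanSpace.single i 1)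
  let DD : Fin N → EuclideanSpace ℝ (Fin N) → ℝ :=
    fun i x => fderiv ℝ (D i) x (EuclideanSpace.single i 1)
  let w : EuclideanSpace ℝ (Fin N) → ℝ := fun x => exp (α * u x) - 1
  have hDc : ∀ i, ∀ x ∈ Ω, ContDiffAt ℝ 1 (D i) x := fun i x hx =>
    ((hC2 x hx).fderiv_right (m := 1) (by norm_num)).clm_apply contDiffAt_const
  have hDcont : ∀ i, ContinuousOn (D i) Ω := fun i x hx =>
    (hDc i x hx).continuousAt.continuousWithinAt
  have hDDcont : ∀ i, ContinuousOn (DD i) Ω := fun i x hx =>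
    (((hDc i x hx).fderiv_right (m := 0) (by norm_num)).clm_apply
      contDiffAt_const).continuousAt.continuousWithinAt
  have hDb : ∀ i, ∀ x ∈ Ω, |D i x| ≤ C := by
    intro i x hx
    have := (fderiv ℝ u x).le_opNorm (EuclideanSpace.single i 1)
    simp only [EuclideanSpace.norm_single, norm_one, mul_one] at this
    exact this.trans (hC x hx).1
  have hDDb : ∀ i, ∀ x ∈ Ω, |DD i x| ≤ C := by
    intro i x hx
    have hd : DifferentiableAt ℝ (fderiv ℝ u) x :=
      ((hC2 x hx).fderiv_right (m := 1) (by norm_num)).differentiableAt (by simp)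
    have e : DD i x = fderiv ℝ (fderiv ℝ u) x (EuclideanSpace.single i 1)
        (EuclideanSpace.single i 1) := by
      simp only [DD, D]
      rw [fderiv_clm_apply hd (differentiableAt_const _)]
      simp
    have h1 := (fderiv ℝ (fderiv ℝ u) x).le_opNorm (EuclideanSpace.single i 1)
    have h2 := (fderiv ℝ (fderiv ℝ u) x (EuclideanSpace.single i 1)).le_opNorm
      (EuclideanSpace.single i 1)
    simp only [EuclideanSpace.norm_single, norm_one, mul_one] at h1 h2
    rw [e]
    exact h2.trans (h1.trans (hC x hx).2)
  have hwcl : ContinuousOn w (closure Ω) := by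
    have := hu.continuousOn
    simp only [w]
    fun_prop
  have hwc : ContinuousOn w Ω := hwcl.mono subset_closure
  have huc : ContinuousOn u Ω := hu.continuousOn.mono subset_closure
  have hvc : ContinuousOn v Ω := hv.continuousOn.mono subset_closure
  obtain ⟨M, hM⟩ := hK.exists_bound_of_continuousOn hwcl
  have hM' : ∀ x ∈ Ω, |w x| ≤ M := fun x hx => hM x (subset_closure hx)
  have hM0 : 0 ≤ M := by
    obtain ⟨x, hx⟩ := hconn.nonempty
    exact (abs_nonneg _).trans (hM' x hx)
  have hwp : ∀ x ∈ Ω, 0 < w x := by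
    intro x hx
    have := hpos x hx
    have : 1 < exp (α * u x) := by
      rw [Real.one_lt_exp_iff]; positivity
    simp only [w]; linarith
  have hw0 : ∀ x ∈ frontier Ω, w x = 0 := by
    intro x hx
    simp [w, hu0 x hx]
  have hexp : ∀ x, exp (α * u x) = w x + 1 := fun x => by simp [w]
  have hexpb : ∀ x ∈ Ω, |exp (α * u x)| ≤ M + 1 := by
    intro x hx
    rw [hexp, abs_of_pos (by linarith [hwp x hx])]
    linarith [le_abs_self (w x), hM' x hx]
  have hexpc : ContinuousOn (fun x => exp (α * u x)) Ω := by fun_prop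
  -- the test functions
  have ha : ∀ n : ℕ, (0:ℝ) < 1 / ((n:ℝ) + 1) := fun n => by positivity
  choose h g hg hg01 hh hhz hhb hg1 hh1 using fun n : ℕ => gel_cutoff (1 / ((n:ℝ) + 1)) (ha n)
  have hhc : ∀ n, Continuous (h n) := fun n =>
    continuous_iff_continuousAt.2 fun s => (hh n s).continuousAt
  have hgb : ∀ n s, |g n s| ≤ 1 := fun n s => by
    rw [abs_of_nonneg (hg01 n s).1]; exact (hg01 n s).2
  have hhM : ∀ n, ∀ x ∈ Ω, |h n (w x)| ≤ M := fun n x hx => (hhb n _).trans (hM' x hx)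
  let T : ℕ → Fin N → EuclideanSpace ℝ (Fin N) → ℝ := fun n i x =>
    g n (w x) * (exp (α * u x) * α * D i x) * D i x + h n (w x) * DD i x
  have hTc : ∀ n i, ContinuousOn (T n i) Ω := by
    intro n i
    have h1 := hDcont i
    have h2 := hDDcont i
    have h3 := (hg n).comp_continuousOn hwc
    have h4 := (hhc n).comp_continuousOn hwc
    exact ((h3.mul ((hexpc.mul continuousOn_const).mul h1)).mul h1).add (h4.mul h2)
  have hTb : ∀ n i, ∀ x ∈ Ω, ‖T n i x‖ ≤ 1 * ((M + 1) * α * C) * C + M * C := by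
    intro n i x hx
    refine (norm_add_le _ _).trans ?_
    simp only [norm_mul, norm_eq_abs, abs_of_pos hα]
    have := hgb n (w x)
    have := hexpb x hx
    have := hDb i x hx
    have := hDDb i x hx
    have := hhM n x hx
    gcongr
  have hTi : ∀ n i, IntegrableOn (T n i) Ω := fun n i =>
    gel_integrable ho hb (hTc n i) _ (hTb n i)
  have hT0 : ∀ n i, ∫ x in Ω, T n i x = 0 := by
    intro n i
    refine gel_div ho (f := fun x => h n (w x) * D i x) (EuclideanSpace.single i 1) ?_ (hTi n i) ?_ ?_
    · refine gel_integrable ho hb (((hhc n).comp_continuousOn hwc).mul (hDcont i)) (M * C) ?_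
      intro x hx
      rw [norm_mul]
      exact mul_le_mul (hhM n x hx) (hDb i x hx) (norm_nonneg _) hM0
    · intro x hx
      have h1 : HasFDerivAt u (fderiv ℝ u x) x :=
        ((hC2 x hx).differentiableAt (by simp)).hasFDerivAt
      have h2 := (((h1.const_mul α).exp).sub_const 1)
      have h3 : HasFDerivAt (fun x => h n (w x)) _ x := (hh n (w x)).comp_hasFDerivAt x h2
      have h4 : HasFDerivAt (D i) (fderiv ℝ (D i) x) x :=
        ((hDc i x hx).differentiableAt (by simp)).hasFDerivAt
      have h5 := (h3.mul h4).hasLineDerivAt (EuclideanSpace.single i 1)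
      refine HasDerivAt.congr_deriv h5 ?_
      simp [T, DD, D]
      ring
    · intro x hx
      by_cases hxc : x ∈ closure Ω
      · have hfr : x ∈ frontier Ω := by
          rw [frontier, ho.interior_eq]; exact ⟨hxc, hx⟩
        have h1 : Tendsto w (𝓝[closure Ω] x) (𝓝 (w x)) := hwcl x hxc
        rw [hw0 x hfr] at h1
        have h2 := h1.eventually (eventually_le_nhds (ha n))
        filter_upwards [eventually_nhdsWithin_iff.1 h2] with y hy hyΩ
        rw [hhz n _ (hy (subset_closure hyΩ)), zero_mul]
      · filter_upwards [isClosed_closure.isOpen_compl.mem_nhds hxc] with y hy hyΩ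
        exact absurd (subset_closure hyΩ) hy
  have hgrad : ∀ x, ‖gradient u x‖ ^ 2 = ∑ i, (D i x) ^ 2 := fun x => gel_norm u x
  have hlap : ∀ x, lap u x = ∑ i, DD i x := fun x => rfl
  have hlim : Tendsto (fun n => ∫ x in Ω, ∑ i, T n i x) atTop
      (𝓝 (∫ x in Ω, (α * (exp (α * u x) * ‖gradient u x‖ ^ 2) -
        mu * ((exp (α * u x) - 1) * exp (v x))))) := by
    refine tendsto_integral_of_dominated_convergence
      (fun _ => ∑ i : Fin N, (1 * ((M + 1) * α * C) * C + M * C)) ?_ ?_ ?_ ?_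
    · intro n
      exact (integrable_finsetSum _ fun i _ => hTi n i).aestronglyMeasurable
    · exact gel_integrable ho hb continuousOn_const _ (fun x _ => le_rfl)
    · intro n
      refine ae_restrict_of_forall_mem hm fun x hx => ?_
      exact norm_sum_le_of_le _ fun i _ => hTb n i x hx
    · refine ae_restrict_of_forall_mem hm fun x hx => ?_
      have hw := hwp x hx
      have ht : Tendsto (fun n : ℕ => 1 / ((n:ℝ) + 1)) atTop (𝓝 0) :=
        tendsto_one_div_add_atTop_nhds_zero_nat
      have hev : ∀ᶠ n : ℕ in atTop, 2 * (1 / ((n:ℝ) + 1)) ≤ w x := by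
        have : Tendsto (fun n : ℕ => 2 * (1 / ((n:ℝ) + 1))) atTop (𝓝 0) := by
          simpa using ht.const_mul 2
        exact this.eventually (eventually_le_nhds hw)
      have hgt : Tendsto (fun n => g n (w x)) atTop (𝓝 1) := by
        refine tendsto_const_nhds.congr' ?_
        filter_upwards [hev] with n hn
        exact (hg1 n _ hn).symm
      have hht : Tendsto (fun n => h n (w x)) atTop (𝓝 (w x)) := by
        rw [tendsto_iff_norm_sub_tendsto_zero]
        refine squeeze_zero' (Eventually.of_forall fun n => norm_nonneg _) ?_
          (by simpa only [mul_zero] using ht.const_mul 4)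
        filter_upwards [hev] with n hn
        exact hh1 n _ hn
      have hsum : Tendsto (fun n => ∑ i, T n i x) atTop
          (𝓝 (∑ i, (1 * (exp (α * u x) * α * D i x) * D i x + w x * DD i x))) :=
        tendsto_finsetSum _ fun i _ =>
          ((hgt.mul_const _).mul_const _).add (hht.mul_const _)
      convert hsum using 2
      rw [Finset.sum_add_distrib, ← Finset.mul_sum, ← hlap, hgrad]
      have := hpu x hx
      have e1 : ∑ i, 1 * (exp (α * u x) * α * D i x) * D i x =
          α * (exp (α * u x) * ∑ i, D i x ^ 2) := by
        rw [Finset.mul_sum, Finset.mul_sum]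
        exact Finset.sum_congr rfl fun i _ => by ring
      rw [e1, show lap u x = - (mu * exp (v x)) by linarith]
      simp only [w]; ring
  have hzero : ∀ n, ∫ x in Ω, ∑ i, T n i x = 0 := by
    intro n
    rw [integral_finsetSum _ fun i _ => hTi n i]
    exact Finset.sum_eq_zero fun i _ => hT0 n i
  simp only [hzero] at hlim
  have hfin := tendsto_nhds_unique hlim tendsto_const_nhds
  have hI1 : IntegrableOn (fun x => α * (exp (α * u x) * ‖gradient u x‖ ^ 2)) Ω := by
    simp only [hgrad]
    refine gel_integrable ho hb (C := α * ((M + 1) * ∑ i : Fin N, C ^ 2)) ?_ ?_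
    · exact continuousOn_const.mul (hexpc.mul (continuousOn_finsetSum _ fun i _ => (hDcont i).pow 2))
    · intro x hx
      rw [norm_mul, norm_mul, norm_eq_abs α, abs_of_pos hα]
      have h1 := hexpb x hx
      have h2 : ‖∑ i, D i x ^ 2‖ ≤ ∑ i : Fin N, C ^ 2 := norm_sum_le_of_le _ fun i _ => by
        rw [norm_pow]
        exact pow_le_pow_left₀ (norm_nonneg _) (hDb i x hx) 2
      exact mul_le_mul_of_nonneg_left (mul_le_mul h1 h2 (norm_nonneg _) (by linarith)) hα.le
  have hI2 : IntegrableOn (fun x => mu * ((exp (α * u x) - 1) * exp (v x))) Ω := by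
    have hcl : ContinuousOn (fun x => mu * ((exp (α * u x) - 1) * exp (v x))) (closure Ω) := by
      have := hu.continuousOn
      have := hv.continuousOn
      fun_prop
    exact (hcl.integrableOn_compact hK).mono_set subset_closure
  rw [integral_sub hI1 hI2, integral_const_mul, integral_const_mul] at hfin
  linarith

end GelfandHelpers

/-- For a classical solution of the Gelfand system and `α > 0`,
`μ ∫ (e^{αu} − 1) e^v = α ∫ e^{αu} |∇u|² = (4/α) ∫ |∇(e^{αu/2} − 1)|²`. -/
theorem integration_by_parts_alpha {N : ℕ}
    (Ω : Set (EuclideanSpace ℝ (Fin N))) (hΩ : IsBoundedDomain Ω)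
    (lam mu : ℝ) (hlam : 0 < lam) (hmu : 0 < mu)
    (α : ℝ) (hα : 0 < α)
    (u v : EuclideanSpace ℝ (Fin N) → ℝ)
    (huv : IsGelfandSolution Ω lam mu u v) :
    mu * ∫ x in Ω, (exp (α * u x) - 1) * exp (v x) =
        α * ∫ x in Ω, exp (α * u x) * ‖gradient u x‖ ^ 2 ∧
    α * ∫ x in Ω, exp (α * u x) * ‖gradient u x‖ ^ 2 =
        (4 / α) * ∫ x in Ω, ‖gradient (fun y => exp (α * u y / 2) - 1) x‖ ^ 2 := by
  refine ⟨gel_main Ω hΩ lam mu hmu α hα u v huv, ?_⟩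
  rw [← integral_const_mul, ← integral_const_mul]
  refine setIntegral_congr_fun hΩ.1.measurableSet fun x hx => ?_
  have hn : closure Ω ∈ nhds x := Filter.mem_of_superset (hΩ.1.mem_nhds hx) subset_closure
  have h1 : HasFDerivAt u (fderiv ℝ u x) x :=
    (((huv.1 x (subset_closure hx)).contDiffAt hn).differentiableAt (by simp)).hasFDerivAt
  have h2 : HasFDerivAt (fun y => exp (α * u y / 2) - 1)
      (exp (α * u x / 2) • (α / 2) • fderiv ℝ u x) x := by
    have h3 := ((h1.const_mul (α / 2)).exp).sub_const 1
    have e : ∀ y, α / 2 * u y = α * u y / 2 := fun y => by ring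
    simpa only [e] using h3
  have h4 : gradient (fun y => exp (α * u y / 2) - 1) x =
      (exp (α * u x / 2) * (α / 2)) • gradient u x := by
    simp only [gradient, h2.fderiv, smul_smul, map_smul]
  have h5 : exp (α * u x) = exp (α * u x / 2) ^ 2 := by
    rw [← Real.exp_nat_mul]; congr 1; push_cast; ring
  simp only [h4, norm_smul, mul_pow, h5, Real.norm_eq_abs, sq_abs]
  field_simp
  ring
end

section
/- Let Ω ⊂ ℝ^N be a smoothly bounded domain, λ, μ > 0, α > 1/2, and (u, v) a stable classical solution of the Gelfand system. Then √(λμ) ∫_Ω e^{(u+v)/2} (e^{αu/2} − 1)² dx ≤ (α/4) μ ∫_Ω (e^{αu} − 1) e^{v} dx. -/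
open MeasureTheory Real
open scoped RealInnerProductSpace

open Filter Topology Set

/-- A function vanishing off a compact subset of `Ω` and `C¹` on `Ω` has directional derivatives
of zero mean. -/
lemma aux_div {N : ℕ} {Ω K : Set (EuclideanSpace ℝ (Fin N))} (hΩ : IsOpen Ω)
    (hK : IsCompact K) (hKΩ : K ⊆ Ω) (f : EuclideanSpace ℝ (Fin N) → ℝ)
    (hf : ContDiffOn ℝ 1 f Ω) (hf0 : ∀ x, x ∉ K → f x = 0) (e : EuclideanSpace ℝ (Fin N)) :
    IntegrableOn (fun x => fderiv ℝ f x e) Ω ∧ ∫ x in Ω, fderiv ℝ f x e = 0 := by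
  have hfc : ContDiff ℝ 1 f := by
    rw [contDiff_iff_contDiffAt]
    intro x
    by_cases hx : x ∈ Ω
    · exact hf.contDiffAt (hΩ.mem_nhds hx)
    · have hxK : x ∈ Kᶜ := fun h => hx (hKΩ h)
      have : f =ᶠ[𝓝 x] fun _ => 0 := by
        filter_upwards [hK.isClosed.isOpen_compl.mem_nhds hxK] with y hy using hf0 y hy
      exact contDiffAt_const.congr_of_eventuallyEq this
  have hsupp : HasCompactSupport f := HasCompactSupport.intro hK hf0
  have hd : Continuous (fun x => fderiv ℝ f x e) :=
    (hfc.continuous_fderiv one_ne_zero).clm_apply continuous_const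
  have hds : HasCompactSupport (fun x => fderiv ℝ f x e) := hsupp.fderiv_apply ℝ e
  have hi : Integrable (fun x => fderiv ℝ f x e) := hd.integrable_of_hasCompactSupport hds
  refine ⟨hi.integrableOn, ?_⟩
  have h1 : ∫ x, (fun _ => (1:ℝ)) x * fderiv ℝ f x e
      = - ∫ x, fderiv ℝ (fun _ : EuclideanSpace ℝ (Fin N) => (1:ℝ)) x e * f x := by
    apply integral_mul_fderiv_eq_neg_fderiv_mul_of_integrable
    · simp
    · simpa using hi
    · simpa using hfc.continuous.integrable_of_hasCompactSupport hsupp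
    · intro x _; exact differentiableAt_const _
    · intro x _; exact hfc.differentiable one_ne_zero x
  have h2 : ∫ x, fderiv ℝ f x e = 0 := by simpa using h1
  rw [setIntegral_eq_integral_of_forall_compl_eq_zero, h2]
  intro x hx
  have hxK : x ∈ Kᶜ := fun h => hx (hKΩ h)
  have : f =ᶠ[𝓝 x] fun _ => 0 := by
    filter_upwards [hK.isClosed.isOpen_compl.mem_nhds hxK] with y hy using hf0 y hy
  simp [this.fderiv_eq]

/-- Pointwise computation of one diagonal derivative, with the completed squares dropped. -/
lemma aux_point {N : ℕ} {Ω : Set (EuclideanSpace ℝ (Fin N))} (hΩ : IsOpen Ω)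
    (u φ ψ : EuclideanSpace ℝ (Fin N) → ℝ) (hu : ContDiffOn ℝ 2 u Ω)
    (hφ : ContDiffOn ℝ 2 φ Ω) (hψ : ContDiffOn ℝ 2 ψ Ω)
    (hφp : ∀ x ∈ Ω, 0 < φ x) (hψp : ∀ x ∈ Ω, 0 < ψ x)
    (G H g : ℝ → ℝ) (hG : ∀ t, HasDerivAt G (g t) t) (hH : ∀ t, HasDerivAt H (g t ^ 2) t)
    (e x : EuclideanSpace ℝ (Fin N)) (hx : x ∈ Ω) :
    fderiv ℝ (Ω.indicator fun y => G (u y) ^ 2 * (fderiv ℝ φ y e / φ y + fderiv ℝ ψ y e / ψ y)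
      - 2 * (H (u y) * fderiv ℝ u y e)) x e ≤
    G (u x) ^ 2 * (fderiv ℝ (fun y => fderiv ℝ φ y e) x e / φ x
      + fderiv ℝ (fun y => fderiv ℝ ψ y e) x e / ψ x)
      - 2 * H (u x) * fderiv ℝ (fun y => fderiv ℝ u y e) x e := by
  have key : ∀ w : EuclideanSpace ℝ (Fin N) → ℝ, ContDiffOn ℝ 2 w Ω →
      HasDerivAt (fun t : ℝ => w (x + t • e)) (fderiv ℝ w x e) 0 ∧
      HasDerivAt (fun t : ℝ => fderiv ℝ w (x + t • e) e)
        (fderiv ℝ (fun y => fderiv ℝ w y e) x e) 0 := by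
    intro w hw
    have h1 := hw.contDiffAt (hΩ.mem_nhds hx)
    have h2 : ContDiffAt ℝ 1 (fderiv ℝ w) x := h1.fderiv_right (by norm_num)
    have h3 : DifferentiableAt ℝ (fun y => fderiv ℝ w y e) x :=
      (h2.differentiableAt one_ne_zero).clm_apply (differentiableAt_const e)
    exact ⟨(h1.differentiableAt two_ne_zero).hasFDerivAt.hasLineDerivAt e,
      h3.hasFDerivAt.hasLineDerivAt e⟩
  obtain ⟨u1, u2⟩ := key u hu
  obtain ⟨p1, p2⟩ := key φ hφ
  obtain ⟨q1, q2⟩ := key ψ hψ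
  have hφ0 : φ x ≠ 0 := (hφp x hx).ne'
  have hψ0 : ψ x ≠ 0 := (hψp x hx).ne'
  set F : EuclideanSpace ℝ (Fin N) → ℝ := fun y =>
    G (u y) ^ 2 * (fderiv ℝ φ y e / φ y + fderiv ℝ ψ y e / ψ y)
      - 2 * (H (u y) * fderiv ℝ u y e) with hF
  have hdiffF : DifferentiableAt ℝ F x := by
    have d : ∀ w : EuclideanSpace ℝ (Fin N) → ℝ, ContDiffOn ℝ 2 w Ω →
      DifferentiableAt ℝ w x ∧ DifferentiableAt ℝ (fun y => fderiv ℝ w y e) x := by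
      intro w hw
      have h1 := hw.contDiffAt (hΩ.mem_nhds hx)
      have h2 : ContDiffAt ℝ 1 (fderiv ℝ w) x := h1.fderiv_right (by norm_num)
      exact ⟨h1.differentiableAt two_ne_zero,
        (h2.differentiableAt one_ne_zero).clm_apply (differentiableAt_const e)⟩
    have a1 : DifferentiableAt ℝ (fun y => G (u y)) x :=
      (hG (u x)).differentiableAt.comp x (d u hu).1
    have a2 : DifferentiableAt ℝ (fun y => H (u y)) x :=
      (hH (u x)).differentiableAt.comp x (d u hu).1
    have b1 : DifferentiableAt ℝ (fun y => fderiv ℝ φ y e / φ y) x := by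
      simp only [div_eq_mul_inv]
      exact (d φ hφ).2.mul ((d φ hφ).1.inv hφ0)
    have b2 : DifferentiableAt ℝ (fun y => fderiv ℝ ψ y e / ψ y) x := by
      simp only [div_eq_mul_inv]
      exact (d ψ hψ).2.mul ((d ψ hψ).1.inv hψ0)
    exact ((a1.pow 2).mul (b1.add b2)).sub ((a2.mul (d u hu).2).const_mul 2)
  have heq : Ω.indicator F =ᶠ[𝓝 x] F := by
    filter_upwards [hΩ.mem_nhds hx] with y hy using indicator_of_mem hy F
  rw [heq.fderiv_eq]
  have hl : HasDerivAt (fun t : ℝ => F (x + t • e)) (fderiv ℝ F x e) 0 :=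
    hdiffF.hasFDerivAt.hasLineDerivAt e
  have hGu : HasDerivAt (fun t : ℝ => G (u (x + t • e))) (g (u x) * fderiv ℝ u x e) 0 := by
    have := hG (u (x + (0:ℝ) • e))
    have := HasDerivAt.comp (0:ℝ) this u1
    simp only [zero_smul, add_zero] at this
    exact this
  have hHu : HasDerivAt (fun t : ℝ => H (u (x + t • e))) (g (u x) ^ 2 * fderiv ℝ u x e) 0 := by
    have := hH (u (x + (0:ℝ) • e))
    have := HasDerivAt.comp (0:ℝ) this u1
    simp only [zero_smul, add_zero] at this
    exact this
  have hl2 := ((hGu.fun_pow 2).fun_mul ((p2.fun_div p1 (by simpa using hφ0)).fun_add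
    (q2.fun_div q1 (by simpa using hψ0)))).fun_sub ((hHu.fun_mul u2).const_mul 2)
  have := hl.unique hl2
  rw [this]
  simp only [zero_smul, add_zero]
  have hid : ∀ Gx Hx gx a b c A B C p q : ℝ, p ≠ 0 → q ≠ 0 →
     (G (u x) ^ 2 * 0 + (((2:ℕ):ℝ) * Gx ^ (2 - 1) * (gx * a) * (b / p + c / q) +
      Gx ^ 2 * ((B * p - b * b) / p ^ 2 + (C * q - c * c) / q ^ 2) -
      2 * (gx ^ 2 * a * a + Hx * A))) =
     Gx ^ 2 * (B / p + C / q) - 2 * Hx * A - (gx * a - Gx * b / p) ^ 2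
      - (gx * a - Gx * c / q) ^ 2 := by
    intro Gx Hx gx a b c A B C p q hp hq
    field_simp
    push_cast
    ring
  have h := hid (G (u x)) (H (u x)) (g (u x)) (fderiv ℝ u x e) (fderiv ℝ φ x e) (fderiv ℝ ψ x e)
    (fderiv ℝ (fun y => fderiv ℝ u y e) x e) (fderiv ℝ (fun y => fderiv ℝ φ y e) x e)
    (fderiv ℝ (fun y => fderiv ℝ ψ y e) x e) (φ x) (ψ x) hφ0 hψ0
  rw [mul_zero, zero_add] at h
  rw [h]
  have s1 := sq_nonneg (g (u x) * fderiv ℝ u x e - G (u x) * fderiv ℝ φ x e / φ x)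
  have s2 := sq_nonneg (g (u x) * fderiv ℝ u x e - G (u x) * fderiv ℝ ψ x e / ψ x)
  linarith

lemma aux_key {N : ℕ}
    (Ω : Set (EuclideanSpace ℝ (Fin N))) (hΩ : IsBoundedDomain Ω)
    (lam mu : ℝ) (hlam : 0 < lam) (hmu : 0 < mu)
    (u v : EuclideanSpace ℝ (Fin N) → ℝ)
    (huv : IsStableGelfandSolution Ω lam mu u v)
    (G H g : ℝ → ℝ) (hg : Continuous g)
    (hG : ∀ t, HasDerivAt G (g t) t) (hH : ∀ t, HasDerivAt H (g t ^ 2) t)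
    (δ : ℝ) (hδ : 0 < δ) (hG0 : ∀ t, |t| < δ → G t = 0) (hH0 : ∀ t, |t| < δ → H t = 0) :
    Real.sqrt (lam * mu) * ∫ x in Ω, exp ((u x + v x) / 2) * G (u x) ^ 2 ≤
      mu * ∫ x in Ω, H (u x) * exp (v x) := by
  obtain ⟨hop, -, hbd⟩ := hΩ
  obtain ⟨⟨hu, hv, hue, hve, hu0, hv0⟩, lam1, φ, ψ, hl1, hφ, hψ, hφp, hψp, hφe, hψe, -, -⟩ := huv
  have hcomp : IsCompact (closure Ω) := hbd.isCompact_closure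
  set K := closure Ω ∩ {x | δ ≤ |u x|} with hKdef
  have hK : IsCompact K := by
    apply hcomp.of_isClosed_subset _ inter_subset_left
    have := hu.continuousOn.abs.preimage_isClosed_of_isClosed isClosed_closure
      (isClosed_Ici (a := δ))
    exact this
  have hKΩ : K ⊆ Ω := by
    rintro x ⟨hx, hxu⟩
    by_contra hxΩ
    have : x ∈ frontier Ω := by
      rw [hop.frontier_eq]; exact ⟨hx, hxΩ⟩
    have := hu0 x this
    simp only [mem_ofPred_eq, this, abs_zero] at hxu
    linarith
  have huΩ := hu.mono subset_closure
  have hφΩ := hφ.mono subset_closure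
  have hψΩ := hψ.mono subset_closure
  have hGc : ContDiff ℝ 1 G := by
    rw [contDiff_one_iff_deriv]
    refine ⟨fun t => (hG t).differentiableAt, ?_⟩
    rwa [show deriv G = g from funext fun t => (hG t).deriv]
  have hHc : ContDiff ℝ 1 H := by
    rw [contDiff_one_iff_deriv]
    refine ⟨fun t => (hH t).differentiableAt, ?_⟩
    rw [show deriv H = fun t => g t ^ 2 from funext fun t => (hH t).deriv]
    exact hg.pow 2
  let e : Fin N → EuclideanSpace ℝ (Fin N) := fun i => EuclideanSpace.single i 1
  let f : Fin N → EuclideanSpace ℝ (Fin N) → ℝ := fun i =>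
    Ω.indicator fun y => G (u y) ^ 2 * (fderiv ℝ φ y (e i) / φ y + fderiv ℝ ψ y (e i) / ψ y)
      - 2 * (H (u y) * fderiv ℝ u y (e i))
  have hfK : ∀ i x, x ∉ K → f i x = 0 := by
    intro i x hx
    by_cases hxΩ : x ∈ Ω
    · have hlt : |u x| < δ := by
        by_contra hcon
        exact hx ⟨subset_closure hxΩ, not_lt.mp hcon⟩
      simp [f, hG0 _ hlt, hH0 _ hlt]
    · simp [f, hxΩ]
  have hfC : ∀ i, ContDiffOn ℝ 1 (f i) Ω := by
    intro i
    have d : ∀ w : EuclideanSpace ℝ (Fin N) → ℝ, ContDiffOn ℝ 2 w Ω →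
        ContDiffOn ℝ 1 (fun y => fderiv ℝ w y (e i)) Ω := by
      intro w hw
      exact (hw.fderiv_of_isOpen hop (by norm_num)).clm_apply contDiffOn_const
    have one : ∀ w : EuclideanSpace ℝ (Fin N) → ℝ, ContDiffOn ℝ 2 w Ω → ContDiffOn ℝ 1 w Ω :=
      fun w hw => hw.of_le (by norm_num)
    have a1 : ContDiffOn ℝ 1 (fun y => G (u y)) Ω := hGc.comp_contDiffOn (one u huΩ)
    have a2 : ContDiffOn ℝ 1 (fun y => H (u y)) Ω := hHc.comp_contDiffOn (one u huΩ)
    have := ((a1.pow 2).mul (((d φ hφΩ).div (one φ hφΩ) (fun x hx => (hφp x hx).ne')).add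
      ((d ψ hψΩ).div (one ψ hψΩ) (fun x hx => (hψp x hx).ne')))).sub
      ((contDiffOn_const (c := (2:ℝ))).mul (a2.mul (d u huΩ)))
    refine this.congr ?_
    intro x hx
    simp [f, hx]
  have hdiv := fun i => aux_div hop hK hKΩ (f i) (hfC i) (hfK i) (e i)
  have hsum : ∫ x in Ω, ∑ i, fderiv ℝ (f i) x (e i) = 0 := by
    rw [integral_finsetSum _ (fun i _ => (hdiv i).1)]
    exact Finset.sum_eq_zero fun i _ => (hdiv i).2
  have hsumI : IntegrableOn (fun x => ∑ i, fderiv ℝ (f i) x (e i)) Ω :=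
    integrable_finsetSum _ (fun i _ => (hdiv i).1)
  have hI1 : IntegrableOn (fun x => exp ((u x + v x) / 2) * G (u x) ^ 2) Ω := by
    refine IntegrableOn.mono_set (ContinuousOn.integrableOn_compact hcomp ?_) subset_closure
    have := hu.continuousOn
    have := hv.continuousOn
    have := hGc.continuous.comp_continuousOn hu.continuousOn
    exact ((hu.continuousOn.add hv.continuousOn).div_const 2).rexp.mul (this.pow 2)
  have hI2 : IntegrableOn (fun x => H (u x) * exp (v x)) Ω := by
    refine IntegrableOn.mono_set (ContinuousOn.integrableOn_compact hcomp ?_) subset_closure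
    exact (hHc.continuous.comp_continuousOn hu.continuousOn).mul hv.continuousOn.rexp
  have hpt : ∀ x ∈ Ω, ∑ i, fderiv ℝ (f i) x (e i) ≤
      2 * (mu * (H (u x) * exp (v x)))
        - 2 * (Real.sqrt (lam * mu) * (exp ((u x + v x) / 2) * G (u x) ^ 2)) := by
    intro x hx
    have h1 : ∑ i, fderiv ℝ (f i) x (e i) ≤
        G (u x) ^ 2 * (lap φ x / φ x + lap ψ x / ψ x) - 2 * H (u x) * lap u x := by
      refine (Finset.sum_le_sum fun i _ => aux_point hop u φ ψ huΩ hφΩ hψΩ hφp hψp G H g hG hH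
        (e i) x hx).trans (le_of_eq ?_)
      simp only [lap, e]
      rw [Finset.sum_sub_distrib, ← Finset.mul_sum, ← Finset.mul_sum, Finset.sum_add_distrib,
        Finset.sum_div, Finset.sum_div]
    have hp := hφp x hx
    have hq := hψp x hx
    have e1 : lap φ x / φ x = -(mu * exp (v x) * ψ x / φ x) - lam1 := by
      have := hφe x hx
      field_simp
      linarith
    have e2 : lap ψ x / ψ x = -(lam * exp (u x) * φ x / ψ x) - lam1 := by
      have := hψe x hx
      field_simp
      linarith
    have e3 : lap u x = -(mu * exp (v x)) := by linarith [hue x hx]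
    set P := mu * exp (v x) * ψ x / φ x with hP
    set Q := lam * exp (u x) * φ x / ψ x with hQ
    set S := Real.sqrt (lam * mu) * exp ((u x + v x) / 2) with hS
    have hP0 : 0 < P := by positivity
    have hQ0 : 0 < Q := by positivity
    have hPQ : S ^ 2 = P * Q := by
      rw [hS, mul_pow, Real.sq_sqrt (by positivity), ← Real.exp_nat_mul,
        show ((2:ℕ):ℝ) * ((u x + v x) / 2) = u x + v x by push_cast; ring, Real.exp_add, hP, hQ]
      field_simp
    have hPQS : 2 * S ≤ P + Q := by
      apply le_of_sq_le_sq _ (by positivity)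
      nlinarith [sq_nonneg (P - Q)]
    rw [e1, e2, e3] at h1
    have h2 : G (u x) ^ 2 * (-P - lam1 + (-Q - lam1)) ≤ G (u x) ^ 2 * (-(2 * S)) := by
      apply mul_le_mul_of_nonneg_left _ (sq_nonneg _)
      linarith
    have h3 : G (u x) ^ 2 * (-(2 * S)) = - 2 * (Real.sqrt (lam * mu) *
      (exp ((u x + v x) / 2) * G (u x) ^ 2)) := by rw [hS]; ring
    linarith
  have hR1 := (hI2.const_mul mu).const_mul 2
  have hR2 := (hI1.const_mul (Real.sqrt (lam * mu))).const_mul 2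
  have hmono := setIntegral_mono_on hsumI (hR1.sub hR2) hop.measurableSet hpt
  rw [hsum] at hmono
  have hsub := integral_sub hR1 hR2
  simp only [Pi.sub_apply] at hmono
  rw [hsub] at hmono
  simp only [integral_const_mul] at hmono
  linarith

/-- Continuous cutoffs vanishing near the origin. -/
noncomputable def cut (n : ℕ) (s : ℝ) : ℝ := min 1 (max 0 (n * |s| - 1))

lemma cut_cont (n : ℕ) : Continuous (cut n) := by unfold cut; fun_prop

lemma cut_nonneg (n : ℕ) (s : ℝ) : 0 ≤ cut n s := le_min zero_le_one (le_max_left _ _)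

lemma cut_le (n : ℕ) (s : ℝ) : cut n s ≤ 1 := min_le_left _ _

lemma cut_zero (n : ℕ) (s : ℝ) (h : n * |s| ≤ 1) : cut n s = 0 := by
  unfold cut
  rw [max_eq_left (by linarith)]; simp

lemma cut_tendsto (s : ℝ) (hs : s ≠ 0) : Tendsto (fun n => cut n s) atTop (𝓝 1) := by
  apply tendsto_const_nhds.congr'
  obtain ⟨m, hm⟩ := exists_nat_gt (2 / |s|)
  filter_upwards [eventually_ge_atTop m] with n hn
  have h0 : 0 < |s| := abs_pos.mpr hs
  have : (m:ℝ) ≤ n := by exact_mod_cast hn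
  have h2 : 2 ≤ n * |s| := by
    rw [div_lt_iff₀ h0] at hm
    nlinarith
  unfold cut
  rw [min_eq_left]
  exact le_max_of_le_right (by linarith)

lemma aux_bound (k w : ℝ → ℝ) (C M : ℝ) (hC : ∀ s, |s| ≤ M → |k s| ≤ C)
    (hC0 : 0 ≤ C) (hw0 : ∀ s, 0 ≤ w s) (hw1 : ∀ s, w s ≤ 1) (t : ℝ) (ht : |t| ≤ M) :
    |∫ s in (0:ℝ)..t, k s * w s| ≤ C * M := by
  have := intervalIntegral.norm_integral_le_of_norm_le_const (a := 0) (b := t)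
    (f := fun s => k s * w s) (C := C) ?_
  · rw [Real.norm_eq_abs, sub_zero] at this
    exact this.trans (by gcongr)
  · intro s hs
    have hsM : |s| ≤ M := by
      have h1 := uIoc_subset_uIcc hs
      have := abs_sub_left_of_mem_uIcc h1
      simp only [sub_zero] at this
      exact this.trans ht
    rw [Real.norm_eq_abs, abs_mul, abs_of_nonneg (hw0 s)]
    calc |k s| * w s ≤ |k s| * 1 := by gcongr; exact hw1 s
      _ ≤ C := by rw [mul_one]; exact hC s hsM

lemma aux_lim (k : ℝ → ℝ) (hk : Continuous k) (w : ℕ → ℝ → ℝ) (hwc : ∀ n, Continuous (w n))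
    (hw0 : ∀ n s, 0 ≤ w n s) (hw1 : ∀ n s, w n s ≤ 1)
    (hwl : ∀ s, s ≠ 0 → Tendsto (fun n => w n s) atTop (𝓝 1)) (t : ℝ) :
    Tendsto (fun n => ∫ s in (0:ℝ)..t, k s * w n s) atTop (𝓝 (∫ s in (0:ℝ)..t, k s)) := by
  apply intervalIntegral.tendsto_integral_filter_of_dominated_convergence (fun s => |k s|)
  · exact Eventually.of_forall fun n => (hk.mul (hwc n)).aestronglyMeasurable
  · refine Eventually.of_forall fun n => Eventually.of_forall fun s _ => ?_
    rw [Real.norm_eq_abs, abs_mul, abs_of_nonneg (hw0 n s)]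
    exact mul_le_of_le_one_right (abs_nonneg _) (hw1 n s)
  · exact hk.abs.intervalIntegrable _ _
  · filter_upwards [compl_mem_ae_iff.mpr (measure_singleton (0:ℝ))] with s hs _
    simpa using (hwl s hs).const_mul (k s)

lemma aux_deriv (k : ℝ → ℝ) (hk : Continuous k) (t : ℝ) :
    HasDerivAt (fun t => ∫ s in (0:ℝ)..t, k s) (k t) t :=
  (hk.integral_hasStrictDerivAt 0 t).hasDerivAt

lemma aux_vanish (k : ℝ → ℝ) (δ t : ℝ) (hk : ∀ s, |s| < δ → k s = 0) (ht : |t| < δ) :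
    ∫ s in (0:ℝ)..t, k s = 0 := by
  rw [intervalIntegral.integral_congr (g := fun _ => (0:ℝ))]
  · simp
  · intro s hs
    have := abs_sub_left_of_mem_uIcc hs
    simp only [sub_zero] at this
    exact hk s (this.trans_lt ht)

lemma aux_exp (c t : ℝ) : ∫ s in (0:ℝ)..t, c * exp (c * s) = exp (c * t) - 1 := by
  rw [intervalIntegral.integral_eq_sub_of_hasDerivAt (f := fun s => exp (c * s))]
  · simp
  · intro s _
    have := ((hasDerivAt_id s).const_mul c).exp
    simpa [mul_comm] using this
  · exact Continuous.intervalIntegrable (by fun_prop) _ _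

/-- For a stable classical solution of the Gelfand system and `α > 1/2`,
`√(λμ) ∫ e^{(u+v)/2} (e^{αu/2} − 1)² ≤ (α/4) μ ∫ (e^{αu} − 1) e^v`. -/
theorem stability_alpha_inequality {N : ℕ}
    (Ω : Set (EuclideanSpace ℝ (Fin N))) (hΩ : IsBoundedDomain Ω)
    (lam mu : ℝ) (hlam : 0 < lam) (hmu : 0 < mu)
    (α : ℝ) (hα : 1 / 2 < α)
    (u v : EuclideanSpace ℝ (Fin N) → ℝ)
    (huv : IsStableGelfandSolution Ω lam mu u v) :
    Real.sqrt (lam * mu) *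
        ∫ x in Ω, exp ((u x + v x) / 2) * (exp (α * u x / 2) - 1) ^ 2 ≤
      α / 4 * mu * ∫ x in Ω, (exp (α * u x) - 1) * exp (v x) := by
  have huv' := huv
  obtain ⟨⟨hu, hv, -⟩, -⟩ := huv'
  have hcomp : IsCompact (closure Ω) := hΩ.2.2.isCompact_closure
  have hfin : volume Ω ≠ ⊤ := hΩ.2.2.measure_lt_top.ne
  have hmeas := hΩ.1.measurableSet
  obtain ⟨M, hM⟩ := hcomp.exists_bound_of_continuousOn hu.continuousOn
  obtain ⟨V, hV⟩ := hcomp.exists_bound_of_continuousOn hv.continuousOn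
  have hM0 : 0 ≤ M := by
    obtain ⟨x, hx⟩ := hΩ.2.1.nonempty
    exact (norm_nonneg _).trans (hM x (subset_closure hx))
  let k : ℝ → ℝ := fun s => α / 2 * exp (α / 2 * s)
  have hk : Continuous k := by fun_prop
  let h : ℝ → ℝ := fun s => k s ^ 2
  have hh : Continuous h := hk.pow 2
  let G : ℕ → ℝ → ℝ := fun n t => ∫ s in (0:ℝ)..t, k s * cut n s
  let H : ℕ → ℝ → ℝ := fun n t => ∫ s in (0:ℝ)..t, h s * cut n s ^ 2
  have hGd : ∀ n t, HasDerivAt (G n) (k t * cut n t) t := fun n t =>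
    aux_deriv _ (hk.mul (cut_cont n)) t
  have hHd : ∀ n t, HasDerivAt (H n) ((k t * cut n t) ^ 2) t := fun n t => by
    have := aux_deriv _ (hh.mul ((cut_cont n).pow 2)) t
    rw [mul_pow]
    exact this
  have hGc : ∀ n, Continuous (G n) := fun n =>
    continuous_iff_continuousAt.mpr fun t => (hGd n t).continuousAt
  have hHc : ∀ n, Continuous (H n) := fun n =>
    continuous_iff_continuousAt.mpr fun t => (hHd n t).continuousAt
  have hGl : ∀ t, Tendsto (fun n => G n t) atTop (𝓝 (exp (α * t / 2) - 1)) := by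
    intro t
    have := aux_lim k hk cut cut_cont cut_nonneg cut_le cut_tendsto t
    rw [aux_exp] at this
    rwa [show α * t / 2 = α / 2 * t by ring]
  have hHl : ∀ t, Tendsto (fun n => H n t) atTop (𝓝 (α / 4 * (exp (α * t) - 1))) := by
    intro t
    have := aux_lim h hh (fun n s => cut n s ^ 2) (fun n => (cut_cont n).pow 2)
      (fun n s => sq_nonneg _) (fun n s => pow_le_one₀ (cut_nonneg n s) (cut_le n s))
      (fun s hs => by simpa using (cut_tendsto s hs).pow 2) t
    have e : ∀ s, h s = α / 4 * (α * exp (α * s)) := by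
      intro s
      simp only [h, k]
      rw [mul_pow, ← Real.exp_nat_mul,
        show ((2:ℕ):ℝ) * (α / 2 * s) = α * s by push_cast; ring]
      ring
    have e2 : ∫ s in (0:ℝ)..t, h s = α / 4 * (exp (α * t) - 1) := by
      simp only [e]
      rw [intervalIntegral.integral_const_mul, aux_exp]
    rwa [e2] at this
  have hineq : ∀ n, Real.sqrt (lam * mu) * ∫ x in Ω, exp ((u x + v x) / 2) * G n (u x) ^ 2 ≤
      mu * ∫ x in Ω, H n (u x) * exp (v x) := by
    intro n
    have hpos : (0:ℝ) < 1 / (n + 1) := by positivity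
    have hc : ∀ s : ℝ, |s| < 1 / (n + 1) → cut n s = 0 := by
      intro s hs
      apply cut_zero
      rw [lt_div_iff₀ (by positivity)] at hs
      nlinarith [abs_nonneg s]
    refine aux_key Ω hΩ lam mu hlam hmu u v huv (G n) (H n) (fun t => k t * cut n t)
      (hk.mul (cut_cont n)) (hGd n) (hHd n) _ hpos ?_ ?_
    · intro t ht
      exact aux_vanish _ _ t (fun s hs => by simp [hc s hs]) ht
    · intro t ht
      exact aux_vanish _ _ t (fun s hs => by simp [hc s hs]) ht
  obtain ⟨C, hC⟩ := (isCompact_Icc (a := -M) (b := M)).exists_bound_of_continuousOn hk.continuousOn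
  obtain ⟨D, hD⟩ := (isCompact_Icc (a := -M) (b := M)).exists_bound_of_continuousOn hh.continuousOn
  have h0mem : (0:ℝ) ∈ Icc (-M) M := ⟨by linarith, hM0⟩
  have hC0 : 0 ≤ C := (norm_nonneg _).trans (hC 0 h0mem)
  have hD0 : 0 ≤ D := (norm_nonneg _).trans (hD 0 h0mem)
  have hGb : ∀ n t, |t| ≤ M → |G n t| ≤ C * M := fun n t ht =>
    aux_bound k (cut n) C M (fun s hs => hC s (abs_le.mp hs)) hC0 (cut_nonneg n) (cut_le n) t ht
  have hHb : ∀ n t, |t| ≤ M → |H n t| ≤ D * M := fun n t ht =>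
    aux_bound h (fun s => cut n s ^ 2) D M (fun s hs => hD s (abs_le.mp hs)) hD0
      (fun s => sq_nonneg _) (fun s => pow_le_one₀ (cut_nonneg n s) (cut_le n s)) t ht
  have huc : ContinuousOn u Ω := hu.continuousOn.mono subset_closure
  have hvc : ContinuousOn v Ω := hv.continuousOn.mono subset_closure
  have lim1 : Tendsto (fun n => ∫ x in Ω, exp ((u x + v x) / 2) * G n (u x) ^ 2) atTop
      (𝓝 (∫ x in Ω, exp ((u x + v x) / 2) * (exp (α * u x / 2) - 1) ^ 2)) := by
    apply tendsto_integral_of_dominated_convergence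
      (fun _ => exp ((M + V) / 2) * (C * M) ^ 2)
    · intro n
      exact (((huc.add hvc).div_const 2).rexp.mul
        (((hGc n).comp_continuousOn huc).pow 2)).aestronglyMeasurable hmeas
    · exact integrableOn_const hfin
    · intro n
      filter_upwards [ae_restrict_mem hmeas] with x hx
      have a1 := hM x (subset_closure hx)
      have a2 := hV x (subset_closure hx)
      rw [Real.norm_eq_abs] at a1 a2 ⊢
      rw [abs_mul, Real.abs_exp, abs_pow]
      have b1 := le_of_abs_le a1
      have b2 := le_of_abs_le a2
      have := hGb n (u x) a1
      gcongr
    · refine Eventually.of_forall fun x => ?_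
      exact ((hGl (u x)).pow 2).const_mul _
  have lim2 : Tendsto (fun n => ∫ x in Ω, H n (u x) * exp (v x)) atTop
      (𝓝 (∫ x in Ω, α / 4 * (exp (α * u x) - 1) * exp (v x))) := by
    apply tendsto_integral_of_dominated_convergence (fun _ => (D * M) * exp V)
    · intro n
      exact (((hHc n).comp_continuousOn huc).mul hvc.rexp).aestronglyMeasurable hmeas
    · exact integrableOn_const hfin
    · intro n
      filter_upwards [ae_restrict_mem hmeas] with x hx
      have a1 := hM x (subset_closure hx)
      have a2 := hV x (subset_closure hx)
      rw [Real.norm_eq_abs] at a1 a2 ⊢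
      rw [abs_mul, Real.abs_exp]
      have b2 := le_of_abs_le a2
      have := hHb n (u x) a1
      gcongr
    · refine Eventually.of_forall fun x => ?_
      exact (hHl (u x)).mul_const _
  have hfinal := le_of_tendsto_of_tendsto' (lim1.const_mul (Real.sqrt (lam * mu)))
    (lim2.const_mul mu) hineq
  simp only [mul_assoc] at hfinal
  rw [integral_const_mul] at hfinal
  calc _ ≤ _ := hfinal
    _ = _ := by ring
end

section
/- Let Ω ⊂ ℝ^N be a smoothly bounded domain, λ, μ > 0, α > 1/2, and (u, v) a stable classical solution of the Gelfand system. Then √(λμ) ∫_Ω e^{(2α+1)u/2} e^{v/2} dx ≤ (α/4) μ ∫_Ω e^{αu} e^{v} dx + 2 √(λμ) ∫_Ω e^{(α+1)u/2} e^{v/2} dx. -/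
open MeasureTheory Real
open scoped RealInnerProductSpace

theorem exists_cutoff (α c : ℝ) (hα : 0 < α) (hc : 1 < c) :
    ∃ h G h' : ℝ → ℝ, ∃ ε > 0, ContDiff ℝ 1 h ∧ ContDiff ℝ 1 G ∧
      (∀ t, HasDerivAt h (h' t) t) ∧ (∀ t, HasDerivAt G (h' t ^ 2) t) ∧
      (∀ t, t ≤ ε → h t = 0) ∧ (∀ t, t ≤ ε → G t = 0) ∧
      (∀ t, exp (α * t) - 2 * c * exp (α * t / 2) ≤ h t ^ 2) ∧
      (∀ t, G t ≤ α / 4 * exp (α * t)) := by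
  set ε : ℝ := Real.log c / α with hε
  have hε0 : 0 < ε := div_pos (Real.log_pos hc) hα
  have hαε : α * ε = Real.log c := by rw [hε]; field_simp
  set χ : ℝ → ℝ := fun s => max 0 (min 1 (s / ε - 1)) with hχ
  have hχc : Continuous χ := by fun_prop
  have hχ0 : ∀ s, s ≤ ε → χ s = 0 := by
    intro s hs
    have : s / ε ≤ 1 := (div_le_one hε0).2 hs
    exact max_eq_left ((min_le_right _ _).trans (by linarith))
  have hχ1 : ∀ s, 2 * ε ≤ s → χ s = 1 := by
    intro s hs
    have : 2 ≤ s / ε := (le_div_iff₀ hε0).2 hs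
    simp only [hχ]
    rw [min_eq_left (by linarith), max_eq_right zero_le_one]
  have hχn : ∀ s, 0 ≤ χ s := fun s => le_max_left _ _
  have hχl : ∀ s, χ s ≤ 1 := fun s => max_le zero_le_one (min_le_left _ _)
  set k : ℝ → ℝ := fun s => χ s * (α / 2 * exp (α * s / 2)) with hk
  have hkc : Continuous k := by fun_prop
  have hk2c : Continuous (fun s => k s ^ 2) := by fun_prop
  have hk0 : ∀ s, s ≤ ε → k s = 0 := fun s hs => by simp [hk, hχ0 s hs]
  have hkn : ∀ s, 0 ≤ k s := fun s => mul_nonneg (hχn s) (by positivity)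
  have hd1 : ∀ t, HasDerivAt (fun t => ∫ s in ε..t, k s) (k t) t :=
    fun t => (hkc.integral_hasStrictDerivAt ε t).hasDerivAt
  have hd2 : ∀ t, HasDerivAt (fun t => ∫ s in ε..t, k s ^ 2) (k t ^ 2) t :=
    fun t => (hk2c.integral_hasStrictDerivAt ε t).hasDerivAt
  have cd : ∀ (f f' : ℝ → ℝ), Continuous f' → (∀ t, HasDerivAt f (f' t) t) → ContDiff ℝ 1 f := by
    intro f f' hf' hf
    rw [contDiff_one_iff_deriv]
    refine ⟨fun t => (hf t).differentiableAt, ?_⟩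
    have : deriv f = f' := funext fun t => (hf t).deriv
    rwa [this]
  have z : ∀ (f : ℝ → ℝ), (∀ s, s ≤ ε → f s = 0) → ∀ t, t ≤ ε → ∫ s in ε..t, f s = 0 := by
    intro f hf t ht
    apply intervalIntegral.integral_zero_ae
    refine Filter.Eventually.of_forall fun s hs => hf s ?_
    rw [Set.uIoc_of_ge ht] at hs
    exact hs.2
  have hG0 := z (fun s => k s ^ 2) (fun s hs => by simp [hk0 s hs])
  have eder : ∀ t, HasDerivAt (fun s => exp (α * s / 2)) (α / 2 * exp (α * t / 2)) t := by
    intro t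
    have h1 : HasDerivAt (fun s : ℝ => α * s / 2) (α / 2) t := by
      simpa using ((hasDerivAt_id t).const_mul α).div_const 2
    simpa [mul_comm] using h1.exp
  have eder2 : ∀ t, HasDerivAt (fun s => α / 4 * exp (α * s)) (α / 4 * (α * exp (α * t))) t := by
    intro t
    have h1 : HasDerivAt (fun s : ℝ => α * s) α t := by
      simpa using ((hasDerivAt_id t).const_mul α)
    have := h1.exp.const_mul (α / 4)
    simpa [mul_comm] using this
  refine ⟨_, _, k, ε, hε0, cd _ _ hkc hd1, cd _ _ hk2c hd2, hd1, hd2, z k hk0, hG0, ?_, ?_⟩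
  · intro t
    have e2 : exp (α * t) = exp (α * t / 2) ^ 2 := by rw [← Real.exp_nat_mul]; congr 1; push_cast; ring
    have ec : exp (α * (2 * ε) / 2) = c := by
      rw [show α * (2 * ε) / 2 = α * ε by ring, hαε, Real.exp_log (by linarith)]
    have ep := exp_pos (α * t / 2)
    rw [e2]
    rcases le_total t (2 * ε) with ht | ht
    · have : exp (α * t / 2) ≤ c := by
        rw [← ec]; apply Real.exp_le_exp.2; gcongr
      nlinarith [sq_nonneg (∫ s in ε..t, k s)]
    · have hcy : c ≤ exp (α * t / 2) := by
        rw [← ec]; apply Real.exp_le_exp.2; gcongr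
      have i2 : ∫ s in (2*ε)..t, k s = exp (α * t / 2) - c := by
        rw [← ec, ← intervalIntegral.integral_eq_sub_of_hasDerivAt (fun s _ => eder s)
          (by apply Continuous.intervalIntegrable; fun_prop)]
        apply intervalIntegral.integral_congr
        intro s hs
        rw [Set.uIcc_of_le ht] at hs
        simp [hk, hχ1 s hs.1]
      have i1 : 0 ≤ ∫ s in ε..(2*ε), k s :=
        intervalIntegral.integral_nonneg (by linarith) (fun s _ => hkn s)
      have i3 : exp (α * t / 2) - c ≤ ∫ s in ε..t, k s := by
        rw [← intervalIntegral.integral_add_adjacent_intervals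
          (hkc.intervalIntegrable ε (2*ε)) (hkc.intervalIntegrable (2*ε) t), i2]
        linarith
      nlinarith [sq_nonneg c]
  · intro t
    have ep : 0 < α / 4 * exp (α * t) := by positivity
    rcases le_total t ε with ht | ht
    · rw [hG0 t ht]; exact ep.le
    · have : ∫ s in ε..t, k s ^ 2 ≤ ∫ s in ε..t, α / 4 * (α * exp (α * s)) := by
        apply intervalIntegral.integral_mono_on ht (hk2c.intervalIntegrable _ _)
          (by apply Continuous.intervalIntegrable; fun_prop)
        intro s _
        have e2 : exp (α * s) = exp (α * s / 2) ^ 2 := by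
          rw [← Real.exp_nat_mul]; congr 1; push_cast; ring
        have : χ s ^ 2 ≤ 1 := by nlinarith [hχn s, hχl s]
        have h0 : 0 ≤ (α / 2 * exp (α * s / 2)) ^ 2 := by positivity
        simp only [hk]
        rw [e2]
        nlinarith
      rw [intervalIntegral.integral_eq_sub_of_hasDerivAt (fun s _ => eder2 s)
          (by apply Continuous.intervalIntegrable; fun_prop)] at this
      have : 0 < α / 4 * exp (α * ε) := by positivity
      linarith

/-- The integral of a partial derivative of a compactly supported `C¹` function vanishes. -/
theorem integral_partial_eq_zero {N : ℕ} (f : EuclideanSpace ℝ (Fin N) → ℝ)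
    (hf : ContDiff ℝ 1 f) (hs : HasCompactSupport f) (e : EuclideanSpace ℝ (Fin N)) :
    Integrable (fun x => fderiv ℝ f x e) ∧ ∫ x, fderiv ℝ f x e = 0 := by
  have hc : Continuous (fun x => fderiv ℝ f x e) :=
    (hf.continuous_fderiv (by norm_num)).clm_apply continuous_const
  have hi : Integrable (fun x => fderiv ℝ f x e) :=
    hc.integrable_of_hasCompactSupport (hs.fderiv_apply (𝕜 := ℝ) e)
  refine ⟨hi, ?_⟩
  have := integral_mul_fderiv_eq_neg_fderiv_mul_of_integrable
    (μ := (volume : Measure (EuclideanSpace ℝ (Fin N))))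
    (f := fun _ : EuclideanSpace ℝ (Fin N) => (1 : ℝ)) (g := f) (v := e)
    (by simp) (by simpa using hi)
    (by simpa using hf.continuous.integrable_of_hasCompactSupport hs)
    (fun x _ => differentiableAt_const _) (fun x _ => (hf.differentiable (by norm_num)) x)
  simpa using this

/-- Directional derivative of the vector field used in the proof. -/
theorem field_deriv {N : ℕ} {Ω : Set (EuclideanSpace ℝ (Fin N))} (hΩ : IsOpen Ω)
    {u φ ψ : EuclideanSpace ℝ (Fin N) → ℝ} (hu : ContDiffOn ℝ 2 u Ω)
    (hφ : ContDiffOn ℝ 2 φ Ω) (hψ : ContDiffOn ℝ 2 ψ Ω)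
    (pφ : ∀ x ∈ Ω, 0 < φ x) (pψ : ∀ x ∈ Ω, 0 < ψ x)
    {h G h' : ℝ → ℝ} (hh : ContDiff ℝ 1 h) (hG : ContDiff ℝ 1 G)
    (dh : ∀ t, HasDerivAt h (h' t) t) (dG : ∀ t, HasDerivAt G (h' t ^ 2) t)
    (e x : EuclideanSpace ℝ (Fin N)) (hx : x ∈ Ω) :
    ContDiffAt ℝ 1 (fun y => h (u y) ^ 2 * ((fderiv ℝ φ y e / φ y + fderiv ℝ ψ y e / ψ y) / 2)
      - G (u y) * fderiv ℝ u y e) x ∧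
    fderiv ℝ (fun y => h (u y) ^ 2 * ((fderiv ℝ φ y e / φ y + fderiv ℝ ψ y e / ψ y) / 2)
      - G (u y) * fderiv ℝ u y e) x e ≤
    h (u x) ^ 2 * ((fderiv ℝ (fun y => fderiv ℝ φ y e) x e / φ x
      + fderiv ℝ (fun y => fderiv ℝ ψ y e) x e / ψ x) / 2)
      - G (u x) * fderiv ℝ (fun y => fderiv ℝ u y e) x e := by
  have n := hΩ.mem_nhds hx
  have c2 : ∀ f : EuclideanSpace ℝ (Fin N) → ℝ, ContDiffOn ℝ 2 f Ω →
      ContDiffAt ℝ 1 f x ∧ ContDiffAt ℝ 1 (fun y => fderiv ℝ f y e) x := by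
    intro f hf
    have hf2 := hf.contDiffAt n
    refine ⟨hf2.of_le (by norm_num), ?_⟩
    have := hf2.fderiv_right (m := 1) (by norm_num)
    exact this.clm_apply contDiffAt_const
  obtain ⟨u1, u2⟩ := c2 u hu
  obtain ⟨φ1, φ2⟩ := c2 φ hφ
  obtain ⟨ψ1, ψ2⟩ := c2 ψ hψ
  have hp := pφ x hx
  have hq := pψ x hx
  have hu1 : ContDiffAt ℝ 1 (fun y => h (u y)) x := hh.contDiffAt.comp x u1
  have hG1 : ContDiffAt ℝ 1 (fun y => G (u y)) x := hG.contDiffAt.comp x u1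
  have C : ContDiffAt ℝ 1 (fun y => h (u y) ^ 2 *
      ((fderiv ℝ φ y e / φ y + fderiv ℝ ψ y e / ψ y) / 2) - G (u y) * fderiv ℝ u y e) x :=
    ((hu1.pow 2).mul (((φ2.div φ1 hp.ne').add (ψ2.div ψ1 hq.ne')).div_const 2)).sub (hG1.mul u2)
  refine ⟨C, ?_⟩
  have line : ∀ f : EuclideanSpace ℝ (Fin N) → ℝ, ContDiffAt ℝ 1 f x →
      HasDerivAt (fun s : ℝ => f (x + s • e)) (fderiv ℝ f x e) 0 := by
    intro f hf
    have hf' : HasLineDerivAt ℝ f (fderiv ℝ f x e) x e :=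
      ((hf.differentiableAt (by norm_num)).hasFDerivAt).hasLineDerivAt e
    exact hf'
  have lu := line _ u1
  have lh : HasDerivAt (fun s : ℝ => h (u (x + s • e))) (h' (u x) * fderiv ℝ u x e) 0 := by
    have := (dh (u (x + (0:ℝ) • e))).comp (0:ℝ) lu
    simpa [Function.comp_def] using this
  have lG : HasDerivAt (fun s : ℝ => G (u (x + s • e))) (h' (u x) ^ 2 * fderiv ℝ u x e) 0 := by
    have := (dG (u (x + (0:ℝ) • e))).comp (0:ℝ) lu
    simpa [Function.comp_def] using this
  have D := ((lh.pow 2).mul ((((line _ φ2).div (line _ φ1) (by simpa using hp.ne')).add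
    ((line _ ψ2).div (line _ ψ1) (by simpa using hq.ne'))).div_const 2)).sub (lG.mul (line _ u2))
  have E := (line _ C).unique D
  rw [E]
  simp only [zero_smul, add_zero, Pi.pow_apply, Pi.add_apply, Pi.div_apply]
  generalize fderiv ℝ (fun y => fderiv ℝ φ y e) x e = φii
  generalize fderiv ℝ (fun y => fderiv ℝ ψ y e) x e = ψii
  generalize fderiv ℝ (fun y => fderiv ℝ u y e) x e = uii
  generalize fderiv ℝ u x e = p
  have ea : ∃ a, fderiv ℝ φ x e = a * φ x := ⟨fderiv ℝ φ x e / φ x, by field_simp⟩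
  have eb : ∃ a, fderiv ℝ ψ x e = a * ψ x := ⟨fderiv ℝ ψ x e / ψ x, by field_simp⟩
  obtain ⟨a, ha⟩ := ea
  obtain ⟨b, hb⟩ := eb
  rw [ha, hb]
  generalize φ x = P at *
  generalize ψ x = Q at *
  have e1 : (φii * P - a * P * (a * P)) / P ^ 2 = φii / P - a ^ 2 := by field_simp
  have e2 : (ψii * Q - b * Q * (b * Q)) / Q ^ 2 = ψii / Q - b ^ 2 := by field_simp
  rw [e1, e2, mul_div_cancel_right₀ _ hp.ne', mul_div_cancel_right₀ _ hq.ne']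
  norm_num
  nlinarith [sq_nonneg (h (u x) * a - h' (u x) * p), sq_nonneg (h (u x) * b - h' (u x) * p)]

/-- The key pointwise inequality from the linearized equations. -/
theorem amgm_point (lam mu lam1 U V P Q LP LQ : ℝ) (hlam : 0 < lam) (hmu : 0 < mu)
    (h1 : 0 ≤ lam1) (hP : 0 < P) (hQ : 0 < Q)
    (eP : -LP - mu * exp V * Q = lam1 * P) (eQ : -LQ - lam * exp U * P = lam1 * Q) :
    (LP / P + LQ / Q) / 2 ≤ - (√(lam * mu) * (exp (U / 2) * exp (V / 2))) := by
  have e1 : LP / P = -(mu * exp V * Q / P) - lam1 := by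
    field_simp; linarith
  have e2 : LQ / Q = -(lam * exp U * P / Q) - lam1 := by
    field_simp; linarith
  have s1 : √(lam * mu) = √lam * √mu := Real.sqrt_mul hlam.le _
  have sl := Real.sq_sqrt hlam.le
  have sm := Real.sq_sqrt hmu.le
  have eU : exp U = exp (U / 2) ^ 2 := by rw [← Real.exp_nat_mul]; congr 1; push_cast; ring
  have eV : exp V = exp (V / 2) ^ 2 := by rw [← Real.exp_nat_mul]; congr 1; push_cast; ring
  have key : 2 * (√(lam * mu) * (exp (U / 2) * exp (V / 2))) ≤
      mu * exp V * Q / P + lam * exp U * P / Q := by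
    rw [s1, eU, eV]
    nth_rewrite 2 [← sl]
    nth_rewrite 2 [← sm]
    rw [div_add_div _ _ hP.ne' hQ.ne', le_div_iff₀ (mul_pos hP hQ)]
    nlinarith [sq_nonneg (√mu * exp (V / 2) * Q - √lam * exp (U / 2) * P)]
  rw [e1, e2]
  linarith

theorem expanded_alpha_aux {N : ℕ}
    (Ω : Set (EuclideanSpace ℝ (Fin N))) (hΩ : IsBoundedDomain Ω)
    (lam mu : ℝ) (hlam : 0 < lam) (hmu : 0 < mu)
    (α : ℝ) (hα : 1 / 2 < α)
    (u v : EuclideanSpace ℝ (Fin N) → ℝ)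
    (huv : IsStableGelfandSolution Ω lam mu u v) (c : ℝ) (hc : 1 < c) :
    Real.sqrt (lam * mu) *
        ∫ x in Ω, exp ((2 * α + 1) * u x / 2) * exp (v x / 2) ≤
      α / 4 * mu * (∫ x in Ω, exp (α * u x) * exp (v x)) +
        2 * c * Real.sqrt (lam * mu) *
          ∫ x in Ω, exp ((α + 1) * u x / 2) * exp (v x / 2) := by
  obtain ⟨hO, -, hB⟩ := hΩ
  obtain ⟨⟨cu, cv, equ, -, bu, -⟩, lam1, φ, ψ, hl1, cφ, cψ, pφ, pψ, eφ, eψ, -, -⟩ := huv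
  obtain ⟨h, G, h', ε, hε, hh, hG, dh, dG, h0, G0, hlow, Gup⟩ :=
    exists_cutoff α c (by linarith) hc
  have hK : IsCompact (closure Ω) := hB.isCompact_closure
  have su := cu.continuousOn
  have sv := cv.continuousOn
  have intg : ∀ f : EuclideanSpace ℝ (Fin N) → ℝ, ContinuousOn f (closure Ω) →
      IntegrableOn f Ω := fun f hf => (hf.integrableOn_compact hK).mono_set subset_closure
  have I1 : IntegrableOn (fun x => exp ((2 * α + 1) * u x / 2) * exp (v x / 2)) Ω :=
    intg _ (by fun_prop)
  have I2 : IntegrableOn (fun x => exp (α * u x) * exp (v x)) Ω := intg _ (by fun_prop)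
  have I3 : IntegrableOn (fun x => exp ((α + 1) * u x / 2) * exp (v x / 2)) Ω :=
    intg _ (by fun_prop)
  set K : Set (EuclideanSpace ℝ (Fin N)) := closure Ω ∩ u ⁻¹' Set.Ici ε with hKdef
  have Kcl : IsClosed K := su.preimage_isClosed_of_isClosed isClosed_closure isClosed_Ici
  have Kc : IsCompact K := hK.of_isClosed_subset Kcl Set.inter_subset_left
  have KΩ : K ⊆ Ω := by
    rintro x ⟨hx, hxu⟩
    by_contra hn
    have : x ∈ frontier Ω := by rw [hO.frontier_eq]; exact ⟨hx, hn⟩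
    have hxu' : ε ≤ u x := hxu
    rw [bu x this] at hxu'
    linarith
  set F : Fin N → EuclideanSpace ℝ (Fin N) → ℝ := fun i y =>
    h (u y) ^ 2 * ((fderiv ℝ φ y (EuclideanSpace.single i 1) / φ y
      + fderiv ℝ ψ y (EuclideanSpace.single i 1) / ψ y) / 2)
      - G (u y) * fderiv ℝ u y (EuclideanSpace.single i 1) with hF
  set X : Fin N → EuclideanSpace ℝ (Fin N) → ℝ := fun i => Ω.indicator (F i) with hX
  have FD := fun (i : Fin N) x hx => field_deriv hO (cu.mono subset_closure)
    (cφ.mono subset_closure) (cψ.mono subset_closure) pφ pψ hh hG dh dG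
    (EuclideanSpace.single i 1) x hx
  have Xz : ∀ i, ∀ y, y ∉ K → X i y = 0 := by
    intro i y hy
    by_cases hyΩ : y ∈ Ω
    · have : u y ≤ ε := by
        by_contra hn
        exact hy ⟨subset_closure hyΩ, (not_le.1 hn).le⟩
      simp [hX, hF, h0 _ this, G0 _ this]
    · simp [hX, hyΩ]
  have XF : ∀ i, ∀ x ∈ Ω, X i =ᶠ[nhds x] F i := by
    intro i x hx
    filter_upwards [hO.mem_nhds hx] with y hy
    simp [hX, hy]
  have X0 : ∀ i, ∀ x, x ∉ Ω → X i =ᶠ[nhds x] fun _ => 0 := by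
    intro i x hx
    filter_upwards [Kcl.isOpen_compl.mem_nhds (fun hk => hx (KΩ hk))] with y hy
    exact Xz i y hy
  have XC : ∀ i, ContDiff ℝ 1 (X i) := by
    intro i
    rw [contDiff_iff_contDiffAt]
    intro x
    by_cases hx : x ∈ Ω
    · exact (FD i x hx).1.congr_of_eventuallyEq (XF i x hx)
    · exact contDiffAt_const.congr_of_eventuallyEq (X0 i x hx)
  have XS : ∀ i, HasCompactSupport (X i) := fun i => HasCompactSupport.intro Kc (Xz i)
  have XI := fun i => integral_partial_eq_zero (X i) (XC i) (XS i) (EuclideanSpace.single i 1)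
  set div : EuclideanSpace ℝ (Fin N) → ℝ :=
    fun x => ∑ i, fderiv ℝ (X i) x (EuclideanSpace.single i 1) with hdiv
  have dI : Integrable div := integrable_finsetSum _ fun i _ => (XI i).1
  have d0 : ∫ x in Ω, div x = 0 := by
    rw [setIntegral_eq_integral_of_forall_compl_eq_zero]
    · rw [hdiv, integral_finsetSum _ fun i _ => (XI i).1]
      exact Finset.sum_eq_zero fun i _ => (XI i).2
    · intro x hx
      refine Finset.sum_eq_zero fun i _ => ?_
      rw [(X0 i x hx).fderiv_eq]
      simp
  have pw : ∀ x ∈ Ω, div x ≤ - (√(lam * mu) * (exp ((2 * α + 1) * u x / 2) * exp (v x / 2)))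
      + (α / 4 * mu * (exp (α * u x) * exp (v x)) +
        2 * c * √(lam * mu) * (exp ((α + 1) * u x / 2) * exp (v x / 2))) := by
    intro x hx
    have s1 : div x ≤ h (u x) ^ 2 * ((lap φ x / φ x + lap ψ x / ψ x) / 2)
        - G (u x) * lap u x := by
      have pt : ∀ i ∈ (Finset.univ : Finset (Fin N)), _ := fun i _ => (FD i x hx).2
      have key := Finset.sum_le_sum pt
      rw [Finset.sum_sub_distrib, ← Finset.mul_sum, ← Finset.mul_sum, ← Finset.sum_div,
        Finset.sum_add_distrib, ← Finset.sum_div, ← Finset.sum_div] at key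
      have dF : div x = ∑ i, fderiv ℝ (F i) x (EuclideanSpace.single i 1) :=
        Finset.sum_congr rfl fun i _ => by rw [(XF i x hx).fderiv_eq]
      rw [dF]
      exact key
    have s2 := amgm_point lam mu lam1 (u x) (v x) (φ x) (ψ x) _ _ hlam hmu hl1 (pφ x hx) (pψ x hx)
      (eφ x hx) (eψ x hx)
    have s3 := equ x hx
    have s4 := hlow (u x)
    have s5 := Gup (u x)
    have s6 := mul_le_mul_of_nonneg_left s2 (sq_nonneg (h (u x)))
    have s7 : 0 ≤ √(lam * mu) * (exp (u x / 2) * exp (v x / 2)) := by positivity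
    have s8 := mul_le_mul_of_nonneg_right s4 s7
    have s9 : 0 ≤ mu * exp (v x) := by positivity
    have s10 := mul_le_mul_of_nonneg_right s5 s9
    have x1 : exp ((2 * α + 1) * u x / 2) = exp (α * u x) * exp (u x / 2) := by
      rw [← Real.exp_add]; congr 1; ring
    have x2 : exp ((α + 1) * u x / 2) = exp (α * u x / 2) * exp (u x / 2) := by
      rw [← Real.exp_add]; congr 1; ring
    rw [x1, x2]
    have s11 : lap u x = - (mu * exp (v x)) := by linarith
    rw [s11] at s1
    linarith
  have J1 := I1.const_mul (√(lam * mu))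
  have J2 := I2.const_mul (α / 4 * mu)
  have J3 := I3.const_mul (2 * c * √(lam * mu))
  have M := setIntegral_mono_on dI.integrableOn (J1.neg.add (J2.add J3)) hO.measurableSet pw
  have e : ∫ x in Ω, (- (√(lam * mu) * (exp ((2 * α + 1) * u x / 2) * exp (v x / 2)))
      + (α / 4 * mu * (exp (α * u x) * exp (v x)) +
        2 * c * √(lam * mu) * (exp ((α + 1) * u x / 2) * exp (v x / 2)))) = _ :=
    integral_add J1.neg (J2.add J3)
  have e' : ∫ x in Ω, (α / 4 * mu * (exp (α * u x) * exp (v x)) +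
        2 * c * √(lam * mu) * (exp ((α + 1) * u x / 2) * exp (v x / 2))) = _ :=
    integral_add J2 J3
  have e'' : ∫ x in Ω, - (√(lam * mu) * (exp ((2 * α + 1) * u x / 2) * exp (v x / 2))) = _ :=
    integral_neg _
  rw [integral_const_mul] at e''
  rw [integral_const_mul, integral_const_mul] at e'
  have M' := M.trans_eq (e.trans (congrArg₂ (· + ·) e'' e'))
  rw [d0] at M'
  linarith

/-- For a stable classical solution of the Gelfand system and `α > 1/2`,
`√(λμ) ∫ e^{(2α+1)u/2} e^{v/2} ≤ (α/4) μ ∫ e^{αu} e^v + 2 √(λμ) ∫ e^{(α+1)u/2} e^{v/2}`. -/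
theorem expanded_alpha_inequality {N : ℕ}
    (Ω : Set (EuclideanSpace ℝ (Fin N))) (hΩ : IsBoundedDomain Ω)
    (lam mu : ℝ) (hlam : 0 < lam) (hmu : 0 < mu)
    (α : ℝ) (hα : 1 / 2 < α)
    (u v : EuclideanSpace ℝ (Fin N) → ℝ)
    (huv : IsStableGelfandSolution Ω lam mu u v) :
    Real.sqrt (lam * mu) *
        ∫ x in Ω, exp ((2 * α + 1) * u x / 2) * exp (v x / 2) ≤
      α / 4 * mu * (∫ x in Ω, exp (α * u x) * exp (v x)) +
        2 * Real.sqrt (lam * mu) *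
          ∫ x in Ω, exp ((α + 1) * u x / 2) * exp (v x / 2) := by
  refine le_of_forall_pos_le_add fun δ hδ => ?_
  set B : ℝ := 2 * √(lam * mu) * ∫ x in Ω, exp ((α + 1) * u x / 2) * exp (v x / 2) with hB
  have hB0 : 0 ≤ B :=
    mul_nonneg (by positivity) (integral_nonneg fun x => by positivity)
  have hd : 0 < δ / (B + 1) := by positivity
  have h1 := expanded_alpha_aux Ω hΩ lam mu hlam hmu α hα u v huv (1 + δ / (B + 1)) (by linarith)
  have h2 : δ / (B + 1) * B ≤ δ := by
    rw [div_mul_eq_mul_div, div_le_iff₀ (by linarith)]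
    nlinarith
  have h3 : 2 * (1 + δ / (B + 1)) * √(lam * mu) *
      ∫ x in Ω, exp ((α + 1) * u x / 2) * exp (v x / 2) = B + δ / (B + 1) * B := by
    generalize δ / (B + 1) = r
    rw [hB]
    ring
  rw [h3] at h1
  linarith
end

section
/- Let Ω ⊂ ℝ^N be a smoothly bounded domain, λ, μ > 0, α > 1/2, ε > 0, and (u, v) a stable classical solution of the Gelfand system. Set X = ∫_Ω e^{(2α+1)u/2} e^{v/2} dx and Y = ∫_Ω e^{(2α+1)v/2} e^{u/2} dx. Then there is a constant C₁ > 0 depending only on |Ω|, α and ε such that (1 − (α/4 + ε)²) X Y ≤ C₁ (λ/μ + μ/λ)² (1 + X^{(2α−1)/(2α)} Y^{1/(2α)} + Y^{(2α−1)/(2α)} X^{1/(2α)}). -/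
open MeasureTheory Real
open scoped RealInnerProductSpace

/-- Divergence theorem for a compactly supported field `c ∇w`. -/
lemma gel_div_s14 {N : ℕ} {Ω K : Set (EuclideanSpace ℝ (Fin N))} (hΩ : IsOpen Ω)
    (hK : IsCompact K) (hKΩ : K ⊆ Ω) {c w : EuclideanSpace ℝ (Fin N) → ℝ}
    (hc : ContDiffOn ℝ 1 c Ω) (hw : ContDiffOn ℝ 2 w Ω) (hc0 : ∀ x ∈ Ω, x ∉ K → c x = 0) :
    IntegrableOn (fun x => (∑ i : Fin N, fderiv ℝ c x (EuclideanSpace.single i 1) *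
      fderiv ℝ w x (EuclideanSpace.single i 1)) + c x * lap w x) Ω ∧
    ∫ x in Ω, ((∑ i : Fin N, fderiv ℝ c x (EuclideanSpace.single i 1) *
      fderiv ℝ w x (EuclideanSpace.single i 1)) + c x * lap w x) = 0 := by
  classical
  let f : Fin N → EuclideanSpace ℝ (Fin N) → ℝ := fun i =>
    Ω.indicator (fun x => c x * fderiv ℝ w x (EuclideanSpace.single i 1))
  have hw1 : ∀ i : Fin N, ContDiffOn ℝ 1
      (fun x => fderiv ℝ w x (EuclideanSpace.single i 1)) Ω := by
    intro i
    have h := hw.fderiv_of_isOpen (m := 1) hΩ (by norm_num)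
    exact h.clm_apply contDiffOn_const
  have hfz : ∀ i x, x ∉ K → f i x = 0 := by
    intro i x hx
    by_cases hxΩ : x ∈ Ω
    · simp [f, hxΩ, hc0 x hxΩ hx]
    · simp [f, hxΩ]
  have hfC : ∀ i, ContDiff ℝ 1 (f i) := by
    intro i
    rw [contDiff_iff_contDiffAt]
    intro x
    by_cases hxK : x ∈ K
    · have hx := hKΩ hxK
      have h1 : ContDiffAt ℝ 1 (fun x => c x * fderiv ℝ w x (EuclideanSpace.single i 1)) x :=
        ((hc.mul (hw1 i)).contDiffAt (hΩ.mem_nhds hx))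
      refine h1.congr_of_eventuallyEq ?_
      filter_upwards [hΩ.mem_nhds hx] with y hy
      simp [f, hy]
    · refine (contDiffAt_const (c := (0:ℝ))).congr_of_eventuallyEq ?_
      filter_upwards [hK.isClosed.isOpen_compl.mem_nhds hxK] with y hy
      exact hfz i y hy
  have hfs : ∀ i, HasCompactSupport (f i) := fun i =>
    HasCompactSupport.intro hK (hfz i)
  have hgc : ∀ i, Continuous (fun x => fderiv ℝ (f i) x (EuclideanSpace.single i 1)) := fun i =>
    ((hfC i).continuous_fderiv (by norm_num)).clm_apply continuous_const
  have hgs : ∀ i, HasCompactSupport (fun x => fderiv ℝ (f i) x (EuclideanSpace.single i 1)) :=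
    fun i => (hfs i).fderiv_apply (𝕜 := ℝ) _
  have hgi : ∀ i, Integrable (fun x => fderiv ℝ (f i) x (EuclideanSpace.single i 1)) :=
    fun i => (hgc i).integrable_of_hasCompactSupport (hgs i)
  have hg0 : ∀ i, ∫ x, fderiv ℝ (f i) x (EuclideanSpace.single i 1) = 0 := by
    intro i
    have := integral_mul_fderiv_eq_neg_fderiv_mul_of_integrable (𝕜 := ℝ)
      (μ := (volume : Measure (EuclideanSpace ℝ (Fin N))))
      (f := fun _ => (1:ℝ)) (g := f i) (v := EuclideanSpace.single i 1)
      (by simp) (by simpa using hgi i)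
      (by simpa using (hfC i).continuous.integrable_of_hasCompactSupport (hfs i))
      (by intro x _; fun_prop) (fun x _ => (hfC i).differentiable (by norm_num) x)
    simpa using this
  have hgoff : ∀ i x, x ∉ Ω → fderiv ℝ (f i) x (EuclideanSpace.single i 1) = 0 := by
    intro i x hx
    have : f i =ᶠ[nhds x] fun _ => (0:ℝ) := by
      filter_upwards [hK.isClosed.isOpen_compl.mem_nhds (fun h => hx (hKΩ h))] with y hy
      exact hfz i y hy
    rw [this.fderiv_eq]; simp
  have hsum : ∀ x ∈ Ω, (∑ i : Fin N, fderiv ℝ (f i) x (EuclideanSpace.single i 1)) =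
      (∑ i : Fin N, fderiv ℝ c x (EuclideanSpace.single i 1) *
      fderiv ℝ w x (EuclideanSpace.single i 1)) + c x * lap w x := by
    intro x hx
    unfold lap
    rw [Finset.mul_sum, ← Finset.sum_add_distrib]
    refine Finset.sum_congr rfl fun i _ => ?_
    have : f i =ᶠ[nhds x] (fun x => c x * fderiv ℝ w x (EuclideanSpace.single i 1)) := by
      filter_upwards [hΩ.mem_nhds hx] with y hy
      simp [f, hy]
    rw [this.fderiv_eq, fderiv_fun_mul]
    · simp; ring
    · exact (hc.contDiffAt (hΩ.mem_nhds hx)).differentiableAt (by norm_num)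
    · exact ((hw1 i).contDiffAt (hΩ.mem_nhds hx)).differentiableAt (by norm_num)
  have hI : Integrable (fun x => ∑ i : Fin N, fderiv ℝ (f i) x (EuclideanSpace.single i 1)) :=
    integrable_finsetSum _ fun i _ => hgi i
  constructor
  · exact (hI.integrableOn (s := Ω)).congr_fun (fun x hx => hsum x hx) hΩ.measurableSet
  · rw [← setIntegral_congr_fun hΩ.measurableSet hsum,
      setIntegral_eq_integral_of_forall_compl_eq_zero, integral_finsetSum _ fun i _ => hgi i]
    · simp [hg0]
    · intro x hx
      exact Finset.sum_eq_zero fun i _ => hgoff i x hx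

lemma gel_integrable_s14 {N : ℕ} {Ω : Set (EuclideanSpace ℝ (Fin N))} (hΩ : IsBoundedDomain Ω)
    {f : EuclideanSpace ℝ (Fin N) → ℝ} (hf : ContinuousOn f (closure Ω)) :
    IntegrableOn f Ω :=
  (hf.integrableOn_compact hΩ.2.2.isCompact_closure).mono_set subset_closure

/-- The stability inequality tested with `g(u)`, combined with the equation tested with `H(u)`. -/
lemma gel_key {N : ℕ} {Ω : Set (EuclideanSpace ℝ (Fin N))} (hΩ : IsBoundedDomain Ω)
    {lam s : ℝ} (hlam : 0 < lam) (hs : 0 < s) {u v : EuclideanSpace ℝ (Fin N) → ℝ}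
    (h : IsStableGelfandSolution Ω lam (lam * s ^ 2) u v)
    {g H : ℝ → ℝ} (hg : ContDiff ℝ 1 g) (hH : ContDiff ℝ 1 H)
    (hgH : ∀ t, (deriv g t) ^ 2 ≤ deriv H t) {τ : ℝ} (hτ : 0 < τ)
    (hg0 : ∀ t ≤ τ, g t = 0) (hH0 : ∀ t ≤ τ, H t = 0) :
    ∫ x in Ω, exp ((u x + v x) / 2) * g (u x) ^ 2 ≤ s * ∫ x in Ω, exp (v x) * H (u x) := by
  obtain ⟨⟨hu, hv, hu2, hv2, hu0, hv0⟩, l1, φ, ψ, hl1, hφ, hψ, hφp, hψp, hφe, hψe, -, -⟩ := h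
  have hO := hΩ.1
  have hsub : Ω ⊆ closure Ω := subset_closure
  have huc := hu.continuousOn
  have hvc := hv.continuousOn
  let K : Set (EuclideanSpace ℝ (Fin N)) := closure Ω ∩ u ⁻¹' Set.Ici τ
  have hK : IsCompact K :=
    hΩ.2.2.isCompact_closure.of_isClosed_subset
      (huc.preimage_isClosed_of_isClosed isClosed_closure isClosed_Ici) Set.inter_subset_left
  have hKΩ : K ⊆ Ω := by
    rintro x ⟨hx1, hx2⟩
    by_contra hx
    have : x ∈ frontier Ω := by
      rw [frontier, hO.interior_eq]; exact ⟨hx1, hx⟩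
    have h0 := hu0 x this
    simp only [Set.mem_preimage, Set.mem_Ici] at hx2
    linarith
  have hKt : ∀ x ∈ Ω, x ∉ K → u x ≤ τ := by
    intro x hx hxK
    by_contra hcon
    exact hxK ⟨hsub hx, (not_le.mp hcon).le⟩
  have huO := hu.mono hsub
  have hφO := hφ.mono hsub
  have hψO := hψ.mono hsub
  have hu1 : ContDiffOn ℝ 1 u Ω := huO.of_le (by norm_num)
  have hφ1 : ContDiffOn ℝ 1 φ Ω := hφO.of_le (by norm_num)
  have hψ1 : ContDiffOn ℝ 1 ψ Ω := hψO.of_le (by norm_num)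
  have hgu : ContDiffOn ℝ 1 (fun x => g (u x)) Ω := hg.comp_contDiffOn hu1
  have hHu : ContDiffOn ℝ 1 (fun x => H (u x)) Ω := hH.comp_contDiffOn hu1
  have D : ∀ {w : EuclideanSpace ℝ (Fin N) → ℝ}, ContDiffOn ℝ 1 w Ω → ∀ x ∈ Ω,
      HasFDerivAt w (fderiv ℝ w x) x := fun hw x hx =>
    ((hw.contDiffAt (hO.mem_nhds hx)).differentiableAt (by norm_num)).hasFDerivAt
  have gd : ∀ t, HasDerivAt g (deriv g t) t := fun t =>
    (hg.differentiable (by norm_num) t).hasDerivAt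
  have Hd : ∀ t, HasDerivAt H (deriv H t) t := fun t =>
    (hH.differentiable (by norm_num) t).hasDerivAt
  -- the three vanishing integrals
  obtain ⟨i1, e1⟩ := gel_div_s14 hO hK hKΩ (c := fun x => g (u x) ^ 2 / φ x) (w := φ)
    ((hgu.pow 2).div hφ1 fun x hx => (hφp x hx).ne') hφO
    (fun x hx hxK => by simp [hg0 _ (hKt x hx hxK)])
  obtain ⟨i2, e2⟩ := gel_div_s14 hO hK hKΩ (c := fun x => g (u x) ^ 2 / ψ x) (w := ψ)
    ((hgu.pow 2).div hψ1 fun x hx => (hψp x hx).ne') hψO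
    (fun x hx hxK => by simp [hg0 _ (hKt x hx hxK)])
  obtain ⟨i3, e3⟩ := gel_div_s14 hO hK hKΩ (c := fun x => H (u x)) (w := u)
    hHu huO (fun x hx hxK => by simp [hH0 _ (hKt x hx hxK)])
  have key : ∀ {w : EuclideanSpace ℝ (Fin N) → ℝ}, ContDiffOn ℝ 1 w Ω → (∀ x ∈ Ω, 0 < w x) →
      ∀ x ∈ Ω, (∑ i : Fin N, fderiv ℝ (fun x => g (u x) ^ 2 / w x) x (EuclideanSpace.single i 1) *
        fderiv ℝ w x (EuclideanSpace.single i 1)) ≤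
        ∑ i : Fin N, fderiv ℝ (fun x => H (u x)) x (EuclideanSpace.single i 1) *
          fderiv ℝ u x (EuclideanSpace.single i 1) := by
    intro w hw hwp x hx
    refine Finset.sum_le_sum fun i _ => ?_
    have hwx := hwp x hx
    have d1 : HasFDerivAt (fun x => g (u x)) (deriv g (u x) • fderiv ℝ u x) x :=
      (gd (u x)).comp_hasFDerivAt x (D hu1 x hx)
    have d2 : HasFDerivAt (fun x => H (u x)) (deriv H (u x) • fderiv ℝ u x) x :=
      (Hd (u x)).comp_hasFDerivAt x (D hu1 x hx)
    have d3 : HasFDerivAt (fun x => (w x)⁻¹) ((-(w x ^ 2)⁻¹) • fderiv ℝ w x) x :=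
      (hasDerivAt_inv hwx.ne').comp_hasFDerivAt x (D hw x hx)
    have d4 := (d1.pow 2).mul d3
    have d5 := HasFDerivAt.fderiv (HasFDerivAt.congr_of_eventuallyEq
      (f₁ := fun x => g (u x) ^ 2 / w x) d4
      (Filter.Eventually.of_forall fun y => by simp [div_eq_mul_inv]))
    rw [d5, d2.fderiv]
    simp only [_root_.add_apply, _root_.smul_apply, smul_eq_mul]
    set a := fderiv ℝ u x (EuclideanSpace.single i 1)
    set b := fderiv ℝ w x (EuclideanSpace.single i 1)
    have h1 := hgH (u x)
    have h2 : deriv g (u x) ^ 2 * a ^ 2 ≤ deriv H (u x) * a ^ 2 :=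
      mul_le_mul_of_nonneg_right h1 (sq_nonneg a)
    have h3 := sq_nonneg (deriv g (u x) * a - g (u x) * b * (w x)⁻¹)
    have h4 : (w x ^ 2)⁻¹ = (w x)⁻¹ ^ 2 := by rw [inv_pow]
    simp
    rw [h4]
    nlinarith
  have I1 : IntegrableOn (fun x => exp ((u x + v x) / 2) * g (u x) ^ 2) Ω := by
    apply gel_integrable_s14 hΩ
    have := hg.continuous
    fun_prop
  have I2 : IntegrableOn (fun x => exp (v x) * H (u x)) Ω := by
    apply gel_integrable_s14 hΩ
    have := hH.continuous
    fun_prop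
  have main : 0 ≤ ∫ x in Ω, (2 * lam * s ^ 2 * (exp (v x) * H (u x)) -
      2 * lam * s * (exp ((u x + v x) / 2) * g (u x) ^ 2)) := by
    have hz := integral_sub (i1.add i2) (i3.const_mul 2)
    have hz2 := integral_add i1 i2
    simp only [Pi.add_apply] at hz
    rw [hz2, integral_const_mul, e1, e2, e3] at hz
    norm_num at hz
    rw [← hz]
    refine setIntegral_mono_on ((i1.add i2).sub (i3.const_mul 2))
      ((I2.const_mul _).sub (I1.const_mul _)) hO.measurableSet ?_
    intro x hx
    have k1 := key hφ1 hφp x hx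
    have k2 := key hψ1 hψp x hx
    have p1 := hφp x hx
    have p2 := hψp x hx
    have q1 : lap φ x = -(lam * s ^ 2 * exp (v x) * ψ x) - l1 * φ x := by linarith [hφe x hx]
    have q2 : lap ψ x = -(lam * exp (u x) * φ x) - l1 * ψ x := by linarith [hψe x hx]
    have q3 : lap u x = -(lam * s ^ 2 * exp (v x)) := by linarith [hu2 x hx]
    have ee : exp ((u x + v x) / 2) = exp (u x / 2) * exp (v x / 2) := by
      rw [← exp_add]; ring_nf
    have eu : exp (u x) = exp (u x / 2) ^ 2 := by rw [← exp_nat_mul]; ring_nf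
    have ev : exp (v x) = exp (v x / 2) ^ 2 := by rw [← exp_nat_mul]; ring_nf
    rw [q1, q2, q3, ee, eu, ev]
    set a := exp (u x / 2)
    set b := exp (v x / 2)
    set G := g (u x)
    have r1 : G ^ 2 / φ x * (-(lam * s ^ 2 * b ^ 2 * ψ x) - l1 * φ x)
      = -lam * G ^ 2 * (s ^ 2 * b ^ 2 * (ψ x / φ x)) - l1 * G ^ 2 := by field_simp
    have r2 : G ^ 2 / ψ x * (-(lam * a ^ 2 * φ x) - l1 * ψ x)
      = -lam * G ^ 2 * (a ^ 2 * (φ x / ψ x)) - l1 * G ^ 2 := by field_simp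
    have r3 : 2 * (s * b * a) ≤ s ^ 2 * b ^ 2 * (ψ x / φ x) + a ^ 2 * (φ x / ψ x) := by
      have : s ^ 2 * b ^ 2 * (ψ x / φ x) + a ^ 2 * (φ x / ψ x) - 2 * (s * b * a)
          = (s * b * ψ x - a * φ x) ^ 2 / (φ x * ψ x) := by field_simp; ring
      have : 0 ≤ (s * b * ψ x - a * φ x) ^ 2 / (φ x * ψ x) := by positivity
      linarith
    have r4 := mul_le_mul_of_nonneg_left r3 (show 0 ≤ lam * G ^ 2 by positivity)
    have r5 : 0 ≤ l1 * G ^ 2 := by positivity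
    rw [r1, r2]
    nlinarith
  rw [integral_sub (I2.const_mul _) (I1.const_mul _), integral_const_mul, integral_const_mul] at main
  have hp : 0 < 2 * lam * s := by positivity
  refine le_of_mul_le_mul_left ?_ hp
  nlinarith

lemma gel_pp (x : ℝ) : HasDerivAt (fun x : ℝ => max x 0 ^ 2) (2 * max x 0) x := by
  rcases lt_trichotomy x 0 with hx | hx | hx
  · rw [max_eq_right hx.le, mul_zero]
    refine (hasDerivAt_const x (0:ℝ)).congr_of_eventuallyEq ?_
    filter_upwards [gt_mem_nhds hx] with y hy
    simp [max_eq_right (le_of_lt hy)]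
  · subst hx
    rw [hasDerivAt_iff_isLittleO_nhds_zero]
    simp only [zero_add, max_self, mul_zero, smul_zero, sub_zero, ne_eq, OfNat.ofNat_ne_zero,
      not_false_eq_true, zero_pow]
    have h1 : (fun h : ℝ => max h 0 ^ 2) =O[nhds 0] (fun h : ℝ => h ^ 2) := by
      refine Asymptotics.isBigO_of_le _ fun h => ?_
      simp only [norm_pow, Real.norm_eq_abs]
      refine pow_le_pow_left₀ (abs_nonneg _) ?_ 2
      rw [abs_of_nonneg (le_max_right h 0)]
      exact max_le (le_abs_self h) (abs_nonneg h)
    refine h1.trans_isLittleO ?_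
    simpa using Asymptotics.isLittleO_pow_pow (𝕜 := ℝ) (show 1 < 2 by norm_num)
  · rw [max_eq_left hx.le]
    have : HasDerivAt (fun x : ℝ => x ^ 2) (2 * x) x := by simpa using hasDerivAt_pow 2 x
    refine this.congr_of_eventuallyEq ?_
    filter_upwards [lt_mem_nhds hx] with y hy
    simp [max_eq_left (le_of_lt hy)]

lemma gel_ppC : ContDiff ℝ 1 (fun x : ℝ => max x 0 ^ 2) := by
  rw [contDiff_one_iff_deriv]
  refine ⟨fun x => (gel_pp x).differentiableAt, ?_⟩
  have : deriv (fun x : ℝ => max x 0 ^ 2) = fun x => 2 * max x 0 :=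
    funext fun x => (gel_pp x).deriv
  rw [this]; fun_prop

/-- The test functions. -/
lemma gel_test {α : ℝ} (hα : 0 < α) : ∃ (g H : ℝ → ℝ) (τ : ℝ), ContDiff ℝ 1 g ∧ ContDiff ℝ 1 H ∧
    (∀ t, (deriv g t) ^ 2 ≤ deriv H t) ∧ 0 < τ ∧ (∀ t ≤ τ, g t = 0) ∧ (∀ t ≤ τ, H t = 0) ∧
    (∀ t, exp (α * t / 2) ^ 2 - g t ^ 2 ≤ 8 * exp (α * t / 2)) ∧
    (∀ t, H t ≤ α / 4 * exp (α * t / 2) ^ 2) := by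
  have hAB : ∀ t, exp (α * t / 2) * exp (-(α * t / 2)) = 1 := fun t => by
    rw [← exp_add]; simp
  have hA : ∀ t, HasDerivAt (fun t => exp (α * t / 2)) (exp (α * t / 2) * (α / 2)) t := fun t => by
    have : HasDerivAt (fun t => α * t / 2) (α / 2) t := by
      simpa using ((hasDerivAt_id t).const_mul α).div_const 2
    exact this.exp
  have hB : ∀ t, HasDerivAt (fun t => exp (-(α * t / 2))) (exp (-(α * t / 2)) * (-(α / 2))) t :=
    fun t => by
    have : HasDerivAt (fun t => α * t / 2) (α / 2) t := by
      simpa using ((hasDerivAt_id t).const_mul α).div_const 2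
    exact this.neg.exp
  have hsmall : ∀ t ≤ 2 * log 2 / α, exp (α * t / 2) ≤ 2 := by
    intro t ht
    rw [le_div_iff₀ hα] at ht
    calc exp (α * t / 2) ≤ exp (log 2) := exp_le_exp.mpr (by linarith)
      _ = 2 := exp_log (by norm_num)
  refine ⟨fun t => max (exp (α * t / 2) - 2) 0 ^ 2 * exp (-(α * t / 2)),
    fun t => α / 4 * max (exp (α * t / 2) - 4 * exp (-(α * t / 2))) 0 ^ 2, 2 * log 2 / α,
    ?_, ?_, ?_, ?_, ?_, ?_, ?_, ?_⟩
  · have h1 : ContDiff ℝ 1 (fun t => exp (α * t / 2) - 2) := by fun_prop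
    have h2 : ContDiff ℝ 1 (fun t => exp (-(α * t / 2))) := by fun_prop
    exact (gel_ppC.comp h1).mul h2
  · have h1 : ContDiff ℝ 1 (fun t => exp (α * t / 2) - 4 * exp (-(α * t / 2))) := by fun_prop
    exact contDiff_const.mul (gel_ppC.comp h1)
  · intro t
    have d1 := ((gel_pp (exp (α * t / 2) - 2)).comp t ((hA t).sub_const 2)).mul (hB t)
    have d2 := ((gel_pp (exp (α * t / 2) - 4 * exp (-(α * t / 2)))).comp t
      ((hA t).sub ((hB t).const_mul 4))).const_mul (α / 4)
    have e1 := d1.deriv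
    have e2 := d2.deriv
    simp only [Function.comp_def] at e1 e2
    have e1' : deriv (fun t => max (exp (α * t / 2) - 2) 0 ^ 2 * exp (-(α * t / 2))) t = _ := e1
    have e2' : deriv (fun t => α / 4 * max (exp (α * t / 2) - 4 * exp (-(α * t / 2))) 0 ^ 2) t = _ :=
      e2
    rw [e1', e2']
    have ab := hAB t
    have pA := exp_pos (α * t / 2)
    have pB := exp_pos (-(α * t / 2))
    set A := exp (α * t / 2)
    set B := exp (-(α * t / 2))
    rcases le_total A 2 with h | h
    · rw [max_eq_right (by linarith : A - 2 ≤ 0)]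
      have : 0 ≤ max (A - 4 * B) 0 := le_max_right _ _
      have h2 : 0 ≤ α / 4 * (2 * max (A - 4 * B) 0 * (α / 2 * (A + 4 * B))) := by positivity
      nlinarith
    · have h4 : 0 ≤ A - 4 * B := by
        have : A - 4 * B = B * (A ^ 2 - 4) := by linear_combination (-A) * ab
        rw [this]; apply mul_nonneg pB.le; nlinarith
      rw [max_eq_left (by linarith : 0 ≤ A - 2), max_eq_left h4]
      have e : 2 * (A - 2) * (A * (α / 2)) * B + (A - 2) ^ 2 * (B * -(α / 2))
          = α / 2 * (A - 4 * B) := by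
        linear_combination (α / 2 * A) * ab
      rw [e]
      have h5 : 0 ≤ α ^ 2 * ((A - 4 * B) * B) := by positivity
      nlinarith
  · have := log_pos (show (1:ℝ) < 2 by norm_num)
    positivity
  · intro t ht
    have := hsmall t ht
    simp [max_eq_right (by linarith : exp (α * t / 2) - 2 ≤ 0)]
  · intro t ht
    have h := hsmall t ht
    have ab := hAB t
    have pA := exp_pos (α * t / 2)
    have pB := exp_pos (-(α * t / 2))
    dsimp only
    set A := exp (α * t / 2)
    set B := exp (-(α * t / 2))
    have h4 : A - 4 * B ≤ 0 := by
      have : A - 4 * B = B * (A ^ 2 - 4) := by linear_combination (-A) * ab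
      rw [this]; apply mul_nonpos_of_nonneg_of_nonpos pB.le; nlinarith
    simp [max_eq_right h4]
  · intro t
    have ab := hAB t
    have pA := exp_pos (α * t / 2)
    have pB := exp_pos (-(α * t / 2))
    dsimp only
    set A := exp (α * t / 2)
    set B := exp (-(α * t / 2))
    rcases le_total A 2 with h | h
    · rw [max_eq_right (by linarith : A - 2 ≤ 0)]
      nlinarith
    · rw [max_eq_left (by linarith : 0 ≤ A - 2)]
      have e : (A - 2) ^ 2 * B = A - 4 + 4 * B := by linear_combination (A - 4) * ab
      rw [e]
      have e2 : A ^ 2 - (A - 4 + 4 * B) ^ 2 = 8 * A - 24 + 32 * B - 16 * B ^ 2 := by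
        linear_combination (-8) * ab
      rw [e2]
      nlinarith [sq_nonneg (B - 1)]
  · intro t
    have pA := exp_pos (α * t / 2)
    have pB := exp_pos (-(α * t / 2))
    dsimp only
    gcongr
    exact max_le (by linarith) pA.le

lemma gel_half {N : ℕ} {Ω : Set (EuclideanSpace ℝ (Fin N))} (hΩ : IsBoundedDomain Ω)
    {lam s α δ η : ℝ} (hlam : 0 < lam) (hs : 0 < s) (hα : 0 < α) (hδ : 0 < δ) (hη : 0 < η)
    {u v : EuclideanSpace ℝ (Fin N) → ℝ}
    (h : IsStableGelfandSolution Ω lam (lam * s ^ 2) u v) :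
    (1 - δ) * (∫ x in Ω, exp ((2 * α + 1) * u x / 2) * exp (v x / 2)) ≤
      (α / 4 + η) * s * (∫ x in Ω, exp (α * u x + v x)) +
        16 * (8 / δ) ^ (2 / α) / η * (volume Ω).toReal / s := by
  obtain ⟨g, H, τ, hg, hH, hgH, hτ, hg0, hH0, hgA, hHA⟩ := gel_test hα
  have key := gel_key hΩ hlam hs h hg hH hgH hτ hg0 hH0
  have huc := h.1.1.continuousOn
  have hvc := h.1.2.1.continuousOn
  have cg := hg.continuous
  have cH := hH.continuous
  have I1 : IntegrableOn (fun x => exp ((u x + v x) / 2) * g (u x) ^ 2) Ω :=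
    gel_integrable_s14 hΩ (by fun_prop)
  have I2 : IntegrableOn (fun x => exp (v x) * H (u x)) Ω := gel_integrable_s14 hΩ (by fun_prop)
  have I3 : IntegrableOn (fun x => exp ((2 * α + 1) * u x / 2) * exp (v x / 2)) Ω :=
    gel_integrable_s14 hΩ (by fun_prop)
  have I4 : IntegrableOn (fun x => exp (α * u x + v x)) Ω := gel_integrable_s14 hΩ (by fun_prop)
  have I5 : IntegrableOn (fun _ : EuclideanSpace ℝ (Fin N) => 16 * (8 / δ) ^ (2 / α) / η / s) Ω :=
    gel_integrable_s14 hΩ (by fun_prop)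
  have I6 : IntegrableOn (fun x => exp ((u x + v x) / 2) * g (u x) ^ 2 +
      η * s * exp (α * u x + v x)) Ω := I1.add (I4.const_mul _)
  have J1 : ∫ x in Ω, exp (v x) * H (u x) ≤ α / 4 * ∫ x in Ω, exp (α * u x + v x) := by
    rw [← integral_const_mul]
    refine setIntegral_mono_on I2 (I4.const_mul _) hΩ.1.measurableSet fun x _ => ?_
    have e : exp (α * u x + v x) = exp (v x) * exp (α * u x / 2) ^ 2 := by
      rw [← exp_nat_mul, ← exp_add]; congr 1; push_cast; ring
    rw [e]
    nlinarith [hHA (u x), exp_pos (v x)]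
  have J2 : (1 - δ) * (∫ x in Ω, exp ((2 * α + 1) * u x / 2) * exp (v x / 2)) ≤
      (∫ x in Ω, exp ((u x + v x) / 2) * g (u x) ^ 2) +
        η * s * (∫ x in Ω, exp (α * u x + v x)) +
        ∫ x in Ω, 16 * (8 / δ) ^ (2 / α) / η / s := by
    rw [← integral_const_mul, ← integral_const_mul, ← integral_add I1 (I4.const_mul _),
      ← integral_add I6 I5]
    refine setIntegral_mono_on (I3.const_mul _) (I6.add I5)
      hΩ.1.measurableSet fun x _ => ?_
    have e1 : exp (α * u x + v x) = exp (v x / 2) ^ 2 * exp (α * u x / 2) ^ 2 := by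
      rw [← exp_nat_mul, ← exp_nat_mul, ← exp_add]; congr 1; push_cast; ring
    have e2 : exp ((2 * α + 1) * u x / 2) = exp (u x / 2) * exp (α * u x / 2) ^ 2 := by
      rw [← exp_nat_mul, ← exp_add]; congr 1; push_cast; ring
    have e3 : exp ((u x + v x) / 2) = exp (u x / 2) * exp (v x / 2) := by
      rw [← exp_add]; congr 1; ring
    have e4 : exp (u x / 2) ^ 2 = exp (α * u x / 2) ^ (2 / α) := by
      rw [← exp_nat_mul, ← exp_mul]; congr 1; push_cast; field_simp
    have hA := hgA (u x)
    rw [e1, e2, e3]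
    have pA := exp_pos (α * u x / 2)
    have pq := exp_pos (u x / 2)
    have pp := exp_pos (v x / 2)
    set A := exp (α * u x / 2)
    set q := exp (u x / 2)
    set p := exp (v x / 2)
    set G := g (u x)
    have h1 : q * p * (A ^ 2 - G ^ 2) ≤ q * p * (8 * A) :=
      mul_le_mul_of_nonneg_left hA (by positivity)
    have hC : 0 ≤ 16 * (8 / δ) ^ (2 / α) / η / s := by positivity
    rcases le_total (8 / δ) A with hc | hc
    · rw [div_le_iff₀ hδ] at hc
      have h2 : q * p * (8 * A) ≤ q * p * (A * δ * A) := by gcongr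
      have h3 : 0 ≤ η * s * (p ^ 2 * A ^ 2) := by positivity
      nlinarith
    · have h2 : q ^ 2 ≤ (8 / δ) ^ (2 / α) := by
        rw [e4]; exact rpow_le_rpow pA.le hc (by positivity)
      have h3 : 16 * q ^ 2 / η / s ≤ 16 * (8 / δ) ^ (2 / α) / η / s := by gcongr
      have h4 : q * p * (8 * A) ≤ η * s * (p ^ 2 * A ^ 2) + 16 * q ^ 2 / η / s := by
        have e : η * s * (p ^ 2 * A ^ 2) + 16 * q ^ 2 / η / s - q * p * (8 * A)
            = (η * s * (p * A) - 4 * q) ^ 2 / (η * s) := by field_simp; ring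
        have : 0 ≤ (η * s * (p * A) - 4 * q) ^ 2 / (η * s) := by positivity
        linarith
      have h5 : 0 ≤ δ * (q * A ^ 2 * p) := by positivity
      nlinarith
  have J3 : ∫ x in Ω, 16 * (8 / δ) ^ (2 / α) / η / s =
      16 * (8 / δ) ^ (2 / α) / η * (volume Ω).toReal / s := by
    rw [setIntegral_const, smul_eq_mul, Measure.real]; ring
  rw [J3] at J2
  have J4 := mul_le_mul_of_nonneg_left J1 hs.le
  nlinarith

/-- Hölder's inequality in the form needed. -/
lemma gel_holder {N : ℕ} {Ω : Set (EuclideanSpace ℝ (Fin N))} (hΩ : IsBoundedDomain Ω)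
    {α : ℝ} (hα : 1 / 2 < α) {u v : EuclideanSpace ℝ (Fin N) → ℝ}
    (huc : ContinuousOn u (closure Ω)) (hvc : ContinuousOn v (closure Ω))
    {X Y : ℝ} (hX : X = ∫ x in Ω, exp ((2 * α + 1) * u x / 2) * exp (v x / 2))
    (hY : Y = ∫ x in Ω, exp ((2 * α + 1) * v x / 2) * exp (u x / 2)) (hX0 : 0 < X) (hY0 : 0 < Y) :
    ∫ x in Ω, exp (α * u x + v x) ≤ X ^ ((2 * α - 1) / (2 * α)) * Y ^ (1 / (2 * α)) := by
  have hα0 : 0 < α := by linarith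
  set a := (2 * α - 1) / (2 * α) with ha
  set b := 1 / (2 * α) with hb
  have ha0 : 0 ≤ a := div_nonneg (by linarith) (by linarith)
  have hb0 : 0 ≤ b := by positivity
  have hab : a + b = 1 := by rw [ha, hb]; field_simp; ring
  have I1 : IntegrableOn (fun x => exp (α * u x + v x)) Ω := gel_integrable_s14 hΩ (by fun_prop)
  have I3 : IntegrableOn (fun x => exp ((2 * α + 1) * u x / 2) * exp (v x / 2)) Ω :=
    gel_integrable_s14 hΩ (by fun_prop)
  have I4 : IntegrableOn (fun x => exp ((2 * α + 1) * v x / 2) * exp (u x / 2)) Ω :=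
    gel_integrable_s14 hΩ (by fun_prop)
  have J : ∫ x in Ω, exp (α * u x + v x) ≤ ∫ x in Ω,
      ((X ^ a * Y ^ b * a / X) * (exp ((2 * α + 1) * u x / 2) * exp (v x / 2)) +
        (X ^ a * Y ^ b * b / Y) * (exp ((2 * α + 1) * v x / 2) * exp (u x / 2))) := by
    refine setIntegral_mono_on I1 ((I3.const_mul _).add (I4.const_mul _)) hΩ.1.measurableSet
      fun x _ => ?_
    have f0 : 0 < exp ((2 * α + 1) * u x / 2) * exp (v x / 2) := by positivity
    have g0 : 0 < exp ((2 * α + 1) * v x / 2) * exp (u x / 2) := by positivity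
    have e : exp (α * u x + v x) = (exp ((2 * α + 1) * u x / 2) * exp (v x / 2)) ^ a *
        (exp ((2 * α + 1) * v x / 2) * exp (u x / 2)) ^ b := by
      rw [← exp_add, ← exp_add, ← exp_mul, ← exp_mul, ← exp_add]
      congr 1
      rw [ha, hb]; field_simp; ring
    rw [e]
    set f := exp ((2 * α + 1) * u x / 2) * exp (v x / 2)
    set g := exp ((2 * α + 1) * v x / 2) * exp (u x / 2)
    have := Real.geom_mean_le_arith_mean2_weighted ha0 hb0 (div_pos f0 hX0).le (div_pos g0 hY0).le hab
    rw [div_rpow f0.le hX0.le, div_rpow g0.le hY0.le] at this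
    have pX : 0 < X ^ a := rpow_pos_of_pos hX0 _
    have pY : 0 < Y ^ b := rpow_pos_of_pos hY0 _
    have h2 := mul_le_mul_of_nonneg_left this (mul_pos pX pY).le
    calc f ^ a * g ^ b = X ^ a * Y ^ b * (f ^ a / X ^ a * (g ^ b / Y ^ b)) := by field_simp
      _ ≤ _ := h2
      _ = _ := by ring
  rw [integral_add (I3.const_mul _) (I4.const_mul _), integral_const_mul, integral_const_mul,
    ← hX, ← hY] at J
  refine J.trans (le_of_eq ?_)
  rw [div_mul_cancel₀ _ hX0.ne', div_mul_cancel₀ _ hY0.ne']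
  linear_combination (X ^ a * Y ^ b) * hab

lemma gel_pos_s14 {N : ℕ} {Ω : Set (EuclideanSpace ℝ (Fin N))} (hΩ : IsBoundedDomain Ω)
    {f : EuclideanSpace ℝ (Fin N) → ℝ} (hf : ContinuousOn f (closure Ω)) (hp : ∀ x, 0 < f x) :
    0 < ∫ x in Ω, f x := by
  rw [setIntegral_pos_iff_support_of_nonneg_ae (Filter.Eventually.of_forall fun x => (hp x).le)
    (gel_integrable_s14 hΩ hf)]
  have : Function.support f = Set.univ := by
    ext x; simp [(hp x).ne']
  rw [this, Set.univ_inter]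
  exact hΩ.1.measure_pos _ hΩ.2.1.nonempty

lemma gel_symm {N : ℕ} {Ω : Set (EuclideanSpace ℝ (Fin N))} {lam mu : ℝ}
    {u v : EuclideanSpace ℝ (Fin N) → ℝ} (h : IsStableGelfandSolution Ω lam mu u v) :
    IsStableGelfandSolution Ω mu lam v u := by
  obtain ⟨⟨a1, a2, a3, a4, a5, a6⟩, l, φ, ψ, b1, b2, b3, b4, b5, b6, b7, b8, b9⟩ := h
  exact ⟨⟨a2, a1, a4, a3, a6, a5⟩, l, ψ, φ, b1, b3, b2, b5, b4, b7, b6, b9, b8⟩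

lemma gel_alg {κ D X Y W W' P Q : ℝ} (hκ : 0 < κ) (hD0 : 0 ≤ D) (hW0 : 0 < W) (hW0' : 0 < W')
    (hp1 : 0 ≤ P) (hp2 : 0 ≤ Q) (hpq : P * Q = 1)
    (C3 : X * Y ≤ κ ^ 2 * (X * Y) + κ * D * (P * W + Q * W') + D ^ 2) :
    (1 - κ ^ 2) * X * Y ≤ (κ * D + D ^ 2 + 1) * (Q + P) ^ 2 * (1 + W + W') := by
  have hS0 : 1 ≤ (Q + P) ^ 2 := by nlinarith [sq_nonneg (P - Q)]
  have hS1 : 1 ≤ Q + P := by nlinarith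
  have hS2 : Q + P ≤ (Q + P) ^ 2 := by nlinarith
  have hP : P ≤ (Q + P) ^ 2 := by linarith
  have hQ : Q ≤ (Q + P) ^ 2 := by linarith
  have hκD : 0 ≤ κ * D := by positivity
  generalize (Q + P) ^ 2 = T at *
  have F1 : κ * D * (P * W + Q * W') ≤ κ * D * (T * W + T * W') := by gcongr
  have F2 : D ^ 2 ≤ D ^ 2 * T := le_mul_of_one_le_right (by positivity) hS0
  have hT : 0 ≤ T := by linarith
  have F3 : 0 ≤ (D ^ 2 + 1) * T * (W + W') := by positivity
  have F4 : 0 ≤ (κ * D + 1) * T := by positivity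
  linarith

/-- There is a constant `C₁ > 0` depending only on `|Ω|`, `α` and `ε`
such that, setting `X = ∫ e^{(2α+1)u/2} e^{v/2}` and `Y = ∫ e^{(2α+1)v/2} e^{u/2}` for a
stable classical solution `(u,v)`,
`(1 − (α/4 + ε)²) X Y ≤ C₁ (λ/μ + μ/λ)² (1 + X^{(2α−1)/(2α)} Y^{1/(2α)} + Y^{(2α−1)/(2α)} X^{1/(2α)})`. -/
theorem XY_product_inequality :
    ∃ C₁ : ℝ → ℝ → ℝ → ℝ,
      ∀ (N : ℕ) (Ω : Set (EuclideanSpace ℝ (Fin N))), IsBoundedDomain Ω →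
        ∀ (α ε : ℝ), 1 / 2 < α → 0 < ε →
          0 < C₁ (volume Ω).toReal α ε ∧
          ∀ (lam mu : ℝ), 0 < lam → 0 < mu →
            ∀ (u v : EuclideanSpace ℝ (Fin N) → ℝ),
              IsStableGelfandSolution Ω lam mu u v →
              (1 - (α / 4 + ε) ^ 2) *
                  (∫ x in Ω, exp ((2 * α + 1) * u x / 2) * exp (v x / 2)) *
                  (∫ x in Ω, exp ((2 * α + 1) * v x / 2) * exp (u x / 2)) ≤
                C₁ (volume Ω).toReal α ε * (lam / mu + mu / lam) ^ 2 *
                  (1 +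
                    (∫ x in Ω, exp ((2 * α + 1) * u x / 2) * exp (v x / 2)) ^
                        ((2 * α - 1) / (2 * α)) *
                      (∫ x in Ω, exp ((2 * α + 1) * v x / 2) * exp (u x / 2)) ^
                        (1 / (2 * α)) +
                    (∫ x in Ω, exp ((2 * α + 1) * v x / 2) * exp (u x / 2)) ^
                        ((2 * α - 1) / (2 * α)) *
                      (∫ x in Ω, exp ((2 * α + 1) * u x / 2) * exp (v x / 2)) ^
                        (1 / (2 * α))) := by
  refine ⟨fun V α ε => (α / 4 + ε) *
    (16 * (8 / (1 - (α / 4 + ε / 2) / (α / 4 + ε))) ^ (2 / α) / (ε / 2) * V /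
      (1 - (1 - (α / 4 + ε / 2) / (α / 4 + ε)))) +
    (16 * (8 / (1 - (α / 4 + ε / 2) / (α / 4 + ε))) ^ (2 / α) / (ε / 2) * V /
      (1 - (1 - (α / 4 + ε / 2) / (α / 4 + ε)))) ^ 2 + 1, ?_⟩
  intro N Ω hΩ α ε hα hε
  have hα0 : 0 < α := by linarith
  have hκ : 0 < α / 4 + ε := by positivity
  have hδ : 0 < 1 - (α / 4 + ε / 2) / (α / 4 + ε) := by
    rw [sub_pos, div_lt_one hκ]; linarith
  have hδ1 : (1 - (1 - (α / 4 + ε / 2) / (α / 4 + ε))) * (α / 4 + ε) = α / 4 + ε / 2 := by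
    field_simp; ring
  have hδ2 : 0 < 1 - (1 - (α / 4 + ε / 2) / (α / 4 + ε)) := by
    rw [sub_sub_cancel]; positivity
  dsimp only
  set δ := 1 - (α / 4 + ε / 2) / (α / 4 + ε)
  have hV : 0 ≤ (volume Ω).toReal := ENNReal.toReal_nonneg
  set κ := α / 4 + ε
  set D := 16 * (8 / δ) ^ (2 / α) / (ε / 2) * (volume Ω).toReal / (1 - δ) with hD
  have hD0 : 0 ≤ D := by positivity
  refine ⟨by positivity, ?_⟩
  intro lam mu hlam hmu u v h
  have huc := h.1.1.continuousOn
  have hvc := h.1.2.1.continuousOn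
  have hX0 : 0 < ∫ x in Ω, exp ((2 * α + 1) * u x / 2) * exp (v x / 2) :=
    gel_pos_s14 hΩ (by fun_prop) (fun x => by positivity)
  have hY0 : 0 < ∫ x in Ω, exp ((2 * α + 1) * v x / 2) * exp (u x / 2) :=
    gel_pos_s14 hΩ (by fun_prop) (fun x => by positivity)
  obtain ⟨s, hs, hs2⟩ : ∃ s : ℝ, 0 < s ∧ s ^ 2 = mu / lam :=
    ⟨√(mu / lam), sqrt_pos.mpr (by positivity), sq_sqrt (by positivity)⟩
  have hm : mu = lam * s ^ 2 := by rw [hs2]; field_simp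
  have hl : lam = mu * s⁻¹ ^ 2 := by rw [hm]; field_simp
  have A1 := gel_half hΩ hlam hs hα0 hδ (half_pos hε) (hm ▸ h)
  have A2 := gel_half hΩ hmu (inv_pos.mpr hs) hα0 hδ (half_pos hε) (u := v) (v := u)
    (hl ▸ gel_symm h)
  have B1 := gel_holder hΩ hα huc hvc rfl rfl hX0 hY0
  have B2 := gel_holder hΩ hα hvc huc rfl rfl hY0 hX0
  generalize (∫ x in Ω, exp ((2 * α + 1) * u x / 2) * exp (v x / 2)) = X at *
  generalize (∫ x in Ω, exp ((2 * α + 1) * v x / 2) * exp (u x / 2)) = Y at *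
  generalize (∫ x in Ω, exp (α * u x + v x)) = W0 at *
  generalize (∫ x in Ω, exp (α * v x + u x)) = W0' at *
  have hab : (2 * α - 1) / (2 * α) + 1 / (2 * α) = 1 := by field_simp; ring
  generalize (2 * α - 1) / (2 * α) = a at *
  generalize 1 / (2 * α) = b at *
  have hWW : (X ^ a * Y ^ b) * (Y ^ a * X ^ b) = X * Y := by
    have e1 : X ^ a * X ^ b = X := by rw [← rpow_add hX0, hab, rpow_one]
    have e2 : Y ^ a * Y ^ b = Y := by rw [← rpow_add hY0, hab, rpow_one]
    calc (X ^ a * Y ^ b) * (Y ^ a * X ^ b) = (X ^ a * X ^ b) * (Y ^ a * Y ^ b) := by ring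
      _ = _ := by rw [e1, e2]
  have hW0 : 0 < X ^ a * Y ^ b := mul_pos (rpow_pos_of_pos hX0 _) (rpow_pos_of_pos hY0 _)
  have hW0' : 0 < Y ^ a * X ^ b := mul_pos (rpow_pos_of_pos hY0 _) (rpow_pos_of_pos hX0 _)
  generalize X ^ a * Y ^ b = W at *
  generalize Y ^ a * X ^ b = W' at *
  have hDe : 16 * (8 / δ) ^ (2 / α) / (ε / 2) * (volume Ω).toReal = (1 - δ) * D := by
    rw [hD]; field_simp
  rw [hDe, ← hδ1] at A1 A2
  have C1 : X ≤ κ * s * W + D / s := by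
    refine le_of_mul_le_mul_left ?_ hδ2
    calc (1 - δ) * X ≤ _ := A1
      _ ≤ (1 - δ) * κ * s * W + (1 - δ) * D / s := by gcongr
      _ = _ := by ring
  have C2 : Y ≤ κ * s⁻¹ * W' + D * s := by
    refine le_of_mul_le_mul_left ?_ hδ2
    calc (1 - δ) * Y ≤ _ := A2
      _ ≤ (1 - δ) * κ * s⁻¹ * W' + (1 - δ) * D / s⁻¹ := by gcongr
      _ = _ := by rw [div_inv_eq_mul]; ring
  have hS : lam / mu + mu / lam = (s⁻¹) ^ 2 + s ^ 2 := by
    rw [hm]; field_simp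
  rw [hS]
  have C3 : X * Y ≤ κ ^ 2 * (X * Y) + κ * D * (s ^ 2 * W + s⁻¹ ^ 2 * W') + D ^ 2 := by
    calc X * Y ≤ (κ * s * W + D / s) * (κ * s⁻¹ * W' + D * s) :=
          mul_le_mul C1 C2 hY0.le (by positivity)
      _ = κ ^ 2 * (W * W') + κ * D * (s ^ 2 * W + s⁻¹ ^ 2 * W') + D ^ 2 := by field_simp; ring
      _ = _ := by rw [hWW]
  have hp1 : 0 ≤ s ^ 2 := by positivity
  have hp2 : 0 ≤ s⁻¹ ^ 2 := by positivity
  have hpq : s ^ 2 * s⁻¹ ^ 2 = 1 := by field_simp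
  exact gel_alg hκ hD0 hW0 hW0' hp1 hp2 hpq C3
end

section
/- Let Ω ⊂ ℝ^N be a smoothly bounded domain, λ ≥ μ > 0, and (u, v) ∈ C²(Ω̄)² a classical solution of the Gelfand system. Then v ≥ u in Ω. -/
open MeasureTheory Real
open scoped RealInnerProductSpace

/-- Second derivative necessary condition at a local minimum in one variable. -/
theorem aux_deriv2_nonneg (g : ℝ → ℝ) (hg : ContinuousAt g 0) (hmin : IsLocalMin g 0) :
    0 ≤ deriv (deriv g) 0 := by
  by_contra! h
  have hmax : IsLocalMax g 0 := isLocalMax_of_deriv_deriv_neg h hmin.deriv_eq_zero hg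
  have hc : g =ᶠ[nhds 0] fun _ => g 0 := by
    filter_upwards [hmin, hmax] with t h1 h2
    exact le_antisymm h2 h1
  have h2 := hc.deriv.deriv_eq
  simp at h2
  linarith

/-- At an interior local minimum of `w`, which is `C²` there, second directional derivatives are
nonnegative. -/
theorem aux_dir2_nonneg {E : Type*} [NormedAddCommGroup E] [NormedSpace ℝ E]
    (w : E → ℝ) (x e : E) (hw : ContDiffAt ℝ 2 w x) (hmin : IsLocalMin w x) :
    0 ≤ fderiv ℝ (fun y => fderiv ℝ w y e) x e := by
  have hline : ∀ t : ℝ, HasDerivAt (fun t : ℝ => x + t • e) e t := by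
    intro t
    simpa using ((hasDerivAt_id t).smul_const e).const_add x
  have hcont : ContinuousAt (fun t : ℝ => x + t • e) 0 := (hline 0).continuousAt
  have htend : Filter.Tendsto (fun t : ℝ => x + t • e) (nhds 0) (nhds x) := by
    have := hcont.tendsto
    simpa using this
  have hx0 : x + (0 : ℝ) • e = x := by simp
  have hd : ∀ᶠ y in nhds x, DifferentiableAt ℝ w y := by
    filter_upwards [hw.eventually (by simp)] with y hy
    exact hy.differentiableAt (by simp)
  have hderiv : deriv (fun t : ℝ => w (x + t • e)) =ᶠ[nhds 0]
      fun t => fderiv ℝ w (x + t • e) e := by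
    filter_upwards [htend.eventually hd] with t ht
    exact (ht.hasFDerivAt.comp_hasDerivAt t (hline t)).deriv
  have hd2 : DifferentiableAt ℝ (fun y => fderiv ℝ w y e) x := by
    have h1 : ContDiffAt ℝ 1 (fderiv ℝ w) x := hw.fderiv_right (by norm_num)
    exact (h1.differentiableAt (by simp)).clm_apply (differentiableAt_const e)
  have hd2' : HasDerivAt (fun t : ℝ => fderiv ℝ w (x + t • e) e)
      (fderiv ℝ (fun y => fderiv ℝ w y e) x e) 0 := by
    have h3 : HasFDerivAt (fun y => fderiv ℝ w y e)
      (fderiv ℝ (fun y => fderiv ℝ w y e) x) (x + (0 : ℝ) • e) := by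
      rw [hx0]; exact hd2.hasFDerivAt
    exact h3.comp_hasDerivAt (0 : ℝ) (hline 0)
  rw [← hd2'.deriv, ← hderiv.deriv_eq]
  apply aux_deriv2_nonneg
  · exact ContinuousAt.comp (f := fun t : ℝ => x + t • e) (g := w)
      (by rw [hx0]; exact hw.continuousAt) hcont
  · have := htend.eventually hmin
    filter_upwards [this] with t ht
    simpa using ht

theorem aux_lap_sub {N : ℕ} (u v : EuclideanSpace ℝ (Fin N) → ℝ) (x : EuclideanSpace ℝ (Fin N))
    (hu : ContDiffAt ℝ 2 u x) (hv : ContDiffAt ℝ 2 v x) :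
    lap (fun y => v y - u y) x = lap v x - lap u x := by
  unfold lap
  rw [← Finset.sum_sub_distrib]
  refine Finset.sum_congr rfl fun i _ => ?_
  set e : EuclideanSpace ℝ (Fin N) := EuclideanSpace.single i 1
  have key : ∀ f : EuclideanSpace ℝ (Fin N) → ℝ, ContDiffAt ℝ 2 f x →
      DifferentiableAt ℝ (fun y => fderiv ℝ f y e) x := by
    intro f hf
    have h1 : ContDiffAt ℝ 1 (fderiv ℝ f) x := hf.fderiv_right (by norm_num)
    exact (h1.differentiableAt (by simp)).clm_apply (differentiableAt_const e)
  have hev : (fun y => fderiv ℝ (fun y => v y - u y) y e) =ᶠ[nhds x]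
      fun y => fderiv ℝ v y e - fderiv ℝ u y e := by
    filter_upwards [hu.eventually (by simp), hv.eventually (by simp)] with y h1 h2
    rw [fderiv_fun_sub (h2.differentiableAt (by simp)) (h1.differentiableAt (by simp))]
    rfl
  rw [hev.fderiv_eq, fderiv_fun_sub (key v hv) (key u hu)]
  rfl

/-- If `λ ≥ μ > 0` and `(u, v)` is a classical solution of the Gelfand
system, then `v ≥ u` in `Ω`. -/
theorem v_ge_u_of_lam_ge_mu {N : ℕ}
    (Ω : Set (EuclideanSpace ℝ (Fin N))) (hΩ : IsBoundedDomain Ω)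
    (lam mu : ℝ) (hmu : 0 < mu) (hlammu : mu ≤ lam)
    (u v : EuclideanSpace ℝ (Fin N) → ℝ)
    (huv : IsGelfandSolution Ω lam mu u v) :
    ∀ x ∈ Ω, u x ≤ v x := by
  obtain ⟨hopen, hconn, hbdd⟩ := hΩ
  obtain ⟨hu, hv, hlu, hlv, hu0, hv0⟩ := huv
  intro x hx
  by_contra! hlt
  have hcpt : IsCompact (closure Ω) := hbdd.isCompact_closure
  obtain ⟨z, hz, hzmin⟩ := hcpt.exists_isMinOn ⟨x, subset_closure hx⟩
    (hv.continuousOn.sub hu.continuousOn)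
  have hzx : v z - u z ≤ v x - u x := hzmin (subset_closure hx)
  have hzΩ : z ∈ Ω := by
    by_contra hn
    have hf : z ∈ frontier Ω := by
      rw [hopen.frontier_eq]; exact ⟨hz, hn⟩
    rw [hu0 z hf, hv0 z hf] at hzx
    linarith
  have hnhds : closure Ω ∈ nhds z := Filter.mem_of_superset (hopen.mem_nhds hzΩ) subset_closure
  have huz := hu.contDiffAt hnhds
  have hvz := hv.contDiffAt hnhds
  have hloc : IsLocalMin (fun y => v y - u y) z := hzmin.isLocalMin hnhds
  have hlap : 0 ≤ lap (fun y => v y - u y) z :=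
    Finset.sum_nonneg fun i _ => aux_dir2_nonneg _ z _ (hvz.sub huz) hloc
  rw [aux_lap_sub u v z huz hvz] at hlap
  have h1 := hlu z hzΩ
  have h2 := hlv z hzΩ
  have h3 : mu * exp (v z) < mu * exp (u z) :=
    mul_lt_mul_of_pos_left (exp_lt_exp.mpr (by linarith)) hmu
  have h4 : mu * exp (u z) ≤ lam * exp (u z) :=
    mul_le_mul_of_nonneg_right hlammu (exp_pos _).le
  linarith
end

section
/- Let Ω ⊂ ℝ^N be a smoothly bounded domain and Λ > 0. For every p with 1 ≤ p < 5 there is a constant C = C(Ω, p, Λ) such that every stable classical solution (u, v) of the Gelfand system with parameters λ ≥ μ > 0 satisfying λ/μ + μ/λ ≤ Λ obeys ∫_Ω e^{p u} dx ≤ C; the bound is uniform with respect to λ and μ. -/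
open MeasureTheory Real
open scoped RealInnerProductSpace

lemma exists_h (α : ℝ) (hα : 0 < α) : ∃ (h h' H : ℝ → ℝ) (K : ℝ),
    ContDiff ℝ 1 h ∧ ContDiff ℝ 1 H ∧ (∀ t, HasDerivAt h (h' t) t) ∧
    (∀ t, HasDerivAt H (h' t ^ 2) t) ∧ (∀ t ≤ 1, h t = 0) ∧ (∀ t ≤ 1, H t = 0) ∧
    (∀ t, 0 ≤ h t) ∧ 0 ≤ K ∧ (∀ t, exp (α * t / 2) ≤ h t + K) ∧
    (∀ t, H t ≤ α / 4 * exp (α * t)) := by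
  set χ : ℝ → ℝ := fun t => max 0 (min 1 (t - 1)) with hχ
  have χc : Continuous χ := by fun_prop
  have χ0 : ∀ t, 0 ≤ χ t := fun t => le_max_left _ _
  have χ1 : ∀ t, χ t ≤ 1 := fun t => max_le (by norm_num) (min_le_left _ _)
  have χz : ∀ t ≤ 1, χ t = 0 := fun t ht => max_eq_left ((min_le_right _ _).trans (by linarith))
  have χo : ∀ t, 2 ≤ t → χ t = 1 := fun t ht => by
    simp only [hχ]
    rw [min_eq_left (by linarith)]; norm_num
  set h' : ℝ → ℝ := fun t => α / 2 * exp (α * t / 2) * χ t with hh'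
  have h'c : Continuous h' := by fun_prop
  have h'c2 : Continuous (fun t => h' t ^ 2) := by fun_prop
  have hd : ∀ t, HasDerivAt (fun t => ∫ s in (1:ℝ)..t, h' s) (h' t) t := fun t =>
    (h'c.integral_hasStrictDerivAt 1 t).hasDerivAt
  have Hd : ∀ t, HasDerivAt (fun t => ∫ s in (1:ℝ)..t, h' s ^ 2) (h' t ^ 2) t := fun t =>
    (h'c2.integral_hasStrictDerivAt 1 t).hasDerivAt
  have hz : ∀ t ≤ 1, (∫ s in (1:ℝ)..t, h' s) = 0 := by
    intro t ht
    apply intervalIntegral.integral_zero_ae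
    filter_upwards with s hs
    rw [Set.uIoc_of_ge ht] at hs
    simp [hh', χz s hs.2]
  have Hz : ∀ t ≤ 1, (∫ s in (1:ℝ)..t, h' s ^ 2) = 0 := by
    intro t ht
    apply intervalIntegral.integral_zero_ae
    filter_upwards with s hs
    rw [Set.uIoc_of_ge ht] at hs
    simp [hh', χz s hs.2]
  have h'0 : ∀ t, 0 ≤ h' t := fun t => mul_nonneg (by positivity) (χ0 t)
  have hn : ∀ t, 0 ≤ ∫ s in (1:ℝ)..t, h' s := by
    intro t
    rcases le_total t 1 with ht | ht
    · rw [hz t ht]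
    · exact intervalIntegral.integral_nonneg ht (fun s _ => h'0 s)
  have ed : ∀ t, HasDerivAt (fun t => exp (α * t / 2)) (α / 2 * exp (α * t / 2)) t := by
    intro t
    have : HasDerivAt (fun t : ℝ => α * t / 2) (α * 1 / 2) t :=
      ((hasDerivAt_id t).const_mul α).div_const 2
    convert this.exp using 1; ring
  have ed2 : ∀ t, HasDerivAt (fun t => α / 4 * exp (α * t)) (α / 4 * (exp (α * t) * (α * 1))) t := by
    intro t
    have : HasDerivAt (fun t : ℝ => α * t) (α * 1) t :=
      ((hasDerivAt_id t).const_mul α)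
    exact this.exp.const_mul _
  refine ⟨_, h', _, exp α, ?_, ?_, hd, Hd, hz, Hz, hn, by positivity, ?_, ?_⟩
  · rw [contDiff_one_iff_deriv]
    refine ⟨fun t => (hd t).differentiableAt, ?_⟩
    rwa [show deriv _ = h' from funext fun t => (hd t).deriv]
  · rw [contDiff_one_iff_deriv]
    refine ⟨fun t => (Hd t).differentiableAt, ?_⟩
    rwa [show deriv _ = fun t => h' t ^ 2 from funext fun t => (Hd t).deriv]
  · intro t
    rcases le_total t 2 with ht | ht
    · have : exp (α * t / 2) ≤ exp α := exp_le_exp.2 (by nlinarith)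
      linarith [hn t]
    · have hm : MonotoneOn (fun t => (∫ s in (1:ℝ)..t, h' s) - exp (α * t / 2)) (Set.Ici 2) := by
        have hD : ∀ t, HasDerivAt (fun t => (∫ s in (1:ℝ)..t, h' s) - exp (α * t / 2))
          (h' t - α / 2 * exp (α * t / 2)) t := fun t => (hd t).sub (ed t)
        apply monotoneOn_of_deriv_nonneg (convex_Ici 2)
        · exact fun t _ => (hD t).continuousAt.continuousWithinAt
        · exact fun t _ => (hD t).differentiableAt.differentiableWithinAt
        · intro t ht
          rw [interior_Ici] at ht
          rw [(hD t).deriv]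
          simp [hh', χo t (le_of_lt ht)]
      have := hm (Set.self_mem_Ici) ht ht
      simp only at this
      have e2 : α * 2 / 2 = α := by ring
      rw [e2] at this
      linarith [hn 2]
  · intro t
    have hD : ∀ t, HasDerivAt (fun t => α / 4 * exp (α * t) - (∫ s in (1:ℝ)..t, h' s ^ 2))
          (α / 4 * (exp (α * t) * (α * 1)) - h' t ^ 2) t := fun t => (ed2 t).sub (Hd t)
    have hm : Monotone (fun t => α / 4 * exp (α * t) - (∫ s in (1:ℝ)..t, h' s ^ 2)) := by
      apply monotone_of_deriv_nonneg (fun t => (hD t).differentiableAt)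
      intro t
      rw [(hD t).deriv]
      have e3 : exp (α * t) = exp (α * t / 2) ^ 2 := by
        rw [← exp_nat_mul]; congr 1; push_cast; ring
      have : h' t ^ 2 = α ^ 2 / 4 * exp (α * t) * χ t ^ 2 := by rw [e3]; simp only [hh']; ring
      rw [this]
      have h1 : χ t ^ 2 ≤ 1 := by nlinarith [χ0 t, χ1 t]
      have h2 : 0 ≤ α ^ 2 / 4 * exp (α * t) := by positivity
      nlinarith
    rcases le_total t 1 with ht | ht
    · rw [Hz t ht]; positivity
    · have := hm ht
      simp only at this
      rw [Hz 1 le_rfl] at this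
      have : 0 ≤ α / 4 * exp (α * 1) := by positivity
      linarith

lemma second_deriv_nonneg {g g' : ℝ → ℝ} {c : ℝ} (hg : ∀ᶠ t in nhds 0, HasDerivAt g (g' t) t)
    (hg' : HasDerivAt g' c 0) (hm : IsLocalMin g 0) : 0 ≤ c := by
  by_contra hc
  push Not at hc
  have e1 : deriv g =ᶠ[nhds 0] g' := hg.mono fun t ht => ht.deriv
  have e2 : deriv (deriv g) 0 = c := by rw [e1.deriv_eq, hg'.deriv]
  have hM : IsLocalMax g 0 := isLocalMax_of_deriv_deriv_neg (by rw [e2]; exact hc)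
    hm.deriv_eq_zero hg.self_of_nhds.continuousAt
  have e3 : g =ᶠ[nhds 0] fun _ => g 0 := by
    filter_upwards [hm, hM] with t h1 h2 using le_antisymm h2 h1
  have e4 : deriv g =ᶠ[nhds 0] deriv (fun _ => g 0) := e3.deriv
  rw [e4.deriv_eq] at e2
  simp at e2
  linarith

lemma pointwise_bound (α K κ0 : ℝ) (h1 : 1 / 2 < α) (h4 : α < 4) (hκ0 : 0 < κ0) :
    ∃ c M : ℝ, 0 < c ∧ ∀ u v κ a b : ℝ, u ≤ v → κ0 ≤ κ → κ ≤ 1 → 0 ≤ a → 0 ≤ b →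
      exp (α * u / 2) ≤ a + K → exp (α * v / 2) ≤ b + K →
      c * exp ((α + 1) * u) - M ≤ exp ((u + v) / 2) * (a ^ 2 + κ * b ^ 2)
        - α / 4 * (exp ((u + v) / 2) * (exp (α * u) + κ * exp (α * v))) := by
  -- square bound
  obtain ⟨d, hd⟩ : ∃ d, d = 1 - α / 4 := ⟨_, rfl⟩
  have hd0 : 0 < d := by rw [hd]; linarith
  -- e^2 (1 - d/2) ≤ a^2 + Q
  set Q := 2 * K ^ 2 / d with hQ
  have sq : ∀ e a : ℝ, 0 ≤ e → 0 ≤ a → e ≤ a + K → e ^ 2 * (1 - d / 2) - Q ≤ a ^ 2 := by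
    intro e a he ha hea
    rcases le_total e K with h | h
    · have : e ^ 2 ≤ K ^ 2 := by nlinarith
      have hd1 : d < 1 := by rw [hd]; linarith
      have : K ^ 2 ≤ Q := by
        rw [hQ, le_div_iff₀ hd0]; nlinarith [sq_nonneg K]
      have h5 : 0 ≤ e ^ 2 * d := by positivity
      linarith [sq_nonneg a]
    · have hsq : (e - K) ^ 2 ≤ a ^ 2 := by
        apply pow_le_pow_left₀ <;> linarith
      have hQd : Q * d = 2 * K ^ 2 := by rw [hQ]; field_simp
      -- 2 e K ≤ d/2 e^2 + 2/d K^2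
      have : 2 * e * K ≤ d / 2 * e ^ 2 + Q := by
        by_contra hcon
        push Not at hcon
        nlinarith [sq_nonneg (d * e - 2 * K)]
      nlinarith [sq_nonneg K]
  have hQ0 : 0 ≤ Q := by rw [hQ]; positivity
  set T := 4 * Q / (κ0 * d) with hT
  have hT0 : 0 ≤ T := by positivity
  refine ⟨d / 2, 2 * Q * (1 + T) ^ (1 / α), by positivity, ?_⟩
  intro u v κ a b huv hk hk1 ha hb hau hbv
  have eu : exp (α * u / 2) ^ 2 = exp (α * u) := by
    rw [← exp_nat_mul]; congr 1; push_cast; ring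
  have ev : exp (α * v / 2) ^ 2 = exp (α * v) := by
    rw [← exp_nat_mul]; congr 1; push_cast; ring
  have A := sq _ a (exp_pos (α * u / 2)).le ha hau
  have B := sq _ b (exp_pos (α * v / 2)).le hb hbv
  rw [eu] at A
  rw [ev] at B
  have hE : exp u ≤ exp ((u + v) / 2) := exp_le_exp.2 (by linarith)
  have hE2 : exp ((u + v) / 2) ≤ exp v := exp_le_exp.2 (by linarith)
  have E0 := exp_pos ((u + v) / 2)
  have hs : exp ((α + 1) * u) = exp u * exp (α * u) := by rw [← exp_add]; congr 1; ring
  have hsb : exp u * exp (α * u) ≤ exp ((u + v) / 2) * exp (α * u) :=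
    mul_le_mul_of_nonneg_right hE (exp_pos _).le
  set E := exp ((u + v) / 2)
  have key : E * (2 * Q) - 2 * Q * (1 + T) ^ (1 / α) ≤ E * (d / 2 * κ * exp (α * v)) := by
    rcases le_total (exp (α * v)) (1 + T) with h | h
    · have hv : exp v ≤ (1 + T) ^ (1 / α) := by
        have : exp v = (exp (α * v)) ^ (1 / α) := by
          rw [← exp_mul]; congr 1; field_simp
        rw [this]
        exact rpow_le_rpow (exp_pos _).le h (by positivity)
      have : E * (2 * Q) ≤ 2 * Q * (1 + T) ^ (1 / α) := by nlinarith
      have : 0 ≤ E * (d / 2 * κ * exp (α * v)) := by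
        have : 0 < κ := by linarith
        positivity
      linarith
    · have hp : 0 ≤ 2 * Q * (1 + T) ^ (1 / α) := by positivity
      have : 2 * Q ≤ d / 2 * κ * exp (α * v) := by
        have t1 : T * (κ0 * d) = 4 * Q := by rw [hT]; field_simp
        have t2 : κ0 * d * T ≤ κ * d * exp (α * v) := by
          apply mul_le_mul _ (by linarith) hT0
          · have : 0 < κ := by linarith
            positivity
          · nlinarith
        nlinarith
      nlinarith
  have hκ : 0 < κ := by linarith
  have A' := mul_le_mul_of_nonneg_left A E0.le
  have B' := mul_le_mul_of_nonneg_left (mul_le_mul_of_nonneg_left B hκ.le) E0.le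
  have hQk : E * (κ * Q) ≤ E * Q := mul_le_mul_of_nonneg_left (by nlinarith) E0.le
  rw [hs, show α / 4 = 1 - d by rw [hd]; ring]
  have hC := mul_le_mul_of_nonneg_left hsb (by positivity : 0 ≤ d / 2)
  clear_value E Q T
  linarith

lemma exp_ineq (α σ u v : ℝ) (h1 : 1 / 2 < α) :
    exp (-σ) * (exp v * exp (α * u)) + exp (-(2 * α * σ)) * (exp σ * (exp u * exp (α * v)))
    ≤ exp ((u + v) / 2) * (exp (α * u) + exp (-(2 * α * σ)) * exp (α * v)) := by
  set d := (v - u) / 2 - σ with hd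
  have e1 : exp (-σ) * (exp v * exp (α * u)) = exp ((u + v) / 2 + α * u) * exp d := by
    simp only [← exp_add]; congr 1; rw [hd]; ring
  have e2 : exp (-(2 * α * σ)) * (exp σ * (exp u * exp (α * v)))
      = exp ((u + v) / 2 + α * u) * exp ((2 * α - 1) * d) := by
    simp only [← exp_add]; congr 1; rw [hd]; ring
  have e3 : exp ((u + v) / 2) * (exp (α * u) + exp (-(2 * α * σ)) * exp (α * v))
      = exp ((u + v) / 2 + α * u) * (1 + exp d * exp ((2 * α - 1) * d)) := by
    rw [mul_add, mul_add]; simp only [← exp_add, mul_one]; congr 2; rw [hd]; ring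
  rw [e1, e2, e3, ← mul_add]
  apply mul_le_mul_of_nonneg_left _ (exp_pos _).le
  have : 0 ≤ (1 - exp d) * (1 - exp ((2 * α - 1) * d)) := by
    rcases le_total d 0 with h | h
    · apply mul_nonneg <;> rw [sub_nonneg, exp_le_one_iff]
      · exact h
      · nlinarith
    · apply mul_nonneg_of_nonpos_of_nonpos <;> rw [sub_nonpos, one_le_exp_iff]
      · exact h
      · nlinarith
  nlinarith

lemma div_zero_int {N : ℕ} {Ω K : Set (EuclideanSpace ℝ (Fin N))} (hΩ : IsOpen Ω)
    (hK : IsCompact K) (hKΩ : K ⊆ Ω) {g : EuclideanSpace ℝ (Fin N) → ℝ}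
    (hg : ∀ x ∈ Ω, ContDiffAt ℝ 1 g x) (hz : ∀ x ∈ Ω, x ∉ K → g x = 0)
    (e : EuclideanSpace ℝ (Fin N)) :
    IntegrableOn (fun x => fderiv ℝ g x e) Ω ∧ ∫ x in Ω, fderiv ℝ g x e = 0 := by
  set G := Ω.indicator g with hG
  have Gz : ∀ x, x ∉ K → G x = 0 := by
    intro x hx
    by_cases h : x ∈ Ω
    · rw [hG, Set.indicator_of_mem h, hz x h hx]
    · rw [hG, Set.indicator_of_notMem h]
  have Ge : ∀ x ∈ Ω, G =ᶠ[nhds x] g := by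
    intro x hx
    filter_upwards [hΩ.mem_nhds hx] with y hy
    rw [hG, Set.indicator_of_mem hy]
  have Ge0 : ∀ x, x ∉ K → G =ᶠ[nhds x] fun _ => 0 := by
    intro x hx
    filter_upwards [hK.isClosed.isOpen_compl.mem_nhds hx] with y hy
    exact Gz y hy
  have Gc : ContDiff ℝ 1 G := by
    rw [contDiff_iff_contDiffAt]
    intro x
    by_cases h : x ∈ Ω
    · exact (hg x h).congr_of_eventuallyEq (Ge x h)
    · exact contDiffAt_const.congr_of_eventuallyEq (Ge0 x (fun hk => h (hKΩ hk)))
  have Gs : HasCompactSupport G := HasCompactSupport.intro hK (fun {x} hx => Gz x hx)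
  have dc : Continuous (fun x => fderiv ℝ G x e) :=
    (Gc.continuous_fderiv (by norm_num)).clm_apply continuous_const
  have ds : HasCompactSupport (fun x => fderiv ℝ G x e) := by
    apply HasCompactSupport.intro hK
    intro x hx
    rw [(Ge0 x hx).fderiv_eq]; simp
  have di : Integrable (fun x => fderiv ℝ G x e) := dc.integrable_of_hasCompactSupport ds
  have ind : (fun x => fderiv ℝ G x e) = Ω.indicator (fun x => fderiv ℝ g x e) := by
    funext x
    by_cases h : x ∈ Ω
    · rw [Set.indicator_of_mem h, (Ge x h).fderiv_eq]
    · rw [Set.indicator_of_notMem h, (Ge0 x (fun hk => h (hKΩ hk))).fderiv_eq]; simp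
  have hI : ∫ x, fderiv ℝ G x e = 0 := by
    have := integral_mul_fderiv_eq_neg_fderiv_mul_of_integrable (μ := volume) (𝕜 := ℝ)
      (f := fun _ : EuclideanSpace ℝ (Fin N) => (1 : ℝ)) (g := G) (v := e) (by simp)
      (by simpa using di) (by simpa using Gc.continuous.integrable_of_hasCompactSupport Gs)
      (fun x _ => differentiableAt_const _) (fun x _ => (Gc.differentiable (by norm_num)) x)
    simpa using this
  constructor
  · rw [← integrable_indicator_iff hΩ.measurableSet, ← ind]; exact di
  · rw [← integral_indicator hΩ.measurableSet, ← ind]; exact hI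

/-- Green formula. -/
lemma green {N : ℕ} {Ω K : Set (EuclideanSpace ℝ (Fin N))} (hΩ : IsOpen Ω)
    (hK : IsCompact K) (hKΩ : K ⊆ Ω) {g f : EuclideanSpace ℝ (Fin N) → ℝ}
    (hg : ∀ x ∈ Ω, ContDiffAt ℝ 1 g x) (hz : ∀ x ∈ Ω, x ∉ K → g x = 0)
    (hf : ∀ x ∈ Ω, ContDiffAt ℝ 2 f x) :
    IntegrableOn (fun x => g x * lap f x + ∑ i, fderiv ℝ g x (EuclideanSpace.single i 1) *
      fderiv ℝ f x (EuclideanSpace.single i 1)) Ω ∧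
    ∫ x in Ω, (g x * lap f x + ∑ i, fderiv ℝ g x (EuclideanSpace.single i 1) *
      fderiv ℝ f x (EuclideanSpace.single i 1)) = 0 := by
  have hf1 : ∀ i : Fin N, ∀ x ∈ Ω,
      ContDiffAt ℝ 1 (fun y => fderiv ℝ f y (EuclideanSpace.single i 1)) x := by
    intro i x hx
    exact ((hf x hx).fderiv_right (m := 1) (by norm_num)).clm_apply contDiffAt_const
  have D := fun i : Fin N => div_zero_int hΩ hK hKΩ
    (g := fun y => g y * fderiv ℝ f y (EuclideanSpace.single i 1))
    (fun x hx => (hg x hx).mul (hf1 i x hx))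
    (fun x hx hxK => by simp [hz x hx hxK]) (EuclideanSpace.single i 1)
  have e : ∀ x ∈ Ω, ∑ i : Fin N, fderiv ℝ
      (fun y => g y * fderiv ℝ f y (EuclideanSpace.single i 1)) x (EuclideanSpace.single i 1) =
      g x * lap f x + ∑ i, fderiv ℝ g x (EuclideanSpace.single i 1) *
      fderiv ℝ f x (EuclideanSpace.single i 1) := by
    intro x hx
    rw [lap, Finset.mul_sum, ← Finset.sum_add_distrib]
    refine Finset.sum_congr rfl fun i _ => ?_
    rw [fderiv_fun_mul ((hg x hx).differentiableAt (by norm_num))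
      ((hf1 i x hx).differentiableAt (by norm_num))]
    simp; ring
  have hint : IntegrableOn (fun x => ∑ i : Fin N, fderiv ℝ
      (fun y => g y * fderiv ℝ f y (EuclideanSpace.single i 1)) x
      (EuclideanSpace.single i 1)) Ω := integrable_finsetSum _ fun i _ => (D i).1
  constructor
  · exact hint.congr_fun e hΩ.measurableSet
  · rw [← setIntegral_congr_fun hΩ.measurableSet e, integral_finsetSum _ fun i _ => (D i).1]
    exact Finset.sum_eq_zero fun i _ => (D i).2

lemma lap_sub_eq {N : ℕ} {u v : EuclideanSpace ℝ (Fin N) → ℝ} {x : EuclideanSpace ℝ (Fin N)}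
    (hu : ContDiffAt ℝ 2 u x) (hv : ContDiffAt ℝ 2 v x) :
    lap (fun y => v y - u y) x = lap v x - lap u x := by
  rw [lap, lap, lap, ← Finset.sum_sub_distrib]
  refine Finset.sum_congr rfl fun i _ => ?_
  have e : (fun y => fderiv ℝ (fun y => v y - u y) y (EuclideanSpace.single i 1)) =ᶠ[nhds x]
      fun y => fderiv ℝ v y (EuclideanSpace.single i 1) -
        fderiv ℝ u y (EuclideanSpace.single i 1) := by
    filter_upwards [hu.eventually (by simp), hv.eventually (by simp)] with y h1 h2
    rw [fderiv_fun_sub (h2.differentiableAt (by norm_num)) (h1.differentiableAt (by norm_num))]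
    simp
  have d : ∀ f : EuclideanSpace ℝ (Fin N) → ℝ, ContDiffAt ℝ 2 f x →
      DifferentiableAt ℝ (fun y => fderiv ℝ f y (EuclideanSpace.single i 1)) x := fun f hf =>
    (((hf.fderiv_right (m := 1) (by norm_num)).clm_apply contDiffAt_const).differentiableAt
      (by norm_num))
  rw [e.fderiv_eq, fderiv_fun_sub (d v hv) (d u hu)]
  simp

lemma lap_nonneg_of_isLocalMin {N : ℕ} {w : EuclideanSpace ℝ (Fin N) → ℝ}
    {x : EuclideanSpace ℝ (Fin N)} (hw : ContDiffAt ℝ 2 w x) (hm : IsLocalMin w x) :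
    0 ≤ lap w x := by
  apply Finset.sum_nonneg
  intro i _
  set e : EuclideanSpace ℝ (Fin N) := EuclideanSpace.single i 1
  have l : ∀ t : ℝ, HasDerivAt (fun t : ℝ => x + t • e) e t := by
    intro t
    simpa using ((hasDerivAt_id t).smul_const e).const_add x
  have lc : Filter.Tendsto (fun t : ℝ => x + t • e) (nhds 0) (nhds x) := by
    have := (l 0).continuousAt.tendsto
    simpa using this
  apply second_deriv_nonneg (g := fun t => w (x + t • e)) (g' := fun t => fderiv ℝ w (x + t • e) e)
  · have h := lc.eventually (hw.eventually (by simp))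
    filter_upwards [h] with t ht
    exact (ht.differentiableAt (by norm_num)).hasFDerivAt.comp_hasDerivAt t (l t)
  · have d : DifferentiableAt ℝ (fun y => fderiv ℝ w y e) x :=
      (((hw.fderiv_right (m := 1) (by norm_num)).clm_apply contDiffAt_const).differentiableAt
      (by norm_num))
    have d' : HasFDerivAt (fun y => fderiv ℝ w y e) (fderiv ℝ (fun y => fderiv ℝ w y e) x)
        (x + (0:ℝ) • e) := by simpa using d.hasFDerivAt
    exact d'.comp_hasDerivAt 0 (l 0)
  · have h := lc.eventually hm
    filter_upwards [h] with t ht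
    simpa using ht

lemma max_principle {N : ℕ} {Ω : Set (EuclideanSpace ℝ (Fin N))} (hΩ : IsOpen Ω)
    (hb : Bornology.IsBounded Ω) {w : EuclideanSpace ℝ (Fin N) → ℝ}
    (hc : ContinuousOn w (closure Ω)) (hw : ∀ x ∈ Ω, ContDiffAt ℝ 2 w x)
    (h0 : ∀ x ∈ frontier Ω, w x = 0) (hl : ∀ x ∈ Ω, w x < 0 → lap w x < 0) :
    ∀ x ∈ Ω, 0 ≤ w x := by
  intro x hx
  by_contra hn
  push Not at hn
  obtain ⟨y, hy, hmin⟩ := hb.isCompact_closure.exists_isMinOn ⟨x, subset_closure hx⟩ hc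
  have hyn : w y < 0 := (hmin (subset_closure hx)).trans_lt hn
  have hyΩ : y ∈ Ω := by
    by_contra h
    have : y ∈ frontier Ω := by rw [hΩ.frontier_eq]; exact ⟨hy, h⟩
    rw [h0 y this] at hyn
    exact lt_irrefl _ hyn
  have hloc : IsLocalMin w y := by
    filter_upwards [hΩ.mem_nhds hyΩ] with z hz using hmin (subset_closure hz)
  exact absurd (lap_nonneg_of_isLocalMin (hw y hyΩ) hloc) (not_le.2 (hl y hyΩ hyn))

lemma test_term {N : ℕ} {u φ : EuclideanSpace ℝ (Fin N) → ℝ} {x : EuclideanSpace ℝ (Fin N)}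
    {h : ℝ → ℝ} {c : ℝ} (hu : DifferentiableAt ℝ u x) (hφ : DifferentiableAt ℝ φ x)
    (hh : HasDerivAt h c (u x)) (hp : 0 < φ x) :
    ∑ i : Fin N, fderiv ℝ (fun y => h (u y) ^ 2 / φ y) x (EuclideanSpace.single i 1) *
      fderiv ℝ φ x (EuclideanSpace.single i 1) ≤
    ∑ i : Fin N, c ^ 2 * fderiv ℝ u x (EuclideanSpace.single i 1) ^ 2 := by
  apply Finset.sum_le_sum
  intro i _
  set e : EuclideanSpace ℝ (Fin N) := EuclideanSpace.single i 1
  have h1 : HasFDerivAt (fun y => h (u y)) (c • fderiv ℝ u x) x :=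
    hh.comp_hasFDerivAt x hu.hasFDerivAt
  have h2 : HasFDerivAt (fun y => h (u y) ^ 2) ((2 * h (u x)) • (c • fderiv ℝ u x)) x := by
    simpa using h1.pow 2
  have h3 : HasFDerivAt (fun y => (φ y)⁻¹) ((-(φ x ^ 2)⁻¹) • fderiv ℝ φ x) x :=
    (hasDerivAt_inv hp.ne').comp_hasFDerivAt x hφ.hasFDerivAt
  have h4 := h2.mul h3
  have h5 : fderiv ℝ (fun y => h (u y) ^ 2 / φ y) x e =
      2 * h (u x) * c * fderiv ℝ u x e / φ x - h (u x) ^ 2 * fderiv ℝ φ x e / φ x ^ 2 := by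
    have : (fun y => h (u y) ^ 2 / φ y) = (fun y => h (u y) ^ 2) * fun y => (φ y)⁻¹ := by
      funext y; simp [div_eq_mul_inv]
    rw [this, h4.fderiv]
    simp; field_simp; ring
  rw [h5]
  set a := fderiv ℝ u x e
  set b := fderiv ℝ φ x e
  have : c ^ 2 * a ^ 2 - (2 * h (u x) * c * a / φ x - h (u x) ^ 2 * b / φ x ^ 2) * b =
      (c * a - h (u x) * b / φ x) ^ 2 := by field_simp; ring
  nlinarith [sq_nonneg (c * a - h (u x) * b / φ x)]

lemma amgm_term (lam mu u v φ ψ : ℝ) (hl : 0 < lam) (hm : 0 < mu) (hφ : 0 < φ) (hψ : 0 < ψ) :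
    √(lam * mu) * exp ((u + v) / 2) ≤
      (mu * exp v * ψ / φ + lam * exp u * φ / ψ) / 2 := by
  have h1 : √(lam * mu) * exp ((u + v) / 2) =
      √((mu * exp v * ψ / φ) * (lam * exp u * φ / ψ)) := by
    have : (mu * exp v * ψ / φ) * (lam * exp u * φ / ψ) =
        (lam * mu) * exp ((u + v) / 2) ^ 2 := by
      have : exp ((u + v) / 2) ^ 2 = exp u * exp v := by
        rw [← exp_nat_mul, ← exp_add]; congr 1; push_cast; ring
      rw [this]; field_simp
    rw [this, sqrt_mul (by positivity) (exp ((u + v) / 2) ^ 2), sqrt_sq (exp_pos _).le]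
  rw [h1]
  set A := mu * exp v * ψ / φ
  set B := lam * exp u * φ / ψ
  have hA : 0 < A := by positivity
  have hB : 0 < B := by positivity
  rw [sqrt_le_left (by positivity)]
  nlinarith [sq_nonneg (A - B)]

lemma stab {N : ℕ} {Ω : Set (EuclideanSpace ℝ (Fin N))} (hΩ : IsOpen Ω)
    (hb : Bornology.IsBounded Ω) {lam mu lam1 : ℝ} (hl : 0 < lam) (hm : 0 < mu)
    (hl1 : 0 ≤ lam1) {u v φ ψ : EuclideanSpace ℝ (Fin N) → ℝ}
    (uc : ContinuousOn u (closure Ω)) (vc : ContinuousOn v (closure Ω))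
    (u2 : ∀ x ∈ Ω, ContDiffAt ℝ 2 u x)
    (φ2 : ∀ x ∈ Ω, ContDiffAt ℝ 2 φ x) (ψ2 : ∀ x ∈ Ω, ContDiffAt ℝ 2 ψ x)
    (ueq : ∀ x ∈ Ω, -lap u x = mu * exp (v x)) (u0 : ∀ x ∈ frontier Ω, u x = 0)
    (φp : ∀ x ∈ Ω, 0 < φ x) (ψp : ∀ x ∈ Ω, 0 < ψ x)
    (φeq : ∀ x ∈ Ω, -lap φ x - mu * exp (v x) * ψ x = lam1 * φ x)
    (ψeq : ∀ x ∈ Ω, -lap ψ x - lam * exp (u x) * φ x = lam1 * ψ x)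
    {h h' H : ℝ → ℝ} (hc : ContDiff ℝ 1 h) (Hc : ContDiff ℝ 1 H)
    (hd : ∀ t, HasDerivAt h (h' t) t) (Hd : ∀ t, HasDerivAt H (h' t ^ 2) t)
    (hz : ∀ t ≤ 1, h t = 0) (Hz : ∀ t ≤ 1, H t = 0) :
    0 ≤ ∫ x in Ω, (mu * (exp (v x) * H (u x)) -
      √(lam * mu) * (exp ((u x + v x) / 2) * h (u x) ^ 2)) := by
  set K := closure Ω ∩ u ⁻¹' Set.Ici 1 with hKdef
  have hK : IsCompact K := hb.isCompact_closure.of_isClosed_subset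
    (uc.preimage_isClosed_of_isClosed isClosed_closure isClosed_Ici) Set.inter_subset_left
  have hKΩ : K ⊆ Ω := by
    rintro x ⟨hx, h1⟩
    by_contra hn
    have : x ∈ frontier Ω := by rw [hΩ.frontier_eq]; exact ⟨hx, hn⟩
    have h2 := u0 x this
    simp only [Set.mem_preimage, Set.mem_Ici] at h1
    linarith
  have out : ∀ x ∈ Ω, x ∉ K → u x ≤ 1 := by
    intro x hx hn
    by_contra h1
    push Not at h1
    exact hn ⟨subset_closure hx, h1.le⟩
  have u1 : ∀ x ∈ Ω, ContDiffAt ℝ 1 u x := fun x hx => (u2 x hx).of_le (by norm_num)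
  have φ1 : ∀ x ∈ Ω, ContDiffAt ℝ 1 φ x := fun x hx => (φ2 x hx).of_le (by norm_num)
  have ψ1 : ∀ x ∈ Ω, ContDiffAt ℝ 1 ψ x := fun x hx => (ψ2 x hx).of_le (by norm_num)
  have hu1 : ∀ x ∈ Ω, ContDiffAt ℝ 1 (fun y => h (u y)) x := fun x hx =>
    hc.contDiffAt.comp x (u1 x hx)
  have Hu1 : ∀ x ∈ Ω, ContDiffAt ℝ 1 (fun y => H (u y)) x := fun x hx =>
    Hc.contDiffAt.comp x (u1 x hx)
  obtain ⟨i1, I1⟩ := green hΩ hK hKΩ (g := fun y => h (u y) ^ 2 / φ y) (f := φ)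
    (fun x hx => ((hu1 x hx).pow 2).div (φ1 x hx) (φp x hx).ne')
    (fun x hx hn => by simp [hz _ (out x hx hn)]) φ2
  obtain ⟨i2, I2⟩ := green hΩ hK hKΩ (g := fun y => h (u y) ^ 2 / ψ y) (f := ψ)
    (fun x hx => ((hu1 x hx).pow 2).div (ψ1 x hx) (ψp x hx).ne')
    (fun x hx hn => by simp [hz _ (out x hx hn)]) ψ2
  obtain ⟨i3, I3⟩ := green hΩ hK hKΩ (g := fun y => H (u y)) (f := u) Hu1
    (fun x hx hn => by simp [Hz _ (out x hx hn)]) u2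
  have hcc := hc.continuous
  have Hcc := Hc.continuous
  have iR : IntegrableOn (fun x => mu * (exp (v x) * H (u x)) -
      √(lam * mu) * (exp ((u x + v x) / 2) * h (u x) ^ 2)) Ω := by
    refine IntegrableOn.mono_set (ContinuousOn.integrableOn_compact hb.isCompact_closure ?_)
      subset_closure
    have a1 : ContinuousOn (fun x => H (u x)) (closure Ω) := Hcc.comp_continuousOn uc
    have a2 : ContinuousOn (fun x => h (u x)) (closure Ω) := hcc.comp_continuousOn uc
    fun_prop
  have tot := ((i1.add i2).const_mul (1/2)).sub i3
  have Itot : ∫ x in Ω, _ = _ := integral_sub ((i1.add i2).const_mul (1/2)) i3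
  rw [integral_const_mul] at Itot
  have Iadd := integral_add i1 i2
  rw [I1, I2] at Iadd
  simp only [Pi.add_apply] at Itot
  rw [Iadd, I3] at Itot
  rw [show (1 / 2 * (0 + 0) - 0 : ℝ) = 0 by norm_num] at Itot
  rw [← Itot]
  refine setIntegral_mono_on tot iR hΩ.measurableSet ?_
  intro x hx
  have du := (u1 x hx).differentiableAt (by norm_num)
  have t1 := test_term du ((φ1 x hx).differentiableAt (by norm_num)) (hd (u x)) (φp x hx)
  have t2 := test_term du ((ψ1 x hx).differentiableAt (by norm_num)) (hd (u x)) (ψp x hx)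
  have t3 : ∑ i : Fin N, fderiv ℝ (fun y => H (u y)) x (EuclideanSpace.single i 1) *
      fderiv ℝ u x (EuclideanSpace.single i 1) =
      ∑ i : Fin N, h' (u x) ^ 2 * fderiv ℝ u x (EuclideanSpace.single i 1) ^ 2 := by
    refine Finset.sum_congr rfl fun i _ => ?_
    have : HasFDerivAt (fun y => H (u y)) ((h' (u x) ^ 2) • fderiv ℝ u x) x :=
      (Hd (u x)).comp_hasFDerivAt x du.hasFDerivAt
    rw [this.fderiv]; simp; ring
  have l1 : lap φ x = -(mu * exp (v x) * ψ x) - lam1 * φ x := by linarith [φeq x hx]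
  have l2 : lap ψ x = -(lam * exp (u x) * φ x) - lam1 * ψ x := by linarith [ψeq x hx]
  have l3 : lap u x = -(mu * exp (v x)) := by linarith [ueq x hx]
  have am := mul_le_mul_of_nonneg_left
    (amgm_term lam mu (u x) (v x) (φ x) (ψ x) hl hm (φp x hx) (ψp x hx)) (sq_nonneg (h (u x)))
  have hφ := φp x hx
  have hψ := ψp x hx
  have q1 : h (u x) ^ 2 / φ x * lap φ x =
      - (h (u x) ^ 2 * (mu * exp (v x) * ψ x / φ x)) - lam1 * h (u x) ^ 2 := by
    rw [l1]; field_simp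
  have q2 : h (u x) ^ 2 / ψ x * lap ψ x =
      - (h (u x) ^ 2 * (lam * exp (u x) * φ x / ψ x)) - lam1 * h (u x) ^ 2 := by
    rw [l2]; field_simp
  have q3 : 0 ≤ lam1 * h (u x) ^ 2 := by positivity
  rw [t3, q1, q2, l3]
  linarith

set_option maxHeartbeats 1000000 in
/-- For every `1 ≤ p < 5` there is `C = C(Ω, p, Λ)` such that every stable
classical solution of the Gelfand system with `λ ≥ μ > 0` and `λ/μ + μ/λ ≤ Λ` satisfies
`∫_Ω e^{pu} ≤ C`, uniformly in `λ` and `μ`. -/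
theorem exp_Lp_bound {N : ℕ}
    (Ω : Set (EuclideanSpace ℝ (Fin N))) (hΩ : IsBoundedDomain Ω)
    (Λ : ℝ) (hΛ : 0 < Λ) :
    ∀ p : ℝ, 1 ≤ p → p < 5 →
      ∃ C : ℝ,
        ∀ (lam mu : ℝ), 0 < mu → mu ≤ lam → lam / mu + mu / lam ≤ Λ →
          ∀ (u v : EuclideanSpace ℝ (Fin N) → ℝ),
            IsStableGelfandSolution Ω lam mu u v →
            ∫ x in Ω, exp (p * u x) ≤ C := by
  intro p hp1 hp5
  obtain ⟨hO, -, hb⟩ := hΩ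
  obtain ⟨α, hα⟩ : ∃ α, α = max (p - 1) 1 := ⟨_, rfl⟩
  have hα1 : 1 ≤ α := hα ▸ le_max_right _ _
  have hαp : p - 1 ≤ α := hα ▸ le_max_left _ _
  have hα4 : α < 4 := by rw [hα]; exact max_lt (by linarith) (by norm_num)
  obtain ⟨h, h', H, K, hc, Hc, hd, Hd, hz, Hz, hn, hK, hlow, Hup⟩ := exists_h α (by linarith)
  obtain ⟨c, M, hc0, hP⟩ := pointwise_bound α K (exp (-(α * log Λ))) (by linarith) hα4 (exp_pos _)
  have hvol : volume Ω ≠ ⊤ := (hb.measure_lt_top).ne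
  refine ⟨M / c * volume.real Ω + volume.real Ω, ?_⟩
  intro lam mu hmu hml hr u v hst
  obtain ⟨⟨uC, vC, ueq, veq, u0, v0⟩, lam1, φ, ψ, hl1, φC, ψC, φp, ψp, φeq, ψeq, -, -⟩ := hst
  have hlam : 0 < lam := by linarith
  have int2 : ∀ f : EuclideanSpace ℝ (Fin N) → ℝ, ContDiffOn ℝ 2 f (closure Ω) →
      ∀ x ∈ Ω, ContDiffAt ℝ 2 f x := fun f hf x hx =>
    hf.contDiffAt (Filter.mem_of_superset (hO.mem_nhds hx) subset_closure)
  have uc := uC.continuousOn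
  have vc := vC.continuousOn
  have huv : ∀ x ∈ Ω, u x ≤ v x := by
    have := max_principle hO hb (w := fun y => v y - u y) (vc.sub uc)
      (fun x hx => (int2 v vC x hx).sub (int2 u uC x hx))
      (fun x hx => by simp [u0 x hx, v0 x hx])
      (fun x hx hneg => by
        rw [lap_sub_eq (int2 u uC x hx) (int2 v vC x hx)]
        have h1 := ueq x hx
        have h2 := veq x hx
        have h3 : exp (v x) < exp (u x) := exp_lt_exp.2 (by linarith)
        have h4 : mu * exp (v x) < lam * exp (u x) :=
          mul_lt_mul' hml h3 (exp_pos _).le hlam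
        linarith)
    intro x hx
    linarith [this x hx]
  have S1 := stab hO hb hlam hmu hl1 uc vc (int2 u uC) (int2 φ φC) (int2 ψ ψC) ueq u0 φp ψp φeq
    ψeq hc Hc hd Hd hz Hz
  have S2 := stab hO hb hmu hlam hl1 vc uc (int2 v vC) (int2 ψ ψC) (int2 φ φC) veq v0 ψp φp ψeq
    φeq hc Hc hd Hd hz Hz
  -- parameters
  set r := √(lam * mu) with hrdef
  have hr2 : √(mu * lam) = r := by rw [hrdef, mul_comm]
  rw [hr2] at S2
  have r0 : 0 < r := sqrt_pos.2 (by positivity)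
  have rr : r * r = lam * mu := mul_self_sqrt (by positivity)
  obtain ⟨σ, hσ⟩ : ∃ σ, σ = log (lam / r) := ⟨_, rfl⟩
  have eσ : exp σ = lam / r := by rw [hσ, exp_log (by positivity)]
  have eσ' : exp (-σ) = mu / r := by
    rw [exp_neg, eσ]; field_simp; nlinarith
  have rlam : r ≤ lam := by
    rw [hrdef, sqrt_le_left hlam.le]; nlinarith
  have σ0 : 0 ≤ σ := by rw [hσ]; exact log_nonneg (by rw [le_div_iff₀ r0]; linarith)
  have σΛ : 2 * σ ≤ log Λ := by
    have e1 : exp (2 * σ) = lam / mu := by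
      rw [two_mul, exp_add, eσ]; field_simp; nlinarith
    rw [le_log_iff_exp_le hΛ, e1]
    have : 0 < mu / lam := by positivity
    linarith
  obtain ⟨κ, hκ⟩ : ∃ κ, κ = exp (-(2 * α * σ)) := ⟨_, rfl⟩
  have κ1 : κ ≤ 1 := by rw [hκ, exp_le_one_iff]; nlinarith
  have κ0 : exp (-(α * log Λ)) ≤ κ := by rw [hκ, exp_le_exp]; nlinarith
  have κp : 0 < κ := by rw [hκ]; exact exp_pos _
  have hcc := hc.continuous
  have Hcc := Hc.continuous
  have a1 : ContinuousOn (fun x => H (u x)) (closure Ω) := Hcc.comp_continuousOn uc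
  have a2 : ContinuousOn (fun x => h (u x)) (closure Ω) := hcc.comp_continuousOn uc
  have a3 : ContinuousOn (fun x => H (v x)) (closure Ω) := Hcc.comp_continuousOn vc
  have a4 : ContinuousOn (fun x => h (v x)) (closure Ω) := hcc.comp_continuousOn vc
  have cint : ∀ f : EuclideanSpace ℝ (Fin N) → ℝ, ContinuousOn f (closure Ω) →
      IntegrableOn f Ω := fun f hf =>
    (ContinuousOn.integrableOn_compact hb.isCompact_closure hf).mono_set subset_closure
  have j1 : IntegrableOn (fun x => mu * (exp (v x) * H (u x)) -
      r * (exp ((u x + v x) / 2) * h (u x) ^ 2)) Ω := cint _ (by fun_prop)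
  have j2 : IntegrableOn (fun x => lam * (exp (u x) * H (v x)) -
      r * (exp ((v x + u x) / 2) * h (v x) ^ 2)) Ω := cint _ (by fun_prop)
  have j3 : IntegrableOn (fun x => exp ((α + 1) * u x)) Ω := cint _ (by fun_prop)
  have jp : IntegrableOn (fun x => exp (p * u x)) Ω := cint _ (by fun_prop)
  have jc : ∀ a : ℝ, IntegrableOn (fun _ : EuclideanSpace ℝ (Fin N) => a) Ω := fun a =>
    cint _ continuousOn_const
  have main : ∫ x in Ω, ((mu * (exp (v x) * H (u x)) -
      r * (exp ((u x + v x) / 2) * h (u x) ^ 2)) + κ * (lam * (exp (u x) * H (v x)) -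
      r * (exp ((v x + u x) / 2) * h (v x) ^ 2))) ≤
      ∫ x in Ω, (r * M - r * c * exp ((α + 1) * u x)) := by
    refine setIntegral_mono_on (j1.add (j2.const_mul κ)) ((jc _).sub (j3.const_mul _))
      hO.measurableSet ?_
    intro x hx
    have P := hP (u x) (v x) κ (h (u x)) (h (v x)) (huv x hx) κ0 κ1 (hn _) (hn _) (hlow _) (hlow _)
    have Q := exp_ineq α σ (u x) (v x) (by linarith)
    rw [← hκ, eσ, eσ'] at Q
    have P' := mul_le_mul_of_nonneg_left P r0.le
    have Q' := mul_le_mul_of_nonneg_left Q (by positivity : 0 ≤ α / 4 * r)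
    have q1 : α / 4 * r * (mu / r * (exp (v x) * exp (α * u x)) +
        κ * (lam / r * (exp (u x) * exp (α * v x)))) =
        mu * (exp (v x) * (α / 4 * exp (α * u x))) +
        κ * (lam * (exp (u x) * (α / 4 * exp (α * v x)))) := by field_simp
    rw [q1] at Q'
    have H1 : mu * (exp (v x) * H (u x)) ≤ mu * (exp (v x) * (α / 4 * exp (α * u x))) := by
      gcongr; exact Hup _
    have H2 : κ * (lam * (exp (u x) * H (v x))) ≤
        κ * (lam * (exp (u x) * (α / 4 * exp (α * v x)))) := by
      gcongr; exact Hup _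
    rw [add_comm (v x) (u x)]
    linarith
  rw [integral_add j1 (j2.const_mul κ), integral_const_mul, integral_sub (jc _) (j3.const_mul _),
    integral_const_mul (r * c), setIntegral_const, smul_eq_mul] at main
  have S2' := mul_nonneg κp.le S2
  have fin : c * ∫ x in Ω, exp ((α + 1) * u x) ≤ M * volume.real Ω := by
    have : r * (c * ∫ x in Ω, exp ((α + 1) * u x)) ≤ r * (M * volume.real Ω) := by linarith
    exact le_of_mul_le_mul_left this r0
  have fin2 : ∫ x in Ω, exp ((α + 1) * u x) ≤ M / c * volume.real Ω := by
    rw [div_mul_eq_mul_div, le_div_iff₀ hc0]; linarith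
  have last : ∫ x in Ω, exp (p * u x) ≤ ∫ x in Ω, (exp ((α + 1) * u x) + 1) := by
    refine setIntegral_mono_on jp (j3.add (jc 1)) hO.measurableSet ?_
    intro x _
    rcases le_total (u x) 0 with h0 | h0
    · have : exp (p * u x) ≤ 1 := exp_le_one_iff.2
        (mul_nonpos_of_nonneg_of_nonpos (by linarith) h0)
      linarith [exp_pos ((α + 1) * u x)]
    · have : exp (p * u x) ≤ exp ((α + 1) * u x) := exp_le_exp.2
        (mul_le_mul_of_nonneg_right (by linarith) h0)
      linarith
  rw [integral_add j3 (jc 1), setIntegral_const, smul_eq_mul] at last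
  linarith
end
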